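/- arXiv:1003.0544 — 3 statements merged into one kernel-verified Lean document; each statement's English description precedes it below -/
import Mathlib

section
/- Let R be a Gorenstein local ring and I an ideal with grade(I) = 1 and β_1^R(I) - β_0^R(I) = -1 (so that pd_R I = 1). Then the canonical module ω_{R/I} of R/I is cyclic and isomorphic to R/I^unm. -/
open CategoryTheory IsLocalRing RingTheory.Sequence

noncomputable section

variable (R : Type) [CommRing R]

/-- `Tor_n^R(M, N)` as an object of `ModuleCat R`. -/
def TorM (n : ℕ) (M N : ModuleCat R) : ModuleCat R :=
  ((Tor (ModuleCat R) n).obj M).obj N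

/-- `Ext_R^n(M, N)` as an object of `ModuleCat R`. -/
def ExtM (n : ℕ) (M N : ModuleCat R) : ModuleCat R :=
  ((Ext R (ModuleCat R) n).obj (Opposite.op M)).obj N

/-- `b` is the `j`-th Betti number of `M`, i.e. `Tor_j(k, M) ≅ k^b`. -/
def HasBetti [IsLocalRing R] (M : ModuleCat R) (j b : ℕ) : Prop :=
  Nonempty (TorM R j (ModuleCat.of R (ResidueField R)) M ≅
    ModuleCat.of R (Fin b → ResidueField R))

/-- `b` is the `j`-th Bass number of `M`, i.e. `Ext^j(k, M) ≅ k^b`. -/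
def HasBass [IsLocalRing R] (M : ModuleCat R) (j b : ℕ) : Prop :=
  Nonempty (ExtM R j (ModuleCat.of R (ResidueField R)) M ≅
    ModuleCat.of R (Fin b → ResidueField R))

/-- Projective dimension at most `n`: all `Ext^m(M, -)` vanish for `m > n`. -/
def ProjDimLE (M : ModuleCat R) (n : ℕ) : Prop :=
  ∀ m > n, ∀ N : ModuleCat R, Limits.IsZero (ExtM R m M N)

def ProjDimEq (M : ModuleCat R) (n : ℕ) : Prop :=
  ProjDimLE R M n ∧ ∀ m : ℕ, ProjDimLE R M m → n ≤ m

/-- The ideal `I` contains a regular sequence of length `g`. -/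
def GradeGE (I : Ideal R) (g : ℕ) : Prop :=
  ∃ rs : List R, rs.length = g ∧ (∀ x ∈ rs, x ∈ I) ∧ IsRegular R rs

/-- `grade I = g`. -/
def GradeEq (I : Ideal R) (g : ℕ) : Prop :=
  GradeGE R I g ∧ ∀ rs : List R, (∀ x ∈ rs, x ∈ I) → IsRegular R rs → rs.length ≤ g

/-- The height of a prime ideal, as the Krull dimension of the localization. -/
def primeHt (p : Ideal R) [p.IsPrime] : WithBot (WithTop ℕ) :=
  ringKrullDim (Localization.AtPrime p)

/-- The height of an ideal: the infimum of heights of minimal primes over it. -/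
def idealHt (I : Ideal R) : WithBot (WithTop ℕ) :=
  sInf { h | ∃ p : PrimeSpectrum R, p.asIdeal ∈ I.minimalPrimes ∧
    ringKrullDim (Localization.AtPrime p.asIdeal) = h }

/-- The `p`-primary component of `I` (contraction of the extension to `R_p`). -/
def primaryComponent (I p : Ideal R) [p.IsPrime] : Ideal R :=
  (I.map (algebraMap R (Localization.AtPrime p))).comap
    (algebraMap R (Localization.AtPrime p))

/-- The unmixed part of `I`: intersection of the primary components at the
minimal primes of minimal height. -/
def unmixedPart (I : Ideal R) : Ideal R :=
  ⨅ p : { p : PrimeSpectrum R // p.asIdeal ∈ I.minimalPrimes ∧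
      ringKrullDim (Localization.AtPrime p.asIdeal) = idealHt R I },
    primaryComponent R I p.1.asIdeal

/-- The quotient `R ⧸ J` is a Cohen-Macaulay module over the local ring `R`. -/
def IsCMQuot [IsLocalRing R] (J : Ideal R) : Prop :=
  ∃ rs : List R, (∀ x ∈ rs, x ∈ maximalIdeal R) ∧ IsRegular (R ⧸ J) rs ∧
    (rs.length : WithBot (WithTop ℕ)) = ringKrullDim (R ⧸ J)

/-- A Cohen-Macaulay local ring. -/
def IsCMLocalRing [IsLocalRing R] : Prop := IsCMQuot R ⊥

/-- A Gorenstein local ring: Cohen-Macaulay of type 1. -/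
def IsGorensteinLocalRing [IsLocalRing R] : Prop :=
  IsCMLocalRing R ∧ ∃ d : ℕ, (d : WithBot (WithTop ℕ)) = ringKrullDim R ∧
    HasBass R (ModuleCat.of R R) d 1

/-- `M` has rank `r`: `M ⊗ Q` is free of rank `r` over the total quotient ring `Q`. -/
def HasRank (M : Type) [AddCommGroup M] [Module R M] (r : ℕ) : Prop :=
  Nonempty (LocalizedModule (nonZeroDivisors R) M ≃ₗ[Localization (nonZeroDivisors R)]
    (Fin r → Localization (nonZeroDivisors R)))

end

section LeftDerived

open CategoryTheory.Limits

universe v₁ v₂ u₁ u₂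

variable {C : Type u₁} [Category.{v₁} C] [Abelian C] {D : Type u₂} [Category.{v₂} D] [Abelian D]

/-- The augmentation of a projective resolution, as a morphism to the resolved object. -/
def augmentation {Z : C} (P : ProjectiveResolution Z) : P.complex.X 0 ⟶ Z := P.π.f 0

lemma d_comp_augmentation {Z : C} (P : ProjectiveResolution Z) :
    P.complex.d 1 0 ≫ augmentation P = 0 :=
  P.complex_d_comp_π_f_zero

instance {Z : C} (P : ProjectiveResolution Z) : Epi (augmentation P) :=
  inferInstanceAs (Epi (P.π.f 0))

noncomputable def isColimitAugmentation {Z : C} (P : ProjectiveResolution Z) :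
    IsColimit (CokernelCofork.ofπ (augmentation P) (d_comp_augmentation P)) :=
  P.isColimitCokernelCofork

lemma exact_of_epi_comp {S : ShortComplex C} (hS : S.Exact) {X : C} (p : X ⟶ S.X₁) [Epi p] :
    (ShortComplex.mk (p ≫ S.f) S.g (by rw [Category.assoc, S.zero, comp_zero])).Exact := by
  let φ : ShortComplex.mk (p ≫ S.f) S.g (by rw [Category.assoc, S.zero, comp_zero]) ⟶ S :=
    { τ₁ := p, τ₂ := 𝟙 _, τ₃ := 𝟙 _ }
  have : Epi φ.τ₁ := ‹Epi p›
  have : IsIso φ.τ₂ := inferInstanceAs (IsIso (𝟙 _))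
  have : Mono φ.τ₃ := inferInstanceAs (Mono (𝟙 _))
  exact (ShortComplex.exact_iff_of_epi_of_isIso_of_mono φ).2 hS

lemma exact_comp_of_mono {S : ShortComplex C} (hS : S.Exact) {X : C} (i : S.X₃ ⟶ X) [Mono i] :
    (ShortComplex.mk S.f (S.g ≫ i) (by rw [← Category.assoc, S.zero, zero_comp])).Exact := by
  let φ : S ⟶ ShortComplex.mk S.f (S.g ≫ i) (by rw [← Category.assoc, S.zero, zero_comp]) :=
    { τ₁ := 𝟙 _, τ₂ := 𝟙 _, τ₃ := i }
  have : Epi φ.τ₁ := inferInstanceAs (Epi (𝟙 _))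
  have : IsIso φ.τ₂ := inferInstanceAs (IsIso (𝟙 _))
  have : Mono φ.τ₃ := ‹Mono i›
  exact (ShortComplex.exact_iff_of_epi_of_isIso_of_mono φ).1 hS

/-- A projective resolution of the first term of a short complex, continued by the second term. -/
def spliceComplex {S : ShortComplex C} (P : ProjectiveResolution S.X₁) : ChainComplex C ℕ :=
  ChainComplex.augment P.complex (augmentation P ≫ S.f) (by
    rw [← Category.assoc, d_comp_augmentation, zero_comp])

lemma spliceComplex_d_comp {S : ShortComplex C} (P : ProjectiveResolution S.X₁) :
    (augmentation P ≫ S.f) ≫ S.g = 0 := by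
  rw [Category.assoc, S.zero, comp_zero]

lemma spliceComplex_exactAt_succ {S : ShortComplex C} (hS : S.ShortExact)
    (P : ProjectiveResolution S.X₁) (n : ℕ) : (spliceComplex P).ExactAt (n + 1) := by
  rw [HomologicalComplex.exactAt_iff' _ (n + 1 + 1) (n + 1) n (by simp) (by simp)]
  have := hS.mono_f
  match n with
  | 0 =>
    exact exact_comp_of_mono (S := ShortComplex.mk _ _ (d_comp_augmentation P))
      (ShortComplex.exact_of_g_is_cokernel _ (isColimitAugmentation P)) S.f
  | n + 1 => exact P.exact_succ n

/-- The map from the spliced complex to the third term of the short complex. -/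
noncomputable def splicePi {S : ShortComplex C} (P : ProjectiveResolution S.X₁) :
    spliceComplex P ⟶ (ChainComplex.single₀ C).obj S.X₃ :=
  (ChainComplex.toSingle₀Equiv _ _).symm ⟨S.g, spliceComplex_d_comp P⟩

lemma splicePi_f_zero {S : ShortComplex C} (P : ProjectiveResolution S.X₁) :
    (splicePi P).f 0 = S.g :=
  ChainComplex.toSingle₀Equiv_symm_apply_f_zero _ _

lemma quasiIso_splicePi {S : ShortComplex C} (hS : S.ShortExact) (P : ProjectiveResolution S.X₁) :
    QuasiIso (splicePi P) := ⟨fun n => by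
  cases n with
  | zero =>
    rw [ChainComplex.quasiIsoAt₀_iff, ShortComplex.quasiIso_iff_of_zeros' _ rfl rfl rfl]
    refine (ShortComplex.exact_and_epi_g_iff_of_iso ?_).1
      ⟨exact_of_epi_comp hS.exact (augmentation P), hS.epi_g⟩
    exact ShortComplex.isoMk (Iso.refl _) (Iso.refl _) (Iso.refl _)
      ((Category.id_comp _).trans (Category.comp_id _).symm)
      ((Category.id_comp _).trans ((splicePi_f_zero P).trans (Category.comp_id _).symm))
  | succ n =>
    rw [quasiIsoAt_iff_exactAt']
    · exact spliceComplex_exactAt_succ hS P n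
    · apply ChainComplex.exactAt_succ_single_obj⟩

/-- A projective resolution of the third term of a short exact sequence with projective middle
term, obtained from a projective resolution of the first term. -/
noncomputable def splice {S : ShortComplex C} (hS : S.ShortExact) [hP : Projective S.X₂]
    (P : ProjectiveResolution S.X₁) : ProjectiveResolution S.X₃ where
  complex := spliceComplex P
  projective n := by
    cases n with
    | zero => exact hP
    | succ n => exact P.projective n
  π := splicePi P
  quasiIso := quasiIso_splicePi hS P

lemma nonempty_homology_one_iso_kernel (K : ChainComplex D ℕ) {A : D} (p : K.X 1 ⟶ A)
    (hp : K.d 2 1 ≫ p = 0) (c : IsColimit (CokernelCofork.ofπ p hp)) (f : A ⟶ K.X 0)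
    (hf : K.d 1 0 = p ≫ f) : Nonempty (K.homology 1 ≅ kernel f) := by
  let e : K.opcycles 1 ≅ A := (K.opcyclesIsCokernel 2 1 (by simp)).coconePointUniqueUpToIso c
  have he : K.pOpcycles 1 ≫ e.hom = p :=
    (K.opcyclesIsCokernel 2 1 (by simp)).comp_coconePointUniqueUpToIso_hom c
      WalkingParallelPair.one
  have hk : K.fromOpcycles 1 0 = e.hom ≫ f := by
    rw [← cancel_epi (K.pOpcycles 1), K.p_fromOpcycles, ← Category.assoc, he, hf]
  let i : K.homology 1 ≅ kernel (K.fromOpcycles 1 0) :=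
    (K.homologyIsKernel 1 0 (by simp)).conePointUniqueUpToIso (limit.isLimit _)
  exact ⟨i ≪≫ kernel.mapIso _ _ e (Iso.refl _) (by rw [hk]; simp)⟩

/-- The first left derived functor of a right exact functor is computed by a presentation. -/
lemma nonempty_leftDerived_one_iso_kernel [EnoughProjectives C] (F : C ⥤ D) [F.Additive]
    [PreservesFiniteColimits F] {S : ShortComplex C} (hS : S.ShortExact) [Projective S.X₂] :
    Nonempty ((F.leftDerived 1).obj S.X₃ ≅ kernel (F.map S.f)) := by
  let P := projectiveResolution S.X₁
  obtain ⟨e⟩ := nonempty_homology_one_iso_kernel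
    ((F.mapHomologicalComplex (ComplexShape.down ℕ)).obj (splice hS P).complex)
    (F.map (augmentation P))
    (by
      change F.map (P.complex.d 1 0) ≫ F.map (augmentation P) = 0
      rw [← F.map_comp, d_comp_augmentation, F.map_zero])
    (CokernelCofork.mapIsColimit _ (isColimitAugmentation P) F) (F.map S.f) (F.map_comp _ _)
  exact ⟨(splice hS P).isoLeftDerivedObj F 1 ≪≫ e⟩

end LeftDerived

section Betti

open CategoryTheory.Limits TensorProduct

lemma nonempty_tensor_equiv_of_hasBetti_zero {R : Type} [CommRing R] [IsLocalRing R]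
    {M : ModuleCat R} {b : ℕ} (h : HasBetti R M 0 b) :
    Nonempty ((ResidueField R ⊗[R] M) ≃ₗ[R] (Fin b → ResidueField R)) := by
  obtain ⟨e⟩ := h
  let F := (MonoidalCategory.tensoringLeft (ModuleCat R)).obj (ModuleCat.of R (ResidueField R))
  have : PreservesFiniteColimits F :=
    inferInstanceAs (PreservesFiniteColimits
      (MonoidalCategory.tensorLeft (ModuleCat.of R (ResidueField R))))
  exact ⟨((F.leftDerivedZeroIsoSelf.app M).symm ≪≫ e).toLinearEquiv⟩

lemma nonempty_tensor_equiv_of_hasBetti_one {R : Type} [CommRing R] [IsLocalRing R]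
    {S : ShortComplex (ModuleCat R)} (hS : S.ShortExact) [Projective S.X₂]
    (h0 : LinearMap.lTensor (ResidueField R) S.f.hom = 0) {b : ℕ} (h : HasBetti R S.X₃ 1 b) :
    Nonempty ((ResidueField R ⊗[R] S.X₁) ≃ₗ[R] (Fin b → ResidueField R)) := by
  obtain ⟨e⟩ := h
  let F := (MonoidalCategory.tensoringLeft (ModuleCat R)).obj (ModuleCat.of R (ResidueField R))
  have : PreservesFiniteColimits F :=
    inferInstanceAs (PreservesFiniteColimits
      (MonoidalCategory.tensorLeft (ModuleCat.of R (ResidueField R))))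
  obtain ⟨i⟩ := nonempty_leftDerived_one_iso_kernel F hS
  have hF : F.map S.f = 0 := ModuleCat.hom_ext h0
  exact ⟨(((kernelIsoOfEq hF).trans kernelZeroIsoSource).symm ≪≫ i.symm ≪≫ e).toLinearEquiv⟩

end Betti

section Presentation

open TensorProduct

variable {R : Type*} [CommRing R] [IsLocalRing R] {M : Type*} [AddCommGroup M] [Module R M]

/-- Nakayama: a finite module over a local ring needs no more generators than its reduction. -/
lemma exists_surjective_of_residueField_tensor_equiv [Module.Finite R M] {b : ℕ}
    (e : (ResidueField R ⊗[R] M) ≃ₗ[R] (Fin b → ResidueField R)) :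
    ∃ g : (Fin b → R) →ₗ[R] M, Function.Surjective g := by
  let B : Module.Basis (Fin b) (ResidueField R) (ResidueField R ⊗[R] M) :=
    Module.Basis.ofEquivFun (e.extendScalarsOfSurjective Ideal.Quotient.mk_surjective)
  choose f hf using fun i =>
    TensorProduct.mk_surjective R M (ResidueField R) Ideal.Quotient.mk_surjective (B i)
  refine ⟨Fintype.linearCombination R f, ?_⟩
  rw [← LinearMap.range_eq_top, Fintype.range_linearCombination]
  exact span_eq_top_of_tmul_eq_basis f B hf

/-- A minimal generating family has relations in the maximal ideal, in the sense that the
inclusion of the relation module reduces to zero. -/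
lemma lTensor_residueField_ker_subtype_eq_zero {b : ℕ}
    (e : (ResidueField R ⊗[R] M) ≃ₗ[R] (Fin b → ResidueField R))
    {g : (Fin b → R) →ₗ[R] M} (hg : Function.Surjective g) :
    LinearMap.lTensor (ResidueField R) (LinearMap.ker g).subtype = 0 := by
  let p := TensorProduct.piScalarRight R R (ResidueField R) (Fin b)
  let u := p.symm.toLinearMap ∘ₗ e.toLinearMap ∘ₗ LinearMap.lTensor (ResidueField R) g
  have : Module.Finite R (ResidueField R ⊗[R] (Fin b → R)) := Module.Finite.equiv p.symm
  have hu : Function.Injective u := OrzechProperty.injective_of_surjective_endomorphism u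
    (p.symm.surjective.comp (e.surjective.comp (LinearMap.lTensor_surjective _ hg)))
  refine LinearMap.ext fun x => hu ?_
  have h0 : (LinearMap.lTensor (ResidueField R) g) ((LinearMap.lTensor (ResidueField R)
      (LinearMap.ker g).subtype) x) = 0 := by
    rw [← LinearMap.comp_apply, ← LinearMap.lTensor_comp]
    have : g ∘ₗ (LinearMap.ker g).subtype = 0 := LinearMap.ext fun x => x.2
    simp [this]
  simp [u, h0]

end Presentation

lemma exists_presentation_of_hasBetti {R : Type} [CommRing R] [IsNoetherianRing R] [IsLocalRing R]
    {M : ModuleCat R} [Module.Finite R M] {b₀ b₁ : ℕ} (h₀ : HasBetti R M 0 b₀)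
    (h₁ : HasBetti R M 1 b₁) :
    ∃ (g : (Fin b₀ → R) →ₗ[R] M) (φ : (Fin b₁ → R) →ₗ[R] (Fin b₀ → R)),
      Function.Surjective g ∧ LinearMap.range φ = LinearMap.ker g := by
  obtain ⟨e⟩ := nonempty_tensor_equiv_of_hasBetti_zero h₀
  obtain ⟨g, hg⟩ := exists_surjective_of_residueField_tensor_equiv e
  let S : ShortComplex (ModuleCat R) := ShortComplex.mk
    (ModuleCat.ofHom (LinearMap.ker g).subtype)
    (ModuleCat.ofHom g) (ModuleCat.hom_ext (LinearMap.ext fun x => x.2))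
  have hS : S.ShortExact :=
    { exact := by
        rw [ShortComplex.moduleCat_exact_iff]
        exact fun x hx => ⟨⟨x, hx⟩, rfl⟩
      mono_f := (ModuleCat.mono_iff_injective _).2 Subtype.val_injective
      epi_g := (ModuleCat.epi_iff_surjective _).2 hg }
  have : Projective S.X₂ := (IsProjective.iff_projective (R := R) _).1
    (inferInstanceAs (Module.Projective R (Fin b₀ → R)))
  obtain ⟨e'⟩ := nonempty_tensor_equiv_of_hasBetti_one hS
    (lTensor_residueField_ker_subtype_eq_zero e hg) h₁
  have : Module.Finite R S.X₁ := inferInstanceAs (Module.Finite R (LinearMap.ker g))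
  obtain ⟨q, hq⟩ := exists_surjective_of_residueField_tensor_equiv e'
  refine ⟨g, (LinearMap.ker g).subtype ∘ₗ q, hg, ?_⟩
  rw [LinearMap.range_comp, LinearMap.range_eq_top.2 hq, Submodule.map_top, Submodule.range_subtype]

section McCoy

variable {R : Type*} [CommRing R]

/-- McCoy's theorem: if a matrix with `n` columns acts injectively, no nonzero element kills all
its maximal minors. -/
lemma Matrix.exists_mul_det_submatrix_ne_zero {ι : Type*} {n : ℕ} {A : Matrix ι (Fin n) R}
    (hA : Function.Injective A.mulVec) {u : R} (hu : u ≠ 0) (r : ℕ) (hr : r ≤ n) :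
    ∃ e : Fin r → ι, u * (A.submatrix e (Fin.castLE hr)).det ≠ 0 := by
  induction r with
  | zero => exact ⟨Fin.elim0, by simpa using hu⟩
  | succ r ih =>
    obtain ⟨e, he⟩ := ih (Nat.le_of_succ_le hr)
    by_contra! H
    let c : Fin (r + 1) → R := fun j =>
      (-1) ^ (j : ℕ) * u * (A.submatrix e (Fin.castLE hr ∘ j.succAbove)).det
    have hc : A.mulVec (∑ j, Pi.single (Fin.castLE hr j) (c j)) = 0 := by
      funext i
      have h := H (Fin.cons i e)
      rw [Matrix.det_succ_row_zero, Finset.mul_sum] at h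
      rw [Matrix.mulVec_sum, Finset.sum_apply, Pi.zero_apply, ← h]
      refine Finset.sum_congr rfl fun j _ => ?_
      have : ((A.submatrix (Fin.cons i e) (Fin.castLE hr)).submatrix Fin.succ j.succAbove) =
          A.submatrix e (Fin.castLE hr ∘ j.succAbove) := by
        ext a b; simp
      simp only [this, Matrix.mulVec_single, c]
      simp
      ring
    have h0 := congr_fun (hA (hc.trans (Matrix.mulVec_zero A).symm)) (Fin.castLE hr (Fin.last r))
    rw [Finset.sum_apply, Finset.sum_eq_single (Fin.last r)] at h0
    · refine he ?_
      have : Fin.castLE hr ∘ (Fin.last r).succAbove = Fin.castLE (Nat.le_of_succ_le hr) := by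
        ext; simp
      simp only [c, this, Pi.single_eq_same, Pi.zero_apply, mul_assoc] at h0
      exact (IsUnit.mul_right_eq_zero ((isUnit_one.neg).pow _)).1 h0
    · intro j _ hj
      exact Pi.single_eq_of_ne (fun h => hj (Fin.castLE_injective hr h).symm) _
    · simp

lemma Matrix.eq_zero_of_forall_mul_det_succAbove_eq_zero {n : ℕ}
    {A : Matrix (Fin (n + 1)) (Fin n) R} (hA : Function.Injective A.mulVec) {u : R}
    (h : ∀ i : Fin (n + 1), u * (A.submatrix i.succAbove id).det = 0) : u = 0 := by
  by_contra hu
  obtain ⟨e, he⟩ := exists_mul_det_submatrix_ne_zero hA hu n le_rfl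
  have hinj : Function.Injective e := fun a b hab => by
    by_contra hne
    exact he (by rw [Matrix.det_zero_of_row_eq hne (by ext; simp [hab]), mul_zero])
  obtain ⟨i, hi⟩ : ∃ i, ∀ k, e k ≠ i := by
    by_contra! H
    have := Fintype.card_le_of_surjective e H
    simp at this
  choose σ hσ using fun k => Fin.exists_succAbove_eq (hi k)
  have hσ' : Function.Bijective σ := Finite.injective_iff_bijective.1 fun a b hab =>
    hinj (by rw [← hσ a, ← hσ b, hab])
  have : A.submatrix e (Fin.castLE le_rfl) =
      (A.submatrix i.succAbove id).submatrix (Equiv.ofBijective σ hσ') id := by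
    ext a b; simp [hσ]
  rw [this, Matrix.det_permute, mul_left_comm, h i, mul_zero] at he
  exact he rfl

end McCoy

section HilbertBurch

open nonZeroDivisors Matrix

variable {R : Type*} [CommRing R]

/-- The signed maximal minors of an `(n + 1) × n` matrix. -/
def Matrix.signedMinor {n : ℕ} (A : Matrix (Fin (n + 1)) (Fin n) R) (i : Fin (n + 1)) : R :=
  (-1) ^ (i : ℕ) * (A.submatrix i.succAbove id).det

lemma Matrix.dotProduct_signedMinor_mul {n : ℕ} {A : Matrix (Fin (n + 1)) (Fin n) R}
    {g : Fin (n + 1) → R} (hg : g ᵥ* A = 0) (w : Fin (n + 1) → R) (j : Fin (n + 1)) :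
    (∑ i, w i * A.signedMinor i) * g j = (∑ i, g i * w i) * A.signedMinor j := by
  let B : Matrix (Fin (n + 1)) (Fin (n + 1)) R := .of fun i => Fin.cons (w i) (A i)
  have hB (i : Fin (n + 1)) : B.submatrix i.succAbove Fin.succ = A.submatrix i.succAbove id := by
    ext; simp [B]
  have hdet : B.det = ∑ i, w i * A.signedMinor i := by
    rw [Matrix.det_succ_column_zero]
    refine Finset.sum_congr rfl fun i _ => ?_
    rw [hB]
    simp [B, signedMinor]
    ring
  have hgB : g ᵥ* B = Pi.single 0 (∑ i, g i * w i) := by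
    funext k
    refine Fin.cases ?_ (fun k => ?_) k
    · simp [B, vecMul, dotProduct]
    · simpa [B, vecMul, dotProduct] using congr_fun hg k
  have h := congr_fun (Matrix.vecMul_vecMul g B B.adjugate) j
  rw [Matrix.mul_adjugate, hgB, Matrix.single_vecMul, Matrix.vecMul_smul, Matrix.vecMul_one] at h
  simp only [Pi.smul_apply, smul_eq_mul, hdet, Matrix.row_apply,
    Matrix.adjugate_fin_succ_eq_det_submatrix] at h
  rw [← h, Fin.succAbove_zero, hB]
  simp [signedMinor]

/-- The presentation map of an ideal containing a nonzerodivisor by one more generators than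
relations is injective. -/
lemma injective_of_presentation [IsNoetherianRing R] {n : ℕ} {g : (Fin (n + 1) → R) →ₗ[R] R}
    {φ : (Fin n → R) →ₗ[R] (Fin (n + 1) → R)} (hφ : LinearMap.range φ = LinearMap.ker g)
    {c : Fin (n + 1) → R} (hc : g c ∈ R⁰) : Function.Injective φ := by
  let q : (Fin n → R) →ₗ[R] LinearMap.ker g :=
    φ.codRestrict (LinearMap.ker g) fun v => hφ ▸ LinearMap.mem_range_self φ v
  have hq : Function.Surjective q := by
    rintro ⟨x, hx⟩
    rw [← hφ] at hx
    obtain ⟨v, rfl⟩ := hx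
    exact ⟨v, rfl⟩
  let i₁ : (Fin (n + 1) → R) →ₗ[R] LinearMap.ker g :=
    LinearMap.codRestrict (LinearMap.ker g) (g c • LinearMap.id - g.smulRight c) fun w => by
      simp [mul_comm]
  let i : (Fin (n + 1) → R) →ₗ[R] R × LinearMap.ker g := g.prod i₁
  have hi : Function.Injective i := by
    rw [injective_iff_map_eq_zero]
    intro w hw
    obtain ⟨h₁, h₂⟩ := Prod.mk_eq_zero.1 (show (g w, i₁ w) = 0 from hw)
    have h₃ : g c • w - g w • c = 0 := congr_arg Subtype.val h₂
    rw [h₁, zero_smul, sub_zero] at h₃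
    funext k
    exact (mul_left_mem_nonZeroDivisors_eq_zero_iff hc).1 (congr_fun h₃ k)
  let e := Fin.consLinearEquiv R (fun _ : Fin (n + 1) => R)
  have key := OrzechProperty.injective_of_surjective_of_injective (R := R) (i ∘ₗ e.toLinearMap)
    (LinearMap.prodMap LinearMap.id q) (hi.comp e.injective)
    (Function.Surjective.prodMap Function.surjective_id hq)
  intro x y hxy
  have : q x = q y := Subtype.ext hxy
  exact (Prod.mk.inj (@key (0, x) (0, y) (Prod.ext rfl this))).2

/-- The conclusion of the Hilbert–Burch theorem for an ideal containing a nonzerodivisor: it is a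
nonzerodivisor times an ideal of grade at least two. -/
lemma exists_eq_span_singleton_mul [IsNoetherianRing R] {I : Ideal R} {α : R} (hα : α ∈ R⁰)
    (hαI : α ∈ I) {n : ℕ} {g : (Fin (n + 1) → R) →ₗ[R] R}
    {φ : (Fin n → R) →ₗ[R] (Fin (n + 1) → R)} (hg : LinearMap.range g = I)
    (hφ : LinearMap.range φ = LinearMap.ker g) :
    ∃ a ∈ R⁰, ∃ D : Ideal R, I = Ideal.span {a} * D ∧ (∃ d ∈ D, d ∈ R⁰) ∧
      ∀ x ∈ R⁰, ∀ u, (∀ d ∈ D, x ∣ u * d) → x ∣ u := by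
  rw [← hg] at hαI
  obtain ⟨c, rfl⟩ := hαI
  have hinj := injective_of_presentation hφ hα
  let A := LinearMap.toMatrix' φ
  have hA (v) : A *ᵥ v = φ v := LinearMap.toMatrix'_mulVec φ v
  let D : Ideal R := Ideal.span (Set.range A.signedMinor)
  have hmem (i) : A.signedMinor i ∈ D := Ideal.subset_span ⟨i, rfl⟩
  have hD : ∀ u, (∀ d ∈ D, u * d = 0) → u = 0 := fun u hu => by
    refine Matrix.eq_zero_of_forall_mul_det_succAbove_eq_zero (A := A) (u := u) ?_ fun i => ?_
    · rwa [show A.mulVec = φ from funext hA]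
    · have := hu _ (hmem i)
      rw [signedMinor, mul_left_comm] at this
      exact (IsUnit.mul_right_eq_zero ((isUnit_one.neg).pow _)).1 this
  have hD' : ∀ x ∈ R⁰, ∀ u, (∀ d ∈ D, x ∣ u * d) → x ∣ u := fun x hx u hu => by
    let π := Ideal.Quotient.mk (Ideal.span {x})
    have hπ (r) : π r = 0 ↔ x ∣ r := Ideal.Quotient.eq_zero_iff_dvd _ _
    rw [← hπ]
    refine Matrix.eq_zero_of_forall_mul_det_succAbove_eq_zero (A := A.map π) ?_ fun i => ?_
    · change Function.Injective (A.map π).mulVecLin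
      rw [injective_iff_map_eq_zero]
      intro v hv
      obtain ⟨v, rfl⟩ := (Ideal.Quotient.mk_surjective (I := Ideal.span {x})).comp_left v
      have hv' (k) : x ∣ φ v k := by
        rw [← hπ, ← hA, RingHom.map_mulVec]
        exact congr_fun hv k
      choose w hw using hv'
      have hw' : φ v = x • w := funext hw
      have hgw : g w = 0 := by
        have : g (φ v) = 0 := by
          rw [← LinearMap.mem_ker, ← hφ]; exact LinearMap.mem_range_self φ v
        rw [hw', map_smul] at this
        exact (mul_left_mem_nonZeroDivisors_eq_zero_iff hx).1 this
      rw [← LinearMap.mem_ker, ← hφ] at hgw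
      obtain ⟨v', rfl⟩ := hgw
      rw [← map_smul] at hw'
      rw [hinj hw']
      exact funext fun k => (hπ _).2 ⟨v' k, rfl⟩
    · have := (hπ _).2 (hu _ (hmem i))
      rw [signedMinor, mul_left_comm, map_mul, map_pow, map_neg, map_one] at this
      have := (IsUnit.mul_right_eq_zero ((isUnit_one.neg).pow _)).1 this
      rwa [map_mul, RingHom.map_det] at this
  let γ : Fin (n + 1) → R := fun i => g (Pi.single i 1)
  have hγ (w) : g w = ∑ i, γ i * w i := by
    rw [LinearMap.pi_apply_eq_sum_univ g w]
    refine Finset.sum_congr rfl fun i _ => ?_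
    rw [smul_eq_mul, mul_comm]
    congr 2
    funext k
    simp [Pi.single_apply, eq_comm]
  have hγA : γ ᵥ* A = 0 := by
    funext k
    have : φ (Pi.single k 1) ∈ LinearMap.ker g := hφ ▸ LinearMap.mem_range_self φ _
    rw [LinearMap.mem_ker, hγ, ← hA] at this
    simpa [vecMul, dotProduct] using this
  let δ := ∑ i, c i * A.signedMinor i
  have hδ (j) : δ * γ j = g c * A.signedMinor j := by
    rw [hγ c]; exact dotProduct_signedMinor_mul hγA c j
  have hδD : δ ∈ D := Ideal.sum_mem _ fun i _ => D.mul_mem_left _ (hmem i)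
  have hδ₀ : δ ∈ R⁰ := by
    rw [mem_nonZeroDivisors_iff_right]
    intro u hu
    refine (mul_right_mem_nonZeroDivisors_eq_zero_iff hα).1 (hD _ fun d hd => ?_)
    have : D ≤ LinearMap.ker (LinearMap.mulLeft R (u * g c)) := Ideal.span_le.2 <| by
      rintro _ ⟨j, rfl⟩
      change u * g c * A.signedMinor j = 0
      rw [mul_assoc, ← hδ, ← mul_assoc, hu, zero_mul]
    exact this hd
  obtain ⟨a, ha⟩ := hD' δ hδ₀ (g c) fun d hd => by
    have : D ≤ Submodule.comap (LinearMap.mulLeft R (g c)) (Ideal.span {δ}) := Ideal.span_le.2 <| by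
      rintro _ ⟨j, rfl⟩
      change g c * A.signedMinor j ∈ Ideal.span {δ}
      rw [Ideal.mem_span_singleton, ← hδ]
      exact dvd_mul_right _ _
    exact Ideal.mem_span_singleton.1 (this hd)
  have hγa (j) : γ j = a * A.signedMinor j := by
    refine (mul_cancel_left_mem_nonZeroDivisors hδ₀).1 ?_
    rw [hδ, ha, mul_assoc]
  refine ⟨a, (mul_mem_nonZeroDivisors.1 (ha ▸ hα)).2, D, ?_, ⟨δ, hδD, hδ₀⟩, hD'⟩
  rw [← hg, Ideal.span_mul_span', Set.singleton_mul, ← Set.range_comp]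
  apply le_antisymm
  · rintro _ ⟨w, rfl⟩
    rw [hγ]
    exact Ideal.sum_mem _ fun i _ => Ideal.mul_mem_right _ _ (Ideal.subset_span ⟨i, (hγa i).symm⟩)
  · rw [Ideal.span_le]
    rintro _ ⟨i, rfl⟩
    exact ⟨Pi.single i 1, hγa i⟩

end HilbertBurch

section Ext

open CategoryTheory.Limits

lemma preservesFiniteColimits_linearYoneda_obj_rightOp (R : Type) [CommRing R] (Y : ModuleCat R) :
    PreservesFiniteColimits ((linearYoneda R (ModuleCat R)).obj Y).rightOp := by
  have : PreservesFiniteLimits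
      ((linearYoneda R (ModuleCat R)).obj Y ⋙ CategoryTheory.forget (ModuleCat R)) :=
    inferInstanceAs (PreservesFiniteLimits (yoneda.obj Y))
  have : PreservesFiniteLimits ((linearYoneda R (ModuleCat R)).obj Y) :=
    preservesFiniteLimits_of_reflects_of_preserves _ (CategoryTheory.forget (ModuleCat R))
  exact preservesFiniteColimits_rightOp _

lemma nonempty_extM_one_iso {R : Type} [CommRing R] {S : ShortComplex (ModuleCat R)}
    (hS : S.ShortExact) [Projective S.X₂] (Y : ModuleCat R) :
    Nonempty (ExtM R 1 S.X₃ Y ≅ ModuleCat.of R ((S.X₁ ⟶ Y) ⧸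
      LinearMap.range (Linear.leftComp R Y S.f))) := by
  let F := (linearYoneda R (ModuleCat R)).obj Y
  have : PreservesFiniteColimits F.rightOp :=
    preservesFiniteColimits_linearYoneda_obj_rightOp R Y
  obtain ⟨i⟩ := nonempty_leftDerived_one_iso_kernel F.rightOp hS
  exact ⟨i.unop.symm ≪≫ kernelOpUnop (F.map S.f.op) ≪≫
    ModuleCat.cokernelIsoRangeQuotient (F.map S.f.op)⟩

end Ext

section Quotient

open nonZeroDivisors

variable {R : Type*} [CommRing R]

lemma exists_linearMap_of_eq_span_singleton_mul {I D : Ideal R} {a : R} (ha : a ∈ R⁰)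
    (hI : I = Ideal.span {a} * D) :
    ∃ h : I →ₗ[R] R, (∀ x, a * h x = x) ∧ LinearMap.range h = D := by
  subst hI
  choose h hD ha' using fun x : (Ideal.span {a} * D : Ideal R) =>
    Ideal.mem_span_singleton_mul.1 x.2
  have inj {u v : R} (huv : a * u = a * v) : u = v :=
    (mul_cancel_left_mem_nonZeroDivisors ha).1 huv
  refine ⟨⟨⟨h, fun x y => inj ?_⟩, fun r x => inj ?_⟩, ha', le_antisymm ?_ fun d hd => ?_⟩
  · rw [mul_add, ha', ha', ha']; rfl
  · rw [ha', RingHom.id_apply, smul_eq_mul, mul_left_comm, ha']; rfl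
  · rintro _ ⟨x, rfl⟩; exact hD x
  · exact ⟨⟨a * d, Ideal.mem_span_singleton_mul.2 ⟨d, hd, rfl⟩⟩, inj (ha' _)⟩

/-- If `D` has grade at least two and `h : a D → R` is division by `a`, then `h` generates the
dual of `a D`. -/
lemma exists_eq_smul_of_range_eq {I D : Ideal R} {a : R} (ha : a ∈ R⁰) {h : I →ₗ[R] R}
    (hh : ∀ x, a * h x = x) (hD : LinearMap.range h = D) (hreg : ∃ d ∈ D, d ∈ R⁰)
    (hdvd : ∀ x ∈ R⁰, ∀ u, (∀ d ∈ D, x ∣ u * d) → x ∣ u) (f : I →ₗ[R] R) :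
    ∃ r : R, f = r • h := by
  subst hD
  obtain ⟨_, ⟨α, rfl⟩, hβ⟩ := hreg
  have key (x y : I) : f x * h y = f y * h x := by
    refine (mul_cancel_left_mem_nonZeroDivisors ha).1 ?_
    have h₁ : (x : R) • y = (y : R) • x := Subtype.ext (mul_comm _ _)
    have h₂ := congr_arg f h₁
    simp only [map_smul, smul_eq_mul] at h₂
    rw [← hh x, ← hh y] at h₂
    linear_combination -h₂
  obtain ⟨r, hr⟩ := hdvd _ hβ (f α) <| by
    rintro _ ⟨x, rfl⟩
    rw [key]
    exact dvd_mul_left _ _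
  refine ⟨r, LinearMap.ext fun x => (mul_cancel_left_mem_nonZeroDivisors hβ).1 ?_⟩
  rw [LinearMap.smul_apply, smul_eq_mul, mul_comm, ← key α x, hr, mul_assoc]

end Quotient

lemma nonempty_extM_one_quotient_iso {R : Type} [CommRing R] {I D : Ideal R} {a : R}
    (ha : a ∈ nonZeroDivisors R) (hI : I = Ideal.span {a} * D)
    (hreg : ∃ d ∈ D, d ∈ nonZeroDivisors R)
    (hdvd : ∀ x ∈ nonZeroDivisors R, ∀ u, (∀ d ∈ D, x ∣ u * d) → x ∣ u) :
    Nonempty (ExtM R 1 (ModuleCat.of R (R ⧸ I)) (ModuleCat.of R R) ≅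
      ModuleCat.of R (R ⧸ Ideal.span {a})) := by
  let S : ShortComplex (ModuleCat R) := ShortComplex.mk
    (ModuleCat.ofHom I.subtype) (ModuleCat.ofHom I.mkQ)
    (ModuleCat.hom_ext (LinearMap.ext fun x => (Submodule.Quotient.mk_eq_zero I).2 x.2))
  have hS : S.ShortExact :=
    { exact := by
        rw [ShortComplex.moduleCat_exact_iff]
        exact fun x hx => ⟨⟨x, (Submodule.Quotient.mk_eq_zero I).1 hx⟩, rfl⟩
      mono_f := (ModuleCat.mono_iff_injective _).2 Subtype.val_injective
      epi_g := (ModuleCat.epi_iff_surjective _).2 (Submodule.mkQ_surjective I) }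
  have : Projective S.X₂ := (IsProjective.iff_projective (R := R) _).1
    (inferInstanceAs (Module.Projective R R))
  obtain ⟨i⟩ := nonempty_extM_one_iso hS (ModuleCat.of R R)
  obtain ⟨h, hh, hD⟩ := exists_linearMap_of_eq_span_singleton_mul ha hI
  let N := LinearMap.range (Linear.leftComp R (ModuleCat.of R R) S.f)
  let T : R →ₗ[R] ((S.X₁ ⟶ ModuleCat.of R R) ⧸ N) :=
    LinearMap.toSpanSingleton R _ (N.mkQ (ModuleCat.ofHom h))
  have hT : Function.Surjective T := by
    intro y
    obtain ⟨f, rfl⟩ := N.mkQ_surjective y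
    obtain ⟨r, hr⟩ := exists_eq_smul_of_range_eq ha hh hD hreg hdvd f.hom
    refine ⟨r, ?_⟩
    rw [LinearMap.toSpanSingleton_apply, ← map_smul]
    exact congr_arg _ (ModuleCat.hom_ext hr.symm)
  have hker : LinearMap.ker T = Ideal.span {a} := by
    ext r
    rw [LinearMap.mem_ker, LinearMap.toSpanSingleton_apply, ← map_smul, Submodule.mkQ_apply,
      Submodule.Quotient.mk_eq_zero, Ideal.mem_span_singleton]
    constructor
    · rintro ⟨f, hf⟩
      have hf' (x : I) : f.hom (x : R) = r * h x :=
        LinearMap.congr_fun (congr_arg ModuleCat.Hom.hom hf) x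
      obtain ⟨d, hd, hd₀⟩ := hreg
      rw [← hD] at hd
      obtain ⟨x, rfl⟩ := hd
      refine ⟨f.hom (1 : R), (mul_cancel_right_mem_nonZeroDivisors hd₀).1 ?_⟩
      have h₁ : f.hom (x : R) = (x : R) * f.hom (1 : R) := by
        rw [← smul_eq_mul, ← map_smul, smul_eq_mul, mul_one]
      rw [← hf', h₁]
      nth_rewrite 1 [← hh x]
      ring
    · rintro ⟨s, rfl⟩
      refine ⟨ModuleCat.ofHom (LinearMap.toSpanSingleton R R s), ModuleCat.hom_ext
        (LinearMap.ext fun x => ?_)⟩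
      change (x : R) * s = (a * s) * h x
      rw [← hh x]
      ring
  exact ⟨i ≪≫ (((Submodule.quotEquivOfEq _ _ hker.symm).trans
    (T.quotKerEquivOfSurjective hT)).toModuleIso).symm⟩

section Regular

variable {R : Type*} [CommRing R] [IsLocalRing R]
  {M : Type*} [AddCommGroup M] [Module R M]

lemma exists_isSMulRegular_of_maximalIdeal_notMem [IsNoetherianRing R] [Module.Finite R M]
    (h : maximalIdeal R ∉ associatedPrimes R M) :
    ∃ z ∈ maximalIdeal R, IsSMulRegular M z := by
  by_contra! H
  have hsub : (maximalIdeal R : Set R) ⊆ ⋃ p ∈ associatedPrimes R M, p := by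
    rw [biUnion_associatedPrimes_eq_compl_regular]
    exact H
  obtain ⟨p, hp, hle⟩ := (Ideal.subset_union_prime_finite (associatedPrimes.finite R M)
    (f := fun p : Ideal R => p) ⊥ ⊥ fun p hp _ _ => hp.isPrime).1 hsub
  have : maximalIdeal R = p := le_antisymm hle (le_maximalIdeal hp.isPrime.ne_top)
  exact h (this ▸ hp)

lemma maximalIdeal_notMem_associatedPrimes [IsNoetherianRing R] {z : R} (hz : z ∈ maximalIdeal R)
    (h : IsSMulRegular M z) : maximalIdeal R ∉ associatedPrimes R M := fun hm => by
  have : z ∈ ⋃ p ∈ associatedPrimes R M, (p : Set R) := Set.mem_biUnion hm hz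
  rw [biUnion_associatedPrimes_eq_compl_regular] at this
  exact this h

lemma maximalIdeal_mem_associatedPrimes_iff [IsNoetherianRing R] :
    maximalIdeal R ∈ associatedPrimes R M ↔ ∃ u : M, u ≠ 0 ∧ ∀ r ∈ maximalIdeal R, r • u = 0 := by
  rw [AssociatedPrimes.mem_iff, isAssociatedPrime_iff]
  constructor
  · rintro ⟨-, u, hu⟩
    have h (r) : r ∈ maximalIdeal R ↔ r • u = 0 := by
      rw [hu, Submodule.mem_colon_singleton, Submodule.mem_bot]
    exact ⟨u, fun h0 => (maximalIdeal R).ne_top_iff_one.1 (maximalIdeal.isMaximal R).ne_top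
      ((h 1).2 (by rw [h0, smul_zero])), fun r => (h r).1⟩
  · rintro ⟨u, hu, h⟩
    refine ⟨inferInstance, u, le_antisymm (fun r hr => ?_) (le_maximalIdeal fun h1 => ?_)⟩
    · rw [Submodule.mem_colon_singleton, Submodule.mem_bot, h r hr]
    · have : (1 : R) ∈ (⊥ : Submodule R M).colon {u} := h1 ▸ Submodule.mem_top
      rw [Submodule.mem_colon_singleton, Submodule.mem_bot, one_smul] at this
      exact hu this

lemma maximalIdeal_mem_associatedPrimes_quotSMulTop [IsNoetherianRing R] {x y : R}
    (hy : y ∈ maximalIdeal R) (hxr : IsSMulRegular M x)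
    (hyr : IsSMulRegular M y) (h : maximalIdeal R ∈ associatedPrimes R (QuotSMulTop x M)) :
    maximalIdeal R ∈ associatedPrimes R (QuotSMulTop y M) := by
  have key (z : R) (u : M) : (Submodule.Quotient.mk u : QuotSMulTop z M) = 0 ↔ ∃ t, z • t = u := by
    rw [Submodule.Quotient.mk_eq_zero, Submodule.mem_smul_pointwise_iff_exists]
    simp
  rw [maximalIdeal_mem_associatedPrimes_iff] at h ⊢
  obtain ⟨u, hu, h⟩ := h
  obtain ⟨u, rfl⟩ := Submodule.Quotient.mk_surjective _ u
  obtain ⟨v, hv⟩ : ∃ v, x • v = y • u := (key _ _).1 (h y hy)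
  refine ⟨Submodule.Quotient.mk v, fun hv0 => hu ?_, fun r hr => ?_⟩
  · obtain ⟨w, rfl⟩ := (key _ _).1 hv0
    refine (key _ _).2 ⟨w, hyr ?_⟩
    change y • x • w = y • u
    exact (smul_comm y x w).trans hv
  · obtain ⟨t, ht⟩ := (key _ _).1 (h r hr)
    refine (key _ _).2 ⟨t, hxr ?_⟩
    change x • y • t = x • r • v
    rw [smul_comm x r, hv, smul_comm x y, ht, smul_comm]

open RingTheory.Sequence in
/-- In a regular sequence, the first element may be replaced by any regular element of the
maximal ideal, at the cost of changing the others. -/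
lemma exists_isWeaklyRegular_quotSMulTop [IsNoetherianRing R] (n : ℕ) :
    ∀ (M : Type*) [AddCommGroup M] [Module R M] [Module.Finite R M] (x : R) (ys : List R),
      x ∈ maximalIdeal R → IsSMulRegular M x → (∀ y ∈ ys, y ∈ maximalIdeal R) →
      IsWeaklyRegular M ys → ys.length = n + 1 →
      ∃ zs : List R, (∀ z ∈ zs, z ∈ maximalIdeal R) ∧ IsWeaklyRegular (QuotSMulTop x M) zs ∧
        zs.length = n := by
  induction n with
  | zero => exact fun M _ _ _ x ys _ _ _ _ _ => ⟨[], by simp, by simp, rfl⟩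
  | succ n ih =>
    intro M _ _ _ x ys hx hxr hys hysr hlen
    match ys, hlen with
    | y :: y' :: ys, hlen =>
    have hy : y ∈ maximalIdeal R := hys _ (by simp)
    have hy' : y' ∈ maximalIdeal R := hys _ (by simp)
    obtain ⟨hyr, hysr⟩ := (isWeaklyRegular_cons_iff _ _ _).1 hysr
    have hyr' := ((isWeaklyRegular_cons_iff _ _ _).1 hysr).1
    have hP : maximalIdeal R ∉ associatedPrimes R (M × QuotSMulTop x M × QuotSMulTop y M) := by
      rw [associatedPrimes.prod, associatedPrimes.prod]
      have h₁ := maximalIdeal_notMem_associatedPrimes hy hyr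
      have h₂ := maximalIdeal_notMem_associatedPrimes hy' hyr'
      have h₃ : maximalIdeal R ∉ associatedPrimes R (QuotSMulTop x M) := fun h =>
        h₂ (maximalIdeal_mem_associatedPrimes_quotSMulTop hy hxr hyr h)
      simp only [Set.mem_union, h₁, h₂, h₃, or_self, not_false_eq_true]
    obtain ⟨z, hz, hzr⟩ := exists_isSMulRegular_of_maximalIdeal_notMem hP
    have hzM : IsSMulRegular M z := fun a b hab =>
      congr_arg Prod.fst (@hzr (a, 0) (b, 0) (Prod.ext hab rfl))
    have hzx : IsSMulRegular (QuotSMulTop x M) z := fun a b hab =>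
      congr_arg (fun p => p.2.1) (@hzr (0, a, 0) (0, b, 0) (Prod.ext rfl (Prod.ext hab rfl)))
    have hzy : IsSMulRegular (QuotSMulTop y M) z := fun a b hab =>
      congr_arg (fun p => p.2.2) (@hzr (0, 0, a) (0, 0, b) (Prod.ext rfl (Prod.ext rfl hab)))
    obtain ⟨ws, hws, hwsr, hwl⟩ := ih (QuotSMulTop y M) z (y' :: ys) hz hzy
      (fun a ha => hys a (List.mem_cons_of_mem _ ha)) hysr (by simpa using hlen)
    have h₁ : IsWeaklyRegular M (z :: y :: ws) :=
      isWeaklyRegular_of_perm_of_subset_maximalIdeal (rs := y :: z :: ws)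
        (by simp [hyr, hzy, hwsr]) (List.Perm.swap _ _ _) (by simp; tauto)
    have h₂ : IsWeaklyRegular M [z, x] :=
      isWeaklyRegular_of_perm_of_subset_maximalIdeal (rs := [x, z])
        (by simp [hxr, hzx]) (List.Perm.swap _ _ _) (by simp; tauto)
    obtain ⟨vs, hvs, hvsr, hvl⟩ := ih (QuotSMulTop z M) x (y :: ws) hx
      ((isWeaklyRegular_cons_iff _ _ _).1 ((isWeaklyRegular_cons_iff _ _ _).1 h₂).2).1
      (by simp; tauto) ((isWeaklyRegular_cons_iff _ _ _).1 h₁).2 (by simpa using hwl)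
    have h₃ : IsWeaklyRegular M (x :: z :: vs) :=
      isWeaklyRegular_of_perm_of_subset_maximalIdeal (rs := z :: x :: vs)
        ((isWeaklyRegular_cons_iff _ _ _).2 ⟨hzM, (isWeaklyRegular_cons_iff _ _ _).2
          ⟨((isWeaklyRegular_cons_iff _ _ _).1 ((isWeaklyRegular_cons_iff _ _ _).1 h₂).2).1, hvsr⟩⟩)
        (List.Perm.swap _ _ _) (by simp; tauto)
    exact ⟨z :: vs, by simp; tauto, ((isWeaklyRegular_cons_iff _ _ _).1 h₃).2, by simpa using hvl⟩

open RingTheory.Sequence in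
/-- An associated prime of a module with a regular sequence of length `n` has coheight at
least `n`. -/
lemma length_le_coheight_of_isAssociatedPrime [IsNoetherianRing R] (ys : List R) :
    ∀ (M : Type*) [AddCommGroup M] [Module R M] [Module.Finite R M] (p : PrimeSpectrum R),
      p.asIdeal ∈ associatedPrimes R M → (∀ y ∈ ys, y ∈ maximalIdeal R) →
      IsWeaklyRegular M ys → (ys.length : ℕ∞) ≤ Order.coheight p := by
  induction ys with
  | nil => simp
  | cons x ys ih =>
    intro M _ _ _ p hp hys hysr
    obtain ⟨hxr, hysr⟩ := (isWeaklyRegular_cons_iff _ _ _).1 hysr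
    have hx : x ∈ maximalIdeal R := hys _ (by simp)
    obtain ⟨-, u, hu⟩ := isAssociatedPrime_iff.1 hp
    have hu' (r) : r ∈ p.asIdeal ↔ r • u = 0 := by
      rw [hu, Submodule.mem_colon_singleton, Submodule.mem_bot]
    have hu0 : u ≠ 0 := fun h0 => p.asIdeal.ne_top_iff_one.1 p.isPrime.ne_top
      ((hu' 1).2 (by rw [h0, smul_zero]))
    have hxp : x ∉ p.asIdeal := fun h =>
      hu0 (hxr (((hu' x).1 h).trans (smul_zero x).symm))
    obtain ⟨v, hv, hv0⟩ : ∃ v : M, (∀ r ∈ p.asIdeal, r • v = 0) ∧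
        (Submodule.Quotient.mk v : QuotSMulTop x M) ≠ 0 := by
      by_contra! H
      let N : Submodule R M :=
        { carrier := {v | ∀ r ∈ p.asIdeal, r • v = 0}
          add_mem' := fun ha hb r hr => by rw [smul_add, ha r hr, hb r hr, add_zero]
          zero_mem' := fun r _ => smul_zero r
          smul_mem' := fun c v hv r hr => by rw [smul_comm, hv r hr, smul_zero] }
      have hN : N ≤ Ideal.span {x} • N := fun v hv => by
        have h0 := H v hv
        rw [Submodule.Quotient.mk_eq_zero, Submodule.mem_smul_pointwise_iff_exists] at h0
        obtain ⟨w, -, rfl⟩ := h0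
        refine Submodule.smul_mem_smul (Ideal.mem_span_singleton_self x) fun r hr => hxr ?_
        change x • r • w = x • (0 : M)
        rw [smul_comm, hv r hr, smul_zero]
      have := Submodule.eq_bot_of_le_smul_of_le_jacobson_bot _ N (IsNoetherian.noetherian N) hN
        (((Ideal.span_singleton_le_iff_mem _).2 hx).trans (maximalIdeal_le_jacobson _))
      have huN : u ∈ N := fun r hr => (hu' r).1 hr
      rw [this] at huN
      exact hu0 huN
    obtain ⟨q, hq, hle⟩ := exists_le_isAssociatedPrime_of_isNoetherianRing R _ hv0
    have hmem {r : R} (h : r • (Submodule.Quotient.mk v : QuotSMulTop x M) = 0) : r ∈ q :=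
      hle (by rwa [Submodule.mem_colon_singleton, Submodule.mem_bot])
    have hlt : p < ⟨q, hq.isPrime⟩ := by
      refine lt_of_le_of_ne (fun r hr => hmem ?_) fun h => hxp ?_
      · rw [← Submodule.Quotient.mk_smul, hv r hr, Submodule.Quotient.mk_zero]
      · rw [h]
        exact hmem (Module.mem_annihilator.1 (QuotSMulTop.mem_annihilator M x) _)
    have := ih (QuotSMulTop x M) ⟨q, hq.isPrime⟩ hq
      (fun y hy => hys y (List.mem_cons_of_mem _ hy)) hysr
    calc ((x :: ys).length : ℕ∞) = ys.length + 1 := by simp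
      _ ≤ Order.coheight (⟨q, hq.isPrime⟩ : PrimeSpectrum R) + 1 := by gcongr
      _ ≤ Order.coheight p := Order.coheight_add_one_le hlt

end Regular

/-- `R ⧸ (x)` written as `R ⧸ x R`. -/
noncomputable def quotSpanSingletonEquivQuotSMulTop {R : Type*} [CommRing R] (x : R) :
    (R ⧸ Ideal.span {x}) ≃ₗ[R] QuotSMulTop x R :=
  Submodule.quotEquivOfEq _ _ (by
    rw [← Submodule.ideal_span_singleton_smul, smul_eq_mul, Ideal.mul_top])

lemma height_le_one_of_mem_associatedPrimes_quotient_span_singleton {R : Type} [CommRing R]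
    [IsNoetherianRing R] [IsLocalRing R] (hCM : IsCMLocalRing R) {a : R}
    (ha : a ∈ nonZeroDivisors R) (ham : a ∈ maximalIdeal R) {Q : Ideal R}
    (hQ : Q ∈ associatedPrimes R (R ⧸ Ideal.span {a})) : Q.height ≤ 1 := by
  obtain ⟨rs, hrs, hreg, hdim⟩ := hCM
  rw [ringKrullDim_eq_of_ringEquiv (RingEquiv.quotientBot R)] at hdim
  replace hreg : IsWeaklyRegular R rs :=
    (LinearEquiv.isWeaklyRegular_congr (Submodule.quotEquivOfEqBot ⊥ rfl) rs).1
      hreg.toIsWeaklyRegular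
  have hQp : Q.IsPrime := hQ.isPrime
  let q : PrimeSpectrum R := ⟨Q, hQp⟩
  have hsum : Order.height q + Order.coheight q ≤ rs.length := by
    have h : (ringKrullDim R : WithBot ℕ∞) = _ :=
      Order.krullDim_eq_iSup_height_add_coheight_of_nonempty
    rw [← hdim] at h
    have h' : ((rs.length : ℕ∞) : WithBot ℕ∞) = _ := h
    rw [WithBot.coe_inj] at h'
    rw [h']
    exact le_iSup (fun q : PrimeSpectrum R => Order.height q + Order.coheight q) q
  have hht : Q.height = Order.height q := PrimeSpectrum.height_eq_orderHeight q
  rw [hht]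
  rcases hlen : rs.length with _ | n
  · rw [hlen] at hsum
    exact le_self_add.trans (hsum.trans (by simp))
  · obtain ⟨zs, hzs, hzr, hzl⟩ := exists_isWeaklyRegular_quotSMulTop n R a rs ham
      (Module.Flat.isSMulRegular_of_nonZeroDivisors ha) hrs hreg hlen
    rw [LinearEquiv.AssociatedPrimes.eq (quotSpanSingletonEquivQuotSMulTop a)] at hQ
    have := length_le_coheight_of_isAssociatedPrime zs (QuotSMulTop a R) q hQ hzs hzr
    rw [hzl] at this
    rw [hlen] at hsum
    have h2 := (add_le_add_right this _).trans hsum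
    rw [Nat.cast_add, Nat.cast_one, add_comm] at h2
    exact (ENat.add_le_add_iff_left (ENat.natCast_ne_top n)).1 h2

section Unmixed

variable {R : Type} [CommRing R] [IsNoetherianRing R]

lemma not_le_of_mem_associatedPrimes_quotient_span_singleton {D : Ideal R} {x : R}
    (hdvd : ∀ u, (∀ d ∈ D, x ∣ u * d) → x ∣ u) {Q : Ideal R}
    (hQ : Q ∈ associatedPrimes R (R ⧸ Ideal.span {x})) : ¬ D ≤ Q := fun hle => by
  obtain ⟨hQp, u, hu⟩ := isAssociatedPrime_iff.1 hQ
  obtain ⟨u, rfl⟩ := Ideal.Quotient.mk_surjective u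
  have hu' (r) : r ∈ Q ↔ x ∣ u * r := by
    rw [hu, Submodule.mem_colon_singleton, Submodule.mem_bot, Algebra.smul_def,
      Ideal.Quotient.algebraMap_eq, ← map_mul, Ideal.Quotient.eq_zero_iff_mem,
      Ideal.mem_span_singleton, mul_comm]
  have hxu := hdvd u fun d hd => (hu' d).1 (hle hd)
  exact Q.ne_top_iff_one.1 hQp.ne_top ((hu' 1).2 (by rwa [mul_one]))

lemma not_le_of_height_le_one {D : Ideal R} {x : R} (hxD : x ∈ D) (hx : x ∈ nonZeroDivisors R)
    (hdvd : ∀ u, (∀ d ∈ D, x ∣ u * d) → x ∣ u) {P : Ideal R} [P.IsPrime]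
    (hP : P.height ≤ 1) : ¬ D ≤ P := fun hle => by
  refine not_le_of_mem_associatedPrimes_quotient_span_singleton hdvd (Q := P)
    (Module.associatedPrimes.minimalPrimes_annihilator_subset_associatedPrimes R _ ?_) hle
  rw [Ideal.annihilator_quotient]
  refine Ideal.mem_minimalPrimes_of_height_le
    ((Ideal.span_singleton_le_iff_mem _).2 (hle hxD)) (hP.trans ?_)
  exact Ideal.one_le_height_span_singleton_of_mem_nonZeroDivisors hx

lemma GradeEq.eq_top_of_forall_dvd [IsLocalRing R] {D : Ideal R} (hgrade : GradeEq R D 1) {x : R}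
    (hxD : x ∈ D) (hx : x ∈ nonZeroDivisors R) (hdvd : ∀ u, (∀ d ∈ D, x ∣ u * d) → x ∣ u) :
    D = ⊤ := by
  by_contra hD
  have hsub : ¬ (D : Set R) ⊆ ⋃ p ∈ associatedPrimes R (R ⧸ Ideal.span {x}), (p : Set R) :=
    fun hsub => by
      obtain ⟨p, hp, hle⟩ := (Ideal.subset_union_prime_finite
        (associatedPrimes.finite R (R ⧸ Ideal.span {x}))
        (f := fun p : Ideal R => p) ⊥ ⊥ fun p hp _ _ => hp.isPrime).1 hsub
      exact not_le_of_mem_associatedPrimes_quotient_span_singleton hdvd hp hle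
  rw [biUnion_associatedPrimes_eq_compl_regular] at hsub
  obtain ⟨y, hyD, hy⟩ := Set.not_subset.1 hsub
  replace hy : IsSMulRegular (R ⧸ Ideal.span {x}) y := not_not.1 hy
  have hm : D ≤ maximalIdeal R := le_maximalIdeal hD
  have hreg : IsRegular R [x, y] := by
    refine IsRegular.of_isWeaklyRegular_of_mem_maximalIdeal R
      (by simpa using ⟨hm hxD, hm hyD⟩) ?_
    simp only [isWeaklyRegular_cons_iff, IsWeaklyRegular.nil, and_true]
    exact ⟨Module.Flat.isSMulRegular_of_nonZeroDivisors hx,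
      ((quotSpanSingletonEquivQuotSMulTop x).isSMulRegular_congr y).1 hy⟩
  have := hgrade.2 [x, y] (by simpa using ⟨hxD, hyD⟩) hreg
  simp at this

/-- If no prime of height at most one contains `D`, the minimal primes over `(a)` are minimal
over `aD`. -/
lemma mem_minimalPrimes_span_mul_of_le_of_height_le_one {D : Ideal R} {a : R}
    (ha : a ∈ nonZeroDivisors R) (hD : ∀ P : Ideal R, P.IsPrime → P.height ≤ 1 → ¬ D ≤ P)
    {P : Ideal R} [P.IsPrime] (haP : a ∈ P) (hP : P.height ≤ 1) :
    P ∈ (Ideal.span {a} * D).minimalPrimes := by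
  refine ⟨⟨inferInstance, Ideal.mul_le_left.trans ((Ideal.span_singleton_le_iff_mem _).2 haP)⟩,
    fun Q ⟨hQ, hIQ⟩ hQP => ?_⟩
  have haQ : Ideal.span {a} ≤ Q :=
    (hQ.mul_le.1 hIQ).resolve_right (hD Q hQ ((Ideal.height_mono hQP).trans hP))
  have hPa : P ∈ (Ideal.span {a}).minimalPrimes :=
    Ideal.mem_minimalPrimes_of_height_le (haQ.trans hQP)
      (hP.trans (Ideal.one_le_height_span_singleton_of_mem_nonZeroDivisors ha))
  exact hPa.2 ⟨hQ, haQ⟩ hQP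

lemma idealHt_span_mul_eq_one {D : Ideal R} {a x : R}
    (ha : a ∈ nonZeroDivisors R) (hu : ¬ IsUnit a) (hxD : x ∈ D) (hx : x ∈ nonZeroDivisors R)
    (hD : ∀ P : Ideal R, P.IsPrime → P.height ≤ 1 → ¬ D ≤ P) :
    idealHt R (Ideal.span {a} * D) = 1 := by
  refine le_antisymm ?_ (le_sInf ?_)
  · obtain ⟨P, hP⟩ := Ideal.nonempty_minimalPrimes (I := Ideal.span {a})
      (by rwa [Ne, Ideal.span_singleton_eq_top])
    have hPp : P.IsPrime := hP.1.1
    have hP1 := Ideal.height_le_one_of_isPrincipal_of_mem_minimalPrimes _ P hP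
    refine sInf_le_of_le ⟨⟨P, hPp⟩, mem_minimalPrimes_span_mul_of_le_of_height_le_one ha hD
      ((Ideal.span_singleton_le_iff_mem _).1 hP.1.2) hP1, rfl⟩ ?_
    rw [IsLocalization.AtPrime.ringKrullDim_eq_height P]
    exact WithBot.coe_le_coe.2 hP1
  · rintro _ ⟨P, hP, rfl⟩
    rw [IsLocalization.AtPrime.ringKrullDim_eq_height P.asIdeal]
    have h : Ideal.span {a * x} ≤ P.asIdeal := (Ideal.span_singleton_le_iff_mem _).2
      (hP.1.2 (Ideal.mul_mem_mul (Ideal.mem_span_singleton_self a) hxD))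
    exact WithBot.coe_le_coe.2 <| (Ideal.one_le_height_span_singleton_of_mem_nonZeroDivisors
      (mul_mem ha hx)).trans (Ideal.height_mono h)

lemma mem_primaryComponent_iff {R : Type} [CommRing R] {I P : Ideal R} [P.IsPrime] {r : R} :
    r ∈ primaryComponent R I P ↔ ∃ s, s ∉ P ∧ s * r ∈ I := by
  rw [primaryComponent, Ideal.mem_comap,
    IsLocalization.algebraMap_mem_map_algebraMap_iff P.primeCompl]
  simp [Ideal.mem_primeCompl_iff]

lemma unmixedPart_eq_span_singleton [IsLocalRing R] (hCM : IsCMLocalRing R) {I D : Ideal R} {a : R}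
    (hgrade : GradeEq R I 1) (ha : a ∈ nonZeroDivisors R) (hI : I = Ideal.span {a} * D)
    (hreg : ∃ d ∈ D, d ∈ nonZeroDivisors R)
    (hdvd : ∀ x ∈ nonZeroDivisors R, ∀ u, (∀ d ∈ D, x ∣ u * d) → x ∣ u) :
    unmixedPart R I = Ideal.span {a} := by
  obtain ⟨x, hxD, hx⟩ := hreg
  have hD (P : Ideal R) (_ : P.IsPrime) (hP : P.height ≤ 1) : ¬ D ≤ P :=
    not_le_of_height_le_one hxD hx (hdvd x hx) hP
  by_cases hu : IsUnit a
  · have hID : I = D := by rw [hI, Ideal.span_singleton_eq_top.2 hu, Ideal.top_mul]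
    have hIt : I = ⊤ := by
      subst hID
      exact hgrade.eq_top_of_forall_dvd hxD hx (hdvd x hx)
    rw [Ideal.span_singleton_eq_top.2 hu, unmixedPart, iInf_eq_top]
    rintro ⟨P, hP, -⟩
    exact absurd (top_le_iff.1 (hIt ▸ hP.1.2)) P.isPrime.ne_top
  have hht : idealHt R I = 1 := hI ▸ idealHt_span_mul_eq_one ha hu hxD hx hD
  have hIa : I ≤ Ideal.span {a} := hI ▸ Ideal.mul_le_left
  refine le_antisymm (fun r hr => ?_) ?_
  · by_contra hra
    obtain ⟨Q, hQ, hle⟩ := exists_le_isAssociatedPrime_of_isNoetherianRing R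
      (Ideal.Quotient.mk (Ideal.span {a}) r) (mt Ideal.Quotient.eq_zero_iff_mem.1 hra)
    have hcolon {s : R} (hs : s * r ∈ Ideal.span {a}) : s ∈ Q := hle (by
      rwa [Submodule.mem_colon_singleton, Submodule.mem_bot, Algebra.smul_def,
        Ideal.Quotient.algebraMap_eq, ← map_mul, Ideal.Quotient.eq_zero_iff_mem])
    have hQp : Q.IsPrime := hQ.isPrime
    have haQ : a ∈ Q := hcolon (Ideal.mul_mem_right _ _ (Ideal.mem_span_singleton_self a))
    have hQ1 : Q.height ≤ 1 := height_le_one_of_mem_associatedPrimes_quotient_span_singleton hCM ha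
      ((mem_maximalIdeal a).2 hu) hQ
    have hQI : Q ∈ I.minimalPrimes :=
      hI ▸ mem_minimalPrimes_span_mul_of_le_of_height_le_one ha hD haQ hQ1
    have h1Q : 1 ≤ Q.height := (Ideal.one_le_height_span_singleton_of_mem_nonZeroDivisors ha).trans
      (Ideal.height_mono ((Ideal.span_singleton_le_iff_mem _).2 haQ))
    have hQh : ringKrullDim (Localization.AtPrime Q) = idealHt R I := by
      rw [hht, IsLocalization.AtPrime.ringKrullDim_eq_height Q, le_antisymm hQ1 h1Q]
      rfl
    obtain ⟨s, hs, hsr⟩ := mem_primaryComponent_iff.1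
      ((Submodule.mem_iInf _).1 hr ⟨⟨Q, hQp⟩, hQI, hQh⟩)
    exact hs (hcolon (hIa hsr))
  · rw [Ideal.span_singleton_le_iff_mem, unmixedPart, Submodule.mem_iInf]
    rintro ⟨P, -, hP⟩
    rw [hht, IsLocalization.AtPrime.ringKrullDim_eq_height P.asIdeal] at hP
    obtain ⟨s, hsD, hsP⟩ := Set.not_subset.1 (hD P.asIdeal P.isPrime (WithBot.coe_le_coe.1 hP.le))
    refine mem_primaryComponent_iff.2 ⟨s, hsP, ?_⟩
    rw [hI, mul_comm s a]
    exact Ideal.mul_mem_mul (Ideal.mem_span_singleton_self a) hsD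

end Unmixed

theorem stmt10 (R : Type) [CommRing R] [IsNoetherianRing R] [IsLocalRing R]
    (hGor : IsGorensteinLocalRing R)
    (I : Ideal R) (hgrade : GradeEq R I 1)
    (b0 b1 : ℕ) (hb0 : HasBetti R (ModuleCat.of R I) 0 b0)
    (hb1 : HasBetti R (ModuleCat.of R I) 1 b1)
    (hdiff : (b1 : ℤ) - (b0 : ℤ) = -1) :
    Nonempty (ExtM R 1 (ModuleCat.of R (R ⧸ I)) (ModuleCat.of R R) ≅
      ModuleCat.of R (R ⧸ unmixedPart R I)) := by
  obtain ⟨rs, hlen, hrs, hreg⟩ := hgrade.1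
  obtain ⟨α, rfl⟩ := List.length_eq_one_iff.1 hlen
  have hαI : α ∈ I := hrs α (by simp)
  have hα : α ∈ nonZeroDivisors R := isRegular_iff_mem_nonZeroDivisors.1
    (isLeftRegular_iff_isRegular.1
      ((isWeaklyRegular_cons_iff _ _ _).1 hreg.toIsWeaklyRegular).1.isLeftRegular)
  obtain rfl : b0 = b1 + 1 := by omega
  obtain ⟨g, φ, hg, hφ⟩ := exists_presentation_of_hasBetti hb0 hb1
  obtain ⟨a, ha, D, hI, hD, hdvd⟩ := exists_eq_span_singleton_mul hα hαI
    (g := I.subtype ∘ₗ g) (φ := φ)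
    (by rw [LinearMap.range_comp_of_range_eq_top _ (LinearMap.range_eq_top.2 hg),
      Submodule.range_subtype])
    (by rw [hφ, LinearMap.ker_comp_of_ker_eq_bot _ (Submodule.ker_subtype I)])
  rw [unmixedPart_eq_span_singleton hGor.1 hgrade ha hI hD hdvd]
  exact nonempty_extM_one_quotient_iso ha hI hD hdvd
end

section
/- Let (R, m, k) be a Cohen-Macaulay local ring of dimension d with canonical module, J an ideal of height g, α a maximal R-regular sequence of length g contained in J, and I = α : J. Then β_i^R(ω_{R/J}) = β_{i+1}^R(R/I) for all i ≥ g + 1, where ω_{R/J} = Ext^g_R(R/J, R) ≅ I/(α). -/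
open CategoryTheory IsLocalRing RingTheory.Sequence

section

open Limits

universe v u

namespace CategoryTheory

variable {C : Type u} [Category.{v} C] [Abelian C]

namespace ProjectiveResolution

/-- The augmentation of a projective resolution, with target the resolved object itself. -/
noncomputable def augmentation {Z : C} (P : ProjectiveResolution Z) : P.complex.X 0 ⟶ Z := P.π.f 0

lemma complex_d_comp_augmentation {Z : C} (P : ProjectiveResolution Z) :
    P.complex.d 1 0 ≫ P.augmentation = 0 := P.complex_d_comp_π_f_zero

instance {Z : C} (P : ProjectiveResolution Z) : Epi P.augmentation :=
  inferInstanceAs (Epi (P.π.f 0))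

lemma exact_augmentation {Z : C} (P : ProjectiveResolution Z) :
    (ShortComplex.mk (P.complex.d 1 0) P.augmentation P.complex_d_comp_augmentation).Exact :=
  P.exact₀

/-- A projective resolution of the kernel of an epimorphism from a projective object, continued
to a projective resolution of the target. -/
noncomputable def splice {S : ShortComplex C} (hS : S.ShortExact)
    [Projective S.X₂] (P : ProjectiveResolution S.X₁) : ProjectiveResolution S.X₃ where
  complex := P.complex.augment (P.augmentation ≫ S.f)
    (by rw [← Category.assoc, P.complex_d_comp_augmentation, zero_comp])
  projective n := by
    cases n with
    | zero => exact inferInstanceAs (Projective S.X₂)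
    | succ n => exact P.projective n
  π := (ChainComplex.toSingle₀Equiv _ _).symm ⟨S.g,
    (Category.assoc _ _ _).trans (Eq.trans (congrArg (P.augmentation ≫ ·) S.zero) comp_zero)⟩
  quasiIso := ⟨fun n => by
    have := hS.mono_f
    have := hS.epi_g
    match n with
    | 0 =>
      rw [ChainComplex.quasiIsoAt₀_iff, ShortComplex.quasiIso_iff_of_zeros']
      · have w : (P.augmentation ≫ S.f) ≫ S.g = 0 :=
          (Category.assoc _ _ _).trans (by rw [S.zero, comp_zero])
        let α : ShortComplex.mk (P.augmentation ≫ S.f) S.g w ⟶ S :=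
          { τ₁ := P.augmentation, τ₂ := 𝟙 _, τ₃ := 𝟙 _ }
        have : Epi α.τ₁ := inferInstanceAs (Epi P.augmentation)
        refine (ShortComplex.exact_and_epi_g_iff_of_iso ?_).2
          ⟨(ShortComplex.exact_iff_of_epi_of_isIso_of_mono α).2 hS.exact, inferInstanceAs (Epi S.g)⟩
        refine ShortComplex.isoMk (Iso.refl _) (Iso.refl _) (Iso.refl _) ?_ ?_
        · exact (Category.id_comp _).trans (Category.comp_id _).symm
        · exact (Category.id_comp _).trans (((ChainComplex.toSingle₀Equiv_symm_apply_f_zero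
            (C := P.complex.augment (P.augmentation ≫ S.f) _) S.g _).symm).trans
              (Category.comp_id _).symm)
      all_goals rfl
    | 1 =>
      rw [quasiIsoAt_iff_exactAt' (hL := ChainComplex.exactAt_succ_single_obj _ _)]
      rw [HomologicalComplex.exactAt_iff' _ 2 1 0 (by simp) (by simp)]
      have w : P.complex.d 1 0 ≫ P.augmentation ≫ S.f = 0 := by
        rw [← Category.assoc, P.complex_d_comp_augmentation, zero_comp]
      let α : ShortComplex.mk (P.complex.d 1 0) P.augmentation P.complex_d_comp_augmentation ⟶
          ShortComplex.mk (P.complex.d 1 0) (P.augmentation ≫ S.f) w :=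
        { τ₁ := 𝟙 _, τ₂ := 𝟙 _, τ₃ := S.f }
      have : Mono α.τ₃ := hS.mono_f
      exact (ShortComplex.exact_iff_of_epi_of_isIso_of_mono α).1 P.exact_augmentation
    | n + 2 =>
      rw [quasiIsoAt_iff_exactAt' (hL := ChainComplex.exactAt_succ_single_obj _ _)]
      rw [HomologicalComplex.exactAt_iff' _ (n+3) (n+2) (n+1) (by simp) (by simp)]
      exact P.exact_succ n⟩

end ProjectiveResolution

variable {D : Type*} [Category* D] [Abelian D]

theorem Functor.nonempty_leftDerived_iso_of_shortExact_of_projective [HasProjectiveResolutions C]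
    (F : C ⥤ D) [F.Additive] {S : ShortComplex C} (hS : S.ShortExact)
    [Projective S.X₂] (n : ℕ) :
    Nonempty ((F.leftDerived (n + 2)).obj S.X₃ ≅ (F.leftDerived (n + 1)).obj S.X₁) := by
  let P := projectiveResolution S.X₁
  refine ⟨(P.splice hS).isoLeftDerivedObj F (n + 2) ≪≫ ?_ ≪≫ (P.isoLeftDerivedObj F (n + 1)).symm⟩
  refine ShortComplex.homologyMapIso
      (HomologicalComplex.isoSc' _ (n + 3) (n + 2) (n + 1) (by simp) (by simp)) ≪≫ ?_ ≪≫
    ShortComplex.homologyMapIso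
      (HomologicalComplex.isoSc' _ (n + 2) (n + 1) n (by simp) (by simp)).symm
  exact Iso.refl _

lemma ShortComplex.ShortExact.exists_pullback_snd {S : ShortComplex C} (hS : S.ShortExact) {Y : C}
    (f : Y ⟶ S.X₃) :
    ∃ (i : S.X₁ ⟶ pullback S.g f) (w : i ≫ pullback.snd S.g f = 0),
      (ShortComplex.mk i (pullback.snd S.g f) w).ShortExact := by
  have := hS.mono_f
  have := hS.epi_g
  have hw : S.f ≫ S.g = 0 ≫ f := by rw [S.zero, zero_comp]
  have hm : Mono (pullback.lift S.f 0 hw) := mono_of_mono_fac (pullback.lift_fst _ _ _)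
  refine ⟨pullback.lift S.f 0 hw, pullback.lift_snd _ _ _, ?_⟩
  refine { exact := ShortComplex.exact_of_f_is_kernel _ (KernelFork.IsLimit.ofι' _ _ ?_)
           mono_f := hm, epi_g := inferInstanceAs (Epi (pullback.snd S.g f)) }
  intro A (k : A ⟶ pullback S.g f) (hk : k ≫ pullback.snd S.g f = 0)
  have hk' : (k ≫ pullback.fst S.g f) ≫ S.g = 0 := by
    rw [Category.assoc, pullback.condition, reassoc_of% hk, zero_comp]
  refine ⟨hS.exact.lift _ hk', pullback.hom_ext ?_ ?_⟩
  · exact (Category.assoc _ _ _).trans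
      ((hS.exact.lift _ hk' ≫= pullback.lift_fst _ _ _).trans (hS.exact.lift_f _ _))
  · exact (Category.assoc _ _ _).trans
      ((hS.exact.lift _ hk' ≫= pullback.lift_snd _ _ _).trans (comp_zero.trans hk.symm))

lemma ShortComplex.ShortExact.exists_pullback_fst {S : ShortComplex C} (hS : S.ShortExact) {Y : C}
    (f : Y ⟶ S.X₃) :
    ∃ (i : S.X₁ ⟶ pullback f S.g) (w : i ≫ pullback.fst f S.g = 0),
      (ShortComplex.mk i (pullback.fst f S.g) w).ShortExact := by
  obtain ⟨i, w, h⟩ := hS.exists_pullback_snd f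
  refine ⟨i ≫ (pullbackSymmetry _ _).hom, by simpa using w, ?_⟩
  refine ShortComplex.shortExact_of_iso ?_ h
  exact ShortComplex.isoMk (Iso.refl _) (pullbackSymmetry _ _) (Iso.refl _) (by simp) (by simp)

/-- Dimension shifting for left derived functors along a short exact sequence whose middle term
has finite projective dimension. -/
theorem Functor.nonempty_leftDerived_iso_of_hasProjectiveDimensionLT [EnoughProjectives C]
    (F : C ⥤ D) [F.Additive] (g : ℕ) :
    ∀ (S : ShortComplex C), S.ShortExact → HasProjectiveDimensionLT S.X₂ (g + 1) → ∀ n, g ≤ n →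
      Nonempty ((F.leftDerived (n + 2)).obj S.X₃ ≅ (F.leftDerived (n + 1)).obj S.X₁) := by
  induction g with
  | zero =>
    intro S hS h n _
    have := projective_iff_hasProjectiveDimensionLT_one.2 h
    exact F.nonempty_leftDerived_iso_of_shortExact_of_projective hS n
  | succ g ih =>
    intro S hS h n hn
    obtain ⟨n, rfl⟩ : ∃ m, n = m + 1 := ⟨n - 1, by omega⟩
    have := hS.mono_f
    have := hS.epi_g
    have ses {X Y : C} (f : X ⟶ Y) [Epi f] :
      (ShortComplex.mk (kernel.ι f) f (kernel.condition f)).ShortExact :=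
      { exact := ShortComplex.exact_of_f_is_kernel _ (kernelIsKernel f) }
    let π := Projective.π S.X₂
    have hB := ses π
    have hB' : HasProjectiveDimensionLT (Limits.kernel π) (g + 1) :=
      (hB.hasProjectiveDimensionLT_X₃_iff g inferInstance).1 h
    obtain ⟨_, _, hK⟩ := hB.exists_pullback_snd S.f
    let ρ := Projective.π S.X₁
    obtain ⟨_, _, hE⟩ := hK.exists_pullback_snd ρ
    obtain ⟨_, _, hL⟩ := (ses ρ).exists_pullback_fst (pullback.snd π S.f)
    have hE' : HasProjectiveDimensionLT (pullback (pullback.snd π S.f) ρ) (g + 1) :=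
      hE.hasProjectiveDimensionLT_X₂ (g + 1) hB' inferInstance
    have w : pullback.fst π S.f ≫ π ≫ S.g = 0 := by
      rw [pullback.condition_assoc, S.zero, comp_zero]
    have hP : (ShortComplex.mk (pullback.fst π S.f) (π ≫ S.g) w).ShortExact := by
      refine { exact := ShortComplex.exact_of_f_is_kernel _ (KernelFork.IsLimit.ofι' _ _ ?_)
               mono_f := inferInstanceAs (Mono (pullback.fst π S.f))
               epi_g := inferInstanceAs (Epi (π ≫ S.g)) }
      intro A (k : A ⟶ _) (hk : k ≫ π ≫ S.g = 0)
      exact ⟨pullback.lift k (hS.exact.lift (k ≫ π) (by simpa using hk)) (by simp),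
        pullback.lift_fst _ _ _⟩
    have : Projective (ShortComplex.mk (kernel.ι ρ) ρ (kernel.condition ρ)).X₂ :=
      inferInstanceAs (Projective (Projective.over S.X₁))
    have : Projective (ShortComplex.mk (pullback.fst π S.f) (π ≫ S.g) w).X₂ :=
      inferInstanceAs (Projective (Projective.over S.X₂))
    obtain ⟨i⟩ := F.nonempty_leftDerived_iso_of_shortExact_of_projective (ses ρ) n
    obtain ⟨j⟩ := ih _ hL hE' n (by omega)
    obtain ⟨k⟩ := F.nonempty_leftDerived_iso_of_shortExact_of_projective hP (n + 1)
    exact ⟨k ≪≫ j ≪≫ i.symm⟩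

end CategoryTheory

end

section

open Limits

universe v u

variable {R : Type u} [CommRing R]

namespace CategoryTheory
variable {C : Type v} [Category.{u} C] [Abelian C] [Linear R C]

/-- Functoriality of the cochain complex `Hom(K, Y)` in `Y`. -/
noncomputable def linearYonedaObjMap (R : Type u) [CommRing R] [Linear R C] (K : ChainComplex C ℕ)
    {Y Y' : C} (f : Y ⟶ Y') : K.linearYonedaObj R Y ⟶ K.linearYonedaObj R Y' where
  f i := ModuleCat.ofHom (Linear.rightComp R (K.X i) f)
  comm' i j _ := by
    ext (a : K.X i ⟶ Y)
    exact (Category.assoc (K.d j i) a f).symm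

/-- The short complex `Hom(K, S)` of cochain complexes. -/
noncomputable abbrev linearYonedaShortComplex (R : Type u) [CommRing R] [Linear R C]
    (K : ChainComplex C ℕ) (S : ShortComplex C) :
    ShortComplex (CochainComplex (ModuleCat.{u} R) ℕ) :=
  ShortComplex.mk (linearYonedaObjMap R K S.f) (linearYonedaObjMap R K S.g) (by
    ext i (a : K.X i ⟶ S.X₁)
    exact (Category.assoc a S.f S.g).trans (by rw [S.zero, comp_zero]; rfl))

lemma linearYonedaShortComplex_shortExact (K : ChainComplex C ℕ) [∀ i, Projective (K.X i)]
    {S : ShortComplex C} (hS : S.ShortExact) : (linearYonedaShortComplex R K S).ShortExact := by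
  have := hS.mono_f
  have := hS.epi_g
  refine HomologicalComplex.shortExact_of_degreewise_shortExact _ fun i => ?_
  refine { exact := ?_, mono_f := ?_, epi_g := ?_ }
  · refine (ShortComplex.moduleCat_exact_iff _).2 fun (a : K.X i ⟶ S.X₂) ha => ?_
    exact ⟨hS.exact.lift a ha, hS.exact.lift_f a ha⟩
  · refine (ModuleCat.mono_iff_injective _).2 fun (a b : K.X i ⟶ S.X₁) hab => ?_
    exact (cancel_mono S.f).1 hab
  · refine (ModuleCat.epi_iff_surjective _).2 fun (a : K.X i ⟶ S.X₃) => ?_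
    exact ⟨Projective.factorThru a S.g, Projective.factorThru_comp a S.g⟩

/-- If `r` annihilates `M`, then it annihilates `Ext(M, Y)`. -/
lemma ProjectiveResolution.homologyMap_linearYonedaObjMap_smul_eq_zero {M : C}
    (P : ProjectiveResolution M) {r : R} (hr : r • 𝟙 M = 0) (Y : C) (n : ℕ) :
    HomologicalComplex.homologyMap (linearYonedaObjMap R P.complex (r • 𝟙 Y)) n = 0 := by
  let h : Homotopy (r • 𝟙 P.complex) 0 := liftHomotopyZero (Q := P) _ (by
    ext
    refine (Linear.smul_comp _ _ _ r (𝟙 (P.complex.X 0)) P.augmentation).trans ?_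
    have : r • P.augmentation = P.augmentation ≫ (r • 𝟙 M) := by simp
    rw [Category.id_comp, this, hr, comp_zero]
    rfl)
  have H : Homotopy (linearYonedaObjMap R P.complex (r • 𝟙 Y)) 0 :=
    { hom := fun i j => ModuleCat.ofHom (Linear.leftComp R Y (h.hom j i))
      zero := fun i j hij => by
        ext (a : P.complex.X i ⟶ Y)
        exact (h.zero j i hij =≫ a).trans zero_comp
      comm := fun i => by
        ext (a : P.complex.X i ⟶ Y)
        have e : (r • 𝟙 (P.complex.X i)) = dNext i h.hom + prevD i h.hom + 0 := h.comm i
        have e' := e =≫ a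
        have e'' : a ≫ (r • 𝟙 Y) = (r • 𝟙 (P.complex.X i)) ≫ a := by simp
        refine e''.trans (e'.trans ?_)
        rw [add_zero, Preadditive.add_comp, add_comm]
        refine Eq.trans ?_ (add_zero _).symm
        exact congrArg₂ (· + ·) (Category.assoc _ _ _) (Category.assoc _ _ _) }
  rw [H.homologyMap_eq, HomologicalComplex.homologyMap_zero]

/-- The zeroth cohomology of `Hom(P, Y)` is `Hom(M, Y)`. -/
noncomputable def ProjectiveResolution.linearYonedaObjHomologyZeroIso {M : C}
    (P : ProjectiveResolution M) (Y : C) :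
    (P.complex.linearYonedaObj R Y).homology 0 ≅ ModuleCat.of R (M ⟶ Y) := by
  let f : ModuleCat.of R (M ⟶ Y) ⟶ (P.complex.linearYonedaObj R Y).X 0 :=
    ModuleCat.ofHom (Linear.leftComp R Y P.augmentation)
  let S : ShortComplex (ModuleCat R) := ShortComplex.mk f ((P.complex.linearYonedaObj R Y).d 0 1) (by
    ext (a : M ⟶ Y)
    refine (Category.assoc (P.complex.d 1 0) P.augmentation a).symm.trans ?_
    rw [P.complex_d_comp_augmentation, zero_comp]
    rfl)
  have : Mono S.f := (ModuleCat.mono_iff_injective _).2 fun (a b : M ⟶ Y) hab =>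
    (cancel_epi P.augmentation).1 hab
  have hS : S.Exact := (ShortComplex.moduleCat_exact_iff _).2 fun (a : P.complex.X 0 ⟶ Y) ha =>
    ⟨P.exact_augmentation.desc a ha, P.exact_augmentation.g_desc a ha⟩
  exact (CochainComplex.isoHomologyπ₀ _).symm ≪≫
    IsLimit.conePointUniqueUpToIso
      ((P.complex.linearYonedaObj R Y).cyclesIsKernel 0 1 (CochainComplex.next ℕ 0)) hS.fIsKernel

end CategoryTheory

open Pointwise

/-- `Ext^i(M, N)` vanishes for `i` less than the length `n` of a regular sequence on `N` which
annihilates `M`, and `Ext^n(M, N)` is the module of homomorphisms to the quotient of `N`. -/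
theorem CategoryTheory.ProjectiveResolution.linearYonedaObj_homology_of_isWeaklyRegular
    {M : ModuleCat.{u} R} (P : ProjectiveResolution M) (rs : List R) :
    ∀ N : ModuleCat.{u} R, IsWeaklyRegular N rs → (∀ r ∈ rs, ∀ m : M, r • m = 0) →
    (∀ n < rs.length, IsZero ((P.complex.linearYonedaObj R N).homology n)) ∧
      Nonempty ((P.complex.linearYonedaObj R N).homology rs.length ≅
        ModuleCat.of R (M →ₗ[R] N ⧸ (Ideal.ofList rs • ⊤ : Submodule R N))) := by
  induction rs with
  | nil =>
    intro N _ _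
    refine ⟨fun n hn => absurd hn (by simp), ⟨P.linearYonedaObjHomologyZeroIso N ≪≫
      (ModuleCat.homLinearEquiv (S := R) ≪≫ₗ LinearEquiv.congrRight
        (Submodule.quotEquivOfEqBot _ (by simp)).symm).toModuleIso⟩⟩
  | cons x rs ih =>
    intro N hN hM
    obtain ⟨hx, hN'⟩ := (isWeaklyRegular_cons_iff N x rs).1 hN
    have hxM : x • 𝟙 M = 0 := by ext m; exact hM x (by simp) m
    have hrs := ih (ModuleCat.of R (QuotSMulTop x N)) hN' (fun r hr => hM r (by simp [hr]))
    have hS := hx.smulShortComplex_shortExact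
    have hE := linearYonedaShortComplex_shortExact (R := R) P.complex hS
    have hz (n : ℕ) : HomologicalComplex.homologyMap
        (linearYonedaShortComplex R P.complex (ModuleCat.smulShortComplex N x)).f n = 0 :=
      P.homologyMap_linearYonedaObjMap_smul_eq_zero hxM N n
    have hzero : ∀ n < rs.length + 1, IsZero ((P.complex.linearYonedaObj R N).homology n) := by
      intro n hn
      cases n with
      | zero =>
        refine IsZero.of_iso ?_ (P.linearYonedaObjHomologyZeroIso N)
        have : Subsingleton (M ⟶ N) := ⟨fun a b => by
          ext m
          apply hx
          change x • a m = x • b m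
          rw [← map_smul, ← map_smul, hM x (by simp), map_zero, map_zero]⟩
        exact ModuleCat.isZero_of_subsingleton _
      | succ n =>
        have : Mono (HomologicalComplex.homologyMap
            (linearYonedaShortComplex R P.complex (ModuleCat.smulShortComplex N x)).f (n + 1)) :=
          (hE.homology_exact₁ n (n + 1) rfl).mono_g ((hrs.1 n (by omega)).eq_of_src _ _)
        exact @IsZero.of_mono_eq_zero _ _ _ _ _ _ this (hz (n + 1))
    refine ⟨hzero, ?_⟩
    obtain ⟨e⟩ := hrs.2
    have hm : Mono (hE.δ rs.length (rs.length + 1) rfl) :=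
      (hE.homology_exact₃ rs.length (rs.length + 1) rfl).mono_g
        ((hzero rs.length (by omega)).eq_of_src _ _)
    have he : Epi (hE.δ rs.length (rs.length + 1) rfl) :=
      (hE.homology_exact₁ rs.length (rs.length + 1) rfl).epi_f (hz _)
    have := isIso_of_mono_of_epi (hE.δ rs.length (rs.length + 1) rfl)
    exact ⟨(asIso (hE.δ rs.length (rs.length + 1) rfl)).symm ≪≫ e ≪≫
      (LinearEquiv.congrRight
        (Submodule.quotOfListConsSMulTopEquivQuotSMulTopInner N x rs).symm).toModuleIso⟩
end

section
variable {R : Type} [CommRing R]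

theorem hasProjectiveDimensionLT_quotient_ofList [IsNoetherianRing R] [IsLocalRing R]
    (rs : List R) (hreg : IsRegular R rs) :
    HasProjectiveDimensionLT (ModuleCat.of R (R ⧸ Ideal.ofList rs)) (rs.length + 1) := by
  have h := ModuleCat.projectiveDimension_quotient_eq_length rs hreg
  have : HasProjectiveDimensionLT (ModuleCat.of R (Shrink.{0} (R ⧸ Ideal.ofList rs)))
      (rs.length + 1) := by
    rw [← projectiveDimension_lt_iff, h]
    exact_mod_cast Nat.lt_succ_self _
  exact hasProjectiveDimensionLT_of_iso (Shrink.linearEquiv R _).toModuleIso _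

theorem nonempty_extM_quotient_iso (J : Ideal R) (rs : List R) (hmem : ∀ x ∈ rs, x ∈ J)
    (hreg : IsWeaklyRegular R rs) :
    Nonempty (ExtM R rs.length (ModuleCat.of R (R ⧸ J)) (ModuleCat.of R R) ≅
      ModuleCat.of R ((R ⧸ J) →ₗ[R] R ⧸ Ideal.ofList rs)) := by
  let P := projectiveResolution (ModuleCat.of R (R ⧸ J))
  obtain ⟨e⟩ := (P.linearYonedaObj_homology_of_isWeaklyRegular rs (ModuleCat.of R R) hreg
    (by
      intro r hr (m : R ⧸ J)
      obtain ⟨m, rfl⟩ := Ideal.Quotient.mk_surjective m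
      exact Ideal.Quotient.eq_zero_iff_mem.2 (J.mul_mem_right m (hmem r hr)))).2
  exact ⟨P.isoExt rs.length _ ≪≫ e ≪≫ (LinearEquiv.congrRight
    (Submodule.quotEquivOfEq (Ideal.ofList rs • ⊤ : Ideal R) (Ideal.ofList rs)
      (by simp))).toModuleIso⟩

/-- The sequence `0 → Hom(R ⧸ J, R ⧸ A) → R ⧸ A → R ⧸ (A : J) → 0` is exact. -/
theorem exists_shortExact_hom_quotient_colon (A J I : Ideal R) (hI : I = Submodule.colon A J) :
    ∃ (f : ModuleCat.of R ((R ⧸ J) →ₗ[R] R ⧸ A) ⟶ ModuleCat.of R (R ⧸ A))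
      (g : ModuleCat.of R (R ⧸ A) ⟶ ModuleCat.of R (R ⧸ I)) (w : f ≫ g = 0),
      (ShortComplex.mk f g w).ShortExact := by
  have hmem (r : R) : r ∈ I ↔ ∀ s ∈ J, r * s ∈ A := by
    rw [hI, Submodule.mem_colon]; rfl
  have hle : A ≤ I := fun a ha => (hmem a).2 fun s _ => A.mul_mem_right s ha
  let f : ((R ⧸ J) →ₗ[R] R ⧸ A) →ₗ[R] R ⧸ A := LinearMap.applyₗ (1 : R ⧸ J)
  let g : (R ⧸ A) →ₗ[R] R ⧸ I := Submodule.factor hle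
  have exact : Function.Exact f g := by
    intro y
    obtain ⟨a, rfl⟩ := Ideal.Quotient.mk_surjective y
    have hg : g (Ideal.Quotient.mk A a) = 0 ↔ a ∈ I := Ideal.Quotient.eq_zero_iff_mem
    rw [hg, hmem]
    constructor
    · intro h
      refine ⟨Submodule.liftQ J (LinearMap.toSpanSingleton R _ (Ideal.Quotient.mk A a)) ?_, ?_⟩
      · intro s hs
        refine Ideal.Quotient.eq_zero_iff_mem.2 ?_
        exact (congrArg (· ∈ A) (mul_comm a s)).mp (h s hs)
      · exact one_smul R (Ideal.Quotient.mk A a)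
    · rintro ⟨φ, hφ⟩ s hs
      have hφ' : φ 1 = Ideal.Quotient.mk A a := hφ
      have h1 : s • (1 : R ⧸ J) = 0 := by
        rw [Algebra.smul_def, mul_one]
        exact Ideal.Quotient.eq_zero_iff_mem.2 hs
      have h2 : s • φ 1 = 0 := by rw [← map_smul, h1, map_zero]
      rw [hφ'] at h2
      rw [mul_comm]
      exact Ideal.Quotient.eq_zero_iff_mem.1 h2
  have inj : Function.Injective f := fun φ ψ h => by
    ext
    exact h
  refine ⟨ModuleCat.ofHom f, ModuleCat.ofHom g, ?_, ?_⟩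
  · ext φ
    exact exact.apply_apply_eq_zero φ
  · exact
      { exact := (ShortComplex.moduleCat_exact_iff _).2 fun y hy => (exact y).1 hy
        mono_f := (ModuleCat.mono_iff_injective _).2 inj
        epi_g := (ModuleCat.epi_iff_surjective _).2 (Submodule.factor_surjective hle) }

end

theorem stmt12 (R : Type) [CommRing R] [IsNoetherianRing R] [IsLocalRing R]
    (hCM : IsCMLocalRing R)
    (J : Ideal R) (g : ℕ) (hht : idealHt R J = (g : WithBot (WithTop ℕ)))
    (rs : List R) (hlen : rs.length = g) (hmem : ∀ x ∈ rs, x ∈ J)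
    (hreg : RingTheory.Sequence.IsRegular R rs) (hmax : GradeEq R J g)
    (I : Ideal R) (hI : I = Submodule.colon (Ideal.ofList rs) J) :
    ∀ i : ℕ, g + 1 ≤ i → ∀ b b' : ℕ,
      HasBetti R (ExtM R g (ModuleCat.of R (R ⧸ J)) (ModuleCat.of R R)) i b →
      HasBetti R (ModuleCat.of R (R ⧸ I)) (i+1) b' → b = b' := by
  intro i hi b b' ⟨e⟩ ⟨e'⟩
  obtain ⟨n, rfl⟩ : ∃ n, i = n + 1 := ⟨i - 1, by omega⟩
  subst hlen
  obtain ⟨φ⟩ := nonempty_extM_quotient_iso J rs hmem hreg.toIsWeaklyRegular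
  obtain ⟨f, h, w, hS⟩ := exists_shortExact_hom_quotient_colon (Ideal.ofList rs) J I hI
  let F := (MonoidalCategory.tensoringLeft (ModuleCat R)).obj (ModuleCat.of R (ResidueField R))
  obtain ⟨ψ⟩ := F.nonempty_leftDerived_iso_of_hasProjectiveDimensionLT rs.length _ hS
    (hasProjectiveDimensionLT_quotient_ofList rs hreg) n (by omega)
  let ε := e.symm ≪≫ (F.leftDerived (n + 1)).mapIso φ ≪≫ ψ.symm ≪≫ e'
  let l : (Fin b → ResidueField R) ≃ₗ[ResidueField R] (Fin b' → ResidueField R) :=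
    ε.toLinearEquiv.extendScalarsOfSurjective residue_surjective
  simpa using l.finrank_eq
end

section
/- Let R be a Gorenstein local ring of dimension d and J an ideal of height g such that R/J is Cohen-Macaulay. Then β_i^R(ω_{R/J}) = μ^{d-g+i}_R(R/J) for all i ≥ 0, i.e. the i-th Betti number of the canonical module of R/J equals the (d-g+i)-th Bass number of R/J over R. -/
open CategoryTheory IsLocalRing RingTheory.Sequence

namespace BassBetti

open Abelian.Ext

lemma injective_of_exact {R A B C : Type*} [Ring R] [AddCommGroup A] [AddCommGroup B]
    [AddCommGroup C] [Module R A] [Module R B] [Module R C] {f : A →ₗ[R] B} {g : B →ₗ[R] C}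
    (h : Function.Exact f g) (hf : ∀ a, f a = 0) : Function.Injective g := by
  refine (injective_iff_map_eq_zero g).mpr fun b hb ↦ ?_
  obtain ⟨a, rfl⟩ := (h b).mp hb
  exact hf a

section LongExact

variable {R : Type} [CommRing R] {S : ShortComplex (ModuleCat.{0} R)}

lemma exact_postcomp_mid (hS : S.ShortExact) (X : ModuleCat.{0} R) (n : ℕ) : Function.Exact
    ((mk₀ S.f).postcompOfLinear R X (add_zero n))
    ((mk₀ S.g).postcompOfLinear R X (add_zero n)) := by
  have := covariant_sequence_exact₂' X hS n
  rwa [ShortComplex.ab_exact_iff_function_exact] at this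

lemma exact_postcomp_right (hS : S.ShortExact) (X : ModuleCat.{0} R) (n : ℕ) : Function.Exact
    ((mk₀ S.g).postcompOfLinear R X (add_zero n))
    (hS.extClass.postcompOfLinear R X (rfl : n + 1 = n + 1)) := by
  have := covariant_sequence_exact₃' X hS n (n + 1) rfl
  rwa [ShortComplex.ab_exact_iff_function_exact] at this

lemma exact_postcomp_left (hS : S.ShortExact) (X : ModuleCat.{0} R) (n : ℕ) : Function.Exact
    (hS.extClass.postcompOfLinear R X (rfl : n + 1 = n + 1))
    ((mk₀ S.f).postcompOfLinear R X (add_zero (n + 1))) := by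
  have := covariant_sequence_exact₁' X hS n (n + 1) rfl
  rwa [ShortComplex.ab_exact_iff_function_exact] at this

lemma exact_precomp_mid (hS : S.ShortExact) (X : ModuleCat.{0} R) (n : ℕ) : Function.Exact
    ((mk₀ S.g).precompOfLinear R X (zero_add n))
    ((mk₀ S.f).precompOfLinear R X (zero_add n)) := by
  have := contravariant_sequence_exact₂' hS X n
  rwa [ShortComplex.ab_exact_iff_function_exact] at this

lemma exact_precomp_left (hS : S.ShortExact) (X : ModuleCat.{0} R) (n : ℕ) : Function.Exact
    ((mk₀ S.f).precompOfLinear R X (zero_add n))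
    (hS.extClass.precompOfLinear R X (add_comm 1 n)) := by
  have := contravariant_sequence_exact₁' hS X n (n + 1) (add_comm 1 n)
  rwa [ShortComplex.ab_exact_iff_function_exact] at this

lemma exact_precomp_right (hS : S.ShortExact) (X : ModuleCat.{0} R) (n : ℕ) : Function.Exact
    (hS.extClass.precompOfLinear R X (add_comm 1 n))
    ((mk₀ S.g).precompOfLinear R X (zero_add (n + 1))) := by
  have := contravariant_sequence_exact₃' hS X n (n + 1) (add_comm 1 n)
  rwa [ShortComplex.ab_exact_iff_function_exact] at this

lemma postcomp_mono_injective (hS : S.ShortExact) (X : ModuleCat.{0} R) :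
    Function.Injective ((mk₀ S.f).postcompOfLinear R X (add_zero 0)) :=
  have := hS.mono_f
  postcomp_mk₀_injective_of_mono X S.f

lemma precomp_epi_injective (hS : S.ShortExact) (X : ModuleCat.{0} R) :
    Function.Injective ((mk₀ S.g).precompOfLinear R X (zero_add 0)) :=
  have := hS.epi_g
  precomp_mk₀_injective_of_epi X S.g

end LongExact

section Smul

variable {R : Type} [CommRing R] {M N : ModuleCat.{0} R}

lemma postcomp_smul_id (r : R) (n : ℕ) :
    (mk₀ (r • 𝟙 M)).postcompOfLinear R N (add_zero n) = LinearMap.lsmul R _ r := by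
  ext e
  simp [mk₀_smul]

lemma precomp_smul_id (r : R) (n : ℕ) :
    (mk₀ (r • 𝟙 N)).precompOfLinear R M (zero_add n) = LinearMap.lsmul R _ r := by
  ext e
  simp [mk₀_smul]

lemma smul_ext_eq_zero_left {r : R} (hr : ∀ x : N, r • x = 0) {n : ℕ}
    (e : Abelian.Ext N M n) : r • e = 0 := by
  have h : r • 𝟙 N = 0 := by
    ext x
    exact hr x
  have := DFunLike.congr_fun (precomp_smul_id (M := M) (N := N) r n) e
  simpa [h] using this.symm

lemma smul_ext_eq_zero_right {r : R} (hr : ∀ x : M, r • x = 0) {n : ℕ}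
    (e : Abelian.Ext N M n) : r • e = 0 := by
  have h : r • 𝟙 M = 0 := by
    ext x
    exact hr x
  have := DFunLike.congr_fun (postcomp_smul_id (M := M) (N := N) r n) e
  simpa [h] using this.symm

variable {x : R}

lemma exact_ext_smul_right (hx : IsSMulRegular M x) (n : ℕ) : Function.Exact
    (LinearMap.lsmul R (Abelian.Ext N M n) x)
    ((mk₀ (M.smulShortComplex x).g).postcompOfLinear R N (add_zero n)) := by
  rw [← postcomp_smul_id]
  exact exact_postcomp_mid hx.smulShortComplex_shortExact N n

lemma exact_ext_extClass_smul_right (hx : IsSMulRegular M x) (n : ℕ) : Function.Exact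
    (hx.smulShortComplex_shortExact.extClass.postcompOfLinear R N (rfl : n + 1 = n + 1))
    (LinearMap.lsmul R (Abelian.Ext N M (n + 1)) x) := by
  rw [← postcomp_smul_id]
  exact exact_postcomp_left hx.smulShortComplex_shortExact N n

lemma exact_ext_smul_left (hx : IsSMulRegular N x) (n : ℕ) : Function.Exact
    (LinearMap.lsmul R (Abelian.Ext N M n) x)
    (hx.smulShortComplex_shortExact.extClass.precompOfLinear R M (add_comm 1 n)) := by
  rw [← precomp_smul_id]
  exact exact_precomp_left hx.smulShortComplex_shortExact M n

lemma exact_ext_smul_left_mid (hx : IsSMulRegular N x) (n : ℕ) : Function.Exact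
    ((mk₀ (N.smulShortComplex x).g).precompOfLinear R M (zero_add n))
    (LinearMap.lsmul R (Abelian.Ext N M n) x) := by
  rw [← precomp_smul_id]
  exact exact_precomp_mid hx.smulShortComplex_shortExact M n

lemma ext_smul_surjective_of_subsingleton (hx : IsSMulRegular N x) (n : ℕ)
    (h : Subsingleton (Abelian.Ext (ModuleCat.of R (QuotSMulTop x N)) M (n + 1))) :
    Function.Surjective (LinearMap.lsmul R (Abelian.Ext N M n) x) := fun e ↦
  (exact_ext_smul_left hx n e).mp (Subsingleton.elim (α := Abelian.Ext (ModuleCat.of R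
    (QuotSMulTop x N)) M (n + 1)) _ _)

/-- If `x` is regular on `M` and kills `N`, the long exact sequence of `Ext(N, -)` breaks up. -/
lemma length_ext_quotSMulTop_right (hx : IsSMulRegular M x) (hN : ∀ y : N, x • y = 0) (n : ℕ) :
    Module.length R (Abelian.Ext N (ModuleCat.of R (QuotSMulTop x M)) n) =
      Module.length R (Abelian.Ext N M n) + Module.length R (Abelian.Ext N M (n + 1)) := by
  refine Module.length_eq_add_of_exact
    ((mk₀ (M.smulShortComplex x).g).postcompOfLinear R N (add_zero n))
    (hx.smulShortComplex_shortExact.extClass.postcompOfLinear R N (rfl : n + 1 = n + 1)) ?_ ?_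
    (exact_postcomp_right hx.smulShortComplex_shortExact N n)
  · exact injective_of_exact (exact_ext_smul_right hx n) fun e ↦ smul_ext_eq_zero_left hN e
  · intro e
    exact (exact_ext_extClass_smul_right hx n e).mp (smul_ext_eq_zero_left hN e)

/-- If `x` is regular on `N` and kills `M`, the long exact sequence of `Ext(-, M)` breaks up. -/
lemma length_ext_quotSMulTop_left (hx : IsSMulRegular N x) (hM : ∀ y : M, x • y = 0) (n : ℕ) :
    Module.length R (Abelian.Ext (ModuleCat.of R (QuotSMulTop x N)) M (n + 1)) =
      Module.length R (Abelian.Ext N M n) + Module.length R (Abelian.Ext N M (n + 1)) := by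
  refine Module.length_eq_add_of_exact
    (hx.smulShortComplex_shortExact.extClass.precompOfLinear R M (add_comm 1 n))
    ((mk₀ (N.smulShortComplex x).g).precompOfLinear R M (zero_add (n + 1))) ?_ ?_
    (exact_precomp_right hx.smulShortComplex_shortExact M n)
  · exact injective_of_exact (exact_ext_smul_left hx n) fun e ↦ smul_ext_eq_zero_right hM e
  · intro e
    exact (exact_ext_smul_left_mid hx (n + 1) e).mp (smul_ext_eq_zero_right hM e)

lemma length_ext_zero_quotSMulTop_left (hx : IsSMulRegular N x) (hM : ∀ y : M, x • y = 0) :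
    Module.length R (Abelian.Ext (ModuleCat.of R (QuotSMulTop x N)) M 0) =
      Module.length R (Abelian.Ext N M 0) := by
  refine (LinearEquiv.ofBijective
    ((mk₀ (N.smulShortComplex x).g).precompOfLinear R M (zero_add 0))
    ⟨precomp_epi_injective hx.smulShortComplex_shortExact M, fun e ↦ ?_⟩).length_eq
  exact (exact_ext_smul_left_mid hx 0 e).mp (smul_ext_eq_zero_right hM e)

end Smul

section Transport

variable {R : Type} [CommRing R]

/-- `Ext` is invariant under isomorphism in both variables. -/
lemma nonempty_extEquiv {M M' N N' : ModuleCat.{0} R} (e : M ≅ M') (f : N ≅ N') (n : ℕ) :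
    Nonempty (Abelian.Ext M N n ≃ₗ[R] Abelian.Ext M' N' n) := by
  refine ⟨LinearEquiv.ofLinearMap
    (((mk₀ f.hom).postcompOfLinear R M' (add_zero n)).comp
      ((mk₀ e.inv).precompOfLinear R N (zero_add n)))
    (((mk₀ f.inv).postcompOfLinear R M (add_zero n)).comp
      ((mk₀ e.hom).precompOfLinear R N' (zero_add n))) ?_ ?_⟩ <;>
  · ext e
    simp

end Transport

section Depth

variable {R : Type} [CommRing R]

lemma subsingleton_of_smul_injective_of_pow_smul {E : Type*} [AddCommGroup E] [Module R E] {r : R}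
    (hr : Function.Injective (LinearMap.lsmul R E r)) {n : ℕ} (hn : ∀ e : E, r ^ n • e = 0) :
    Subsingleton E := by
  have h : IsSMulRegular E (r ^ n) := IsSMulRegular.pow n hr
  exact ⟨fun a b ↦ h (by simp only [hn])⟩

lemma subsingleton_ext_of_isWeaklyRegular {rs : List R} {L : ModuleCat.{0} R}
    (h : IsWeaklyRegular L rs) (N : ModuleCat.{0} R)
    (hN : ∀ r ∈ rs, ∃ n : ℕ, ∀ y : N, r ^ n • y = 0) :
    ∀ j < rs.length, Subsingleton (Abelian.Ext N L j) := by
  induction rs generalizing L with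
  | nil => simp
  | cons r rs ih =>
    obtain ⟨hr, hrs⟩ := (isWeaklyRegular_cons_iff L r rs).mp h
    obtain ⟨n, hn⟩ := hN r (by simp)
    have ih' := ih (L := ModuleCat.of R (QuotSMulTop r L)) hrs fun s hs ↦ hN s (by simp [hs])
    intro j hj
    refine subsingleton_of_smul_injective_of_pow_smul (r := r) ?_
      (fun e ↦ smul_ext_eq_zero_left hn e)
    cases j with
    | zero =>
      rw [← postcomp_smul_id]
      exact postcomp_mono_injective hr.smulShortComplex_shortExact N
    | succ j =>
      have := ih' j (by simpa using hj)
      exact injective_of_exact (exact_ext_extClass_smul_right hr j) fun a ↦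
        (congrArg _ (Subsingleton.elim (α := Abelian.Ext N (ModuleCat.of R (QuotSMulTop r L)) j)
          a 0)).trans (map_zero _)

lemma subsingleton_of_exact {A B C : Type*} [AddCommGroup A] [AddCommGroup B]
    [AddCommGroup C] [Module R A] [Module R B] [Module R C] {f : A →ₗ[R] B} {g : B →ₗ[R] C}
    (h : Function.Exact f g) [Subsingleton A] [Subsingleton C] : Subsingleton B := by
  refine subsingleton_of_forall_eq 0 fun b ↦ ?_
  obtain ⟨a, rfl⟩ := (h b).mp (Subsingleton.elim _ _)
  rw [Subsingleton.elim a 0, map_zero]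

/-- Vanishing of `Ext` below degree `n` produces a regular sequence of length `n`. -/
lemma exists_isWeaklyRegular_of_subsingleton_ext [IsNoetherianRing R] (N : ModuleCat.{0} R)
    [Module.Finite R N] (n : ℕ) (L : ModuleCat.{0} R) [Module.Finite R L]
    (h : ∀ j < n, Subsingleton (Abelian.Ext N L j)) :
    ∃ rs : List R, rs.length = n ∧ (∀ r ∈ rs, r ∈ Module.annihilator R N) ∧
      IsWeaklyRegular L rs := by
  induction n generalizing L with
  | zero => exact ⟨[], rfl, by simp, IsWeaklyRegular.nil R L⟩
  | succ n ih =>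
    have h0 : Subsingleton (N →ₗ[R] L) :=
      have := h 0 (by simp)
      ((linearEquiv₀ (R := R)).trans (ModuleCat.homLinearEquiv (S := R)) :
        Abelian.Ext N L 0 ≃ₗ[R] _).toEquiv.subsingleton_congr.mp this
    obtain ⟨r, hrN, hr⟩ := IsSMulRegular.subsingleton_linearMap_iff.mp h0
    obtain ⟨rs, hlen, hrs, hreg⟩ := ih (ModuleCat.of R (QuotSMulTop r L)) fun j hj ↦
      have : Subsingleton (Abelian.Ext N (L.smulShortComplex r).X₂ j) := h j (by lia)
      have : Subsingleton (Abelian.Ext N (L.smulShortComplex r).X₁ (j + 1)) := h (j + 1) (by lia)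
      subsingleton_of_exact (exact_postcomp_right hr.smulShortComplex_shortExact N j)
    exact ⟨r :: rs, by simp [hlen], by simpa [hrN] using hrs, hreg.cons hr⟩

lemma bijective_postcomp_iso {L L' : ModuleCat.{0} R} (e : L ≅ L') (N : ModuleCat.{0} R) :
    Function.Bijective ((mk₀ e.hom).postcompOfLinear R N (add_zero 0)) :=
  Function.bijective_iff_has_inverse.mpr
    ⟨(mk₀ e.inv).postcompOfLinear R N (add_zero 0), fun a ↦ by simp, fun a ↦ by simp⟩

/-- Rees: a weakly regular sequence `rs` on `L` identifies `Hom(N, L/rs)` with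
`Ext^n(N, L)` for `N` killed by `rs`, by composition with a class independent of `N`. -/
lemma exists_bijective_comp_of_isWeaklyRegular {rs : List R} {L : ModuleCat.{0} R}
    (h : IsWeaklyRegular L rs) :
    ∃ α : Abelian.Ext (ModuleCat.of R (L ⧸ (Ideal.ofList rs • ⊤ : Submodule R L))) L rs.length,
      ∀ N : ModuleCat.{0} R, (∀ r ∈ rs, ∀ y : N, r • y = 0) →
        Function.Bijective (α.postcompOfLinear R N (zero_add rs.length)) := by
  induction rs generalizing L with
  | nil =>
    let e : (L ⧸ (Ideal.ofList ([] : List R) • ⊤ : Submodule R L)) ≃ₗ[R] L :=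
      Submodule.quotEquivOfEqBot _ (by simp)
    exact ⟨mk₀ e.toModuleIso.hom, fun N _ ↦ bijective_postcomp_iso e.toModuleIso N⟩
  | cons r rs ih =>
    obtain ⟨hr, hrs⟩ := (isWeaklyRegular_cons_iff L r rs).mp h
    obtain ⟨α, hα⟩ := ih (L := ModuleCat.of R (QuotSMulTop r L)) hrs
    let e := (Submodule.quotOfListConsSMulTopEquivQuotSMulTopInner L r rs).toModuleIso
    refine ⟨(mk₀ e.hom).comp (α.comp hr.smulShortComplex_shortExact.extClass rfl)
      (zero_add _), fun N hN ↦ ?_⟩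
    have h1 := hα N fun s hs ↦ hN s (by simp [hs])
    have h2 : Function.Bijective (hr.smulShortComplex_shortExact.extClass.postcompOfLinear R N
        (rfl : rs.length + 1 = rs.length + 1)) := by
      refine ⟨injective_of_exact (exact_postcomp_right hr.smulShortComplex_shortExact N _)
        fun a ↦ ?_, fun b ↦ (exact_ext_extClass_smul_right hr _ b).mp
          (smul_ext_eq_zero_left (hN r (by simp)) b)⟩
      have := subsingleton_ext_of_isWeaklyRegular h N
        (fun s hs ↦ ⟨1, fun y ↦ by rw [pow_one, hN s hs]⟩) rs.length (by simp)
      exact (congrArg _ (Subsingleton.elim (α := Abelian.Ext N L _) a 0)).trans (map_zero _)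
    have h3 := h2.comp (h1.comp (bijective_postcomp_iso e N))
    refine (congrArg Function.Bijective (funext fun a ↦ ?_)).mpr h3
    change a.comp ((mk₀ e.hom).comp (α.comp _ rfl) (zero_add _)) (zero_add (rs.length + 1)) =
      ((a.comp (mk₀ e.hom) (add_zero 0)).comp α (zero_add rs.length)).comp _ rfl
    exact (comp_assoc _ _ _ (add_zero 0) (zero_add _) (by simp)).symm.trans
      (comp_assoc _ _ _ (zero_add _) rfl (by simp)).symm

end Depth

section InjectiveHull

variable {R : Type} [CommRing R]

/-- Every submodule of an injective module has an injective essential extension. -/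
lemma exists_injective_essential {E : Type} [AddCommGroup E] [Module R E] [Module.Injective R E]
    (S : Submodule R E) : ∃ T : Submodule R E, S ≤ T ∧ Module.Injective R T ∧
      ∀ x ∈ T, x ≠ 0 → ∃ r : R, r • x ∈ S ∧ r • x ≠ 0 := by
  let P : Set (Submodule R E) := {T | S ≤ T ∧ ∀ x ∈ T, x ≠ 0 → ∃ r : R, r • x ∈ S ∧ r • x ≠ 0}
  obtain ⟨T, -, hT⟩ := zorn_le_nonempty₀ P (fun c hc hchain T₀ hT₀ ↦ by
      refine ⟨sSup c, ⟨(hc hT₀).1.trans (le_sSup hT₀), fun x hx hx0 ↦ ?_⟩, fun z hz ↦ le_sSup hz⟩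
      obtain ⟨T, hTc, hxT⟩ := (Submodule.mem_sSup_of_directed ⟨T₀, hT₀⟩ hchain.directedOn).mp hx
      exact (hc hTc).2 x hxT hx0) S ⟨le_rfl, fun x hx hx0 ↦ ⟨1, by simpa using hx, by simpa⟩⟩
  obtain ⟨C, -, hC⟩ := zorn_le_nonempty₀ {C : Submodule R E | Disjoint T C}
    (fun c hc hchain T₀ hT₀ ↦ by
      refine ⟨sSup c, Submodule.disjoint_def.mpr fun x hxT hx ↦ ?_, fun z hz ↦ le_sSup hz⟩
      obtain ⟨C, hCc, hxC⟩ := (Submodule.mem_sSup_of_directed ⟨T₀, hT₀⟩ hchain.directedOn).mp hx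
      exact Submodule.disjoint_def.mp (hc hCc) x hxT hxC) ⊥ disjoint_bot_right
  obtain ⟨⟨hST, hTess⟩, hTmax⟩ := hT
  have hTC : Disjoint T C := hC.prop
  obtain ⟨h, hh⟩ := Module.Injective.extension_property R E T (E ⧸ C) (C.mkQ.comp T.subtype)
    ((injective_iff_map_eq_zero _).mpr fun x hx ↦ Subtype.ext
      (Submodule.disjoint_def.mp hTC x x.2 (by simpa using hx))) T.subtype
  have hh' (x : E) (hx : x ∈ T) : h (C.mkQ x) = x := DFunLike.congr_fun hh ⟨x, hx⟩
  have hker : ∀ x, h (C.mkQ x) = 0 → x ∈ C := fun x hx ↦ by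
    have hD : C ≤ LinearMap.ker (h.comp C.mkQ) := fun y hy ↦ by
      have : C.mkQ y = 0 := by simpa using hy
      simp [-Submodule.mkQ_apply, this]
    refine hC.le_of_ge (y := LinearMap.ker (h.comp C.mkQ)) (Submodule.disjoint_def.mpr
      fun y hyT hy ↦ ?_) hD hx
    rw [← hh' y hyT]
    exact hy
  have hrange : ∀ x, h (C.mkQ x) ∈ T := fun x ↦ by
    refine hTmax (y := LinearMap.range (h.comp C.mkQ)) ⟨?_, ?_⟩ ?_ ⟨x, rfl⟩
    · exact fun y hy ↦ ⟨y, hh' y (hST hy)⟩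
    · rintro _ ⟨z, rfl⟩ hz
      have hzC : z ∉ C := fun hz' ↦ hz (by
        have : C.mkQ z = 0 := by simpa using hz'
        simp [-Submodule.mkQ_apply, this])
      have : ¬ Disjoint T (C ⊔ Submodule.span R {z}) := fun hdis ↦ hzC
        (hC.le_of_ge hdis le_sup_left
          (Submodule.mem_sup_right (Submodule.mem_span_singleton_self z)))
      rw [Submodule.disjoint_def] at this
      push Not at this
      obtain ⟨y, hyT, hy, hy0⟩ := this
      obtain ⟨c, hc, w, hw, rfl⟩ := Submodule.mem_sup.mp hy
      obtain ⟨r, rfl⟩ := Submodule.mem_span_singleton.mp hw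
      have hc0 : C.mkQ c = 0 := by simpa using hc
      have key : r • h (C.mkQ z) = c + r • z := by
        rw [← hh' _ hyT, map_add, hc0, zero_add, map_smul, map_smul]
      obtain ⟨s, hs, hs0⟩ := hTess _ hyT hy0
      exact ⟨s * r, by rwa [LinearMap.comp_apply, mul_smul, key],
        by rwa [LinearMap.comp_apply, mul_smul, key]⟩
    · exact fun y hy ↦ ⟨y, hh' y hy⟩
  refine ⟨T, hST, ⟨fun X Y _ _ _ _ f hf g ↦ ?_⟩, hTess⟩
  obtain ⟨l, hl⟩ := Module.Injective.extension_property R E X Y f hf (T.subtype.comp g)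
  refine ⟨LinearMap.codRestrict T (h.comp (C.mkQ.comp l)) fun y ↦ hrange _, fun x ↦ Subtype.ext ?_⟩
  have : l (f x) = g x := DFunLike.congr_fun hl x
  simpa [this, -Submodule.mkQ_apply] using hh' _ (g x).2

variable (R) in
/-- The injective hull of the residue field of a local ring, through the properties we need. -/
lemma exists_injective_residueField [IsLocalRing R] :
    ∃ (E : Type) (_ : AddCommGroup E) (_ : Module R E), Module.Injective R E ∧
      Nonempty ((ResidueField R →ₗ[R] E) ≃ₗ[R] ResidueField R) := by
  obtain ⟨I⟩ := EnoughInjectives.presentation (ModuleCat.of R (ResidueField R))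
  have hI : Module.Injective R I.J := by
    have := I.injective
    exact Module.injective_module_of_injective_object R I.J
  have hf : Function.Injective I.f.hom := (ModuleCat.mono_iff_injective I.f).mp I.mono
  obtain ⟨T, hST, hT, hess⟩ := exists_injective_essential (LinearMap.range I.f.hom)
  let i : ResidueField R →ₗ[R] T := LinearMap.codRestrict T I.f.hom fun x ↦ hST ⟨x, rfl⟩
  have hi : Function.Injective i := fun a b hab ↦ hf (congrArg Subtype.val hab)
  have hm : ∀ r ∈ maximalIdeal R, ∀ z : ResidueField R, r • z = 0 := fun r hr z ↦ by
    rw [Algebra.smul_def, ResidueField.algebraMap_eq, (residue_eq_zero_iff r).mpr hr, zero_mul]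
  have hsurj (x : ResidueField R) : ∃ r : R, r • (1 : ResidueField R) = x := by
    obtain ⟨r, rfl⟩ := residue_surjective x
    exact ⟨r, by rw [Algebra.smul_def, mul_one, ResidueField.algebraMap_eq]⟩
  let Φ : ResidueField R →ₗ[R] (ResidueField R →ₗ[R] T) :=
    (LinearMap.llcomp R _ _ _ i).comp (LinearMap.mul R (ResidueField R))
  have hΦ (a b) : Φ a b = i (a * b) := rfl
  refine ⟨T, inferInstance, inferInstance, hT, ⟨(LinearEquiv.ofBijective Φ ⟨?_, fun f ↦ ?_⟩).symm⟩⟩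
  · intro a b hab
    have := DFunLike.congr_fun hab 1
    simpa [hΦ] using hi this
  · suffices h : ∃ a, i a = f 1 by
      obtain ⟨a, ha⟩ := h
      refine ⟨a, LinearMap.ext fun z ↦ ?_⟩
      obtain ⟨r, rfl⟩ := hsurj z
      rw [map_smul, map_smul, hΦ, mul_one, ha]
    by_cases h0 : (f 1 : T) = 0
    · exact ⟨0, by rw [h0, map_zero]⟩
    obtain ⟨r, ⟨a, ha⟩, hr0⟩ := hess _ (f 1).2 (by simpa using h0)
    have hru : IsUnit r := by
      by_contra hr
      exact hr0 (by
        rw [← Submodule.coe_smul, ← map_smul, hm r (by simpa using hr), map_zero]; rfl)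
    refine ⟨hru.unit⁻¹.val • a, ?_⟩
    rw [map_smul]
    have : i a = r • f 1 := Subtype.ext ha
    rw [this, smul_smul, IsUnit.val_inv_mul, one_smul]

end InjectiveHull

section Matlis

variable {R : Type} [CommRing R] {E : Type} [AddCommGroup E] [Module R E]

lemma bijective_of_injective_of_length_le {M N : Type*} [AddCommGroup M] [AddCommGroup N]
    [Module R M] [Module R N] (f : M →ₗ[R] N) (hf : Function.Injective f)
    (hM : IsFiniteLength R M) (h : Module.length R N ≤ Module.length R M) :
    Function.Bijective f := by
  refine ⟨hf, ?_⟩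
  have h1 := Module.length_eq_add_of_exact f f.range.mkQ hf f.range.mkQ_surjective
    (LinearMap.exact_map_mkQ_range f)
  have hN : Module.length R N ≠ ⊤ := ne_top_of_le_ne_top (Module.length_ne_top_iff.mpr hM) h
  have h2 : Module.length R (N ⧸ f.range) = 0 := by
    have hM' := Module.length_ne_top_iff.mpr hM
    have hq : Module.length R (N ⧸ f.range) ≠ ⊤ := fun hq ↦ hN (by rw [h1, hq, add_top])
    revert h1 h hM' hq
    generalize Module.length R (N ⧸ f.range) = c
    generalize Module.length R N = b
    generalize Module.length R M = a
    intro h h1 ha hc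
    lift a to ℕ using ha
    lift c to ℕ using hc
    subst h1
    norm_cast at h ⊢
    lia
  rw [Module.length_eq_zero_iff, Submodule.Quotient.subsingleton_iff] at h2
  exact LinearMap.range_eq_top.mp h2

/-- `Hom(-, E)` turns short exact sequences into short exact sequences when `E` is injective. -/
lemma length_hom_eq_add [Module.Injective R E] {A B C : Type} [AddCommGroup A] [AddCommGroup B]
    [AddCommGroup C] [Module R A] [Module R B] [Module R C] {f : A →ₗ[R] B} {g : B →ₗ[R] C}
    (hf : Function.Injective f) (hg : Function.Surjective g) (h : Function.Exact f g) :
    Module.length R (B →ₗ[R] E) = Module.length R (C →ₗ[R] E) + Module.length R (A →ₗ[R] E) :=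
  Module.length_eq_add_of_exact (LinearMap.lcomp R E g) (LinearMap.lcomp R E f)
    (LinearMap.lcomp_injective_of_surjective g hg)
    (fun k ↦ Module.Injective.extension_property R E A B f hf k)
    (LinearMap.exact_lcomp_of_exact_of_surjective E h hg)

variable [IsLocalRing R]

lemma isSimpleModule_residueField : IsSimpleModule R (ResidueField R) :=
  isSimpleModule_iff_quot_maximal.mpr ⟨maximalIdeal R, inferInstance, ⟨LinearEquiv.refl R _⟩⟩

lemma nonempty_equiv_residueField (M : Type*) [AddCommGroup M] [Module R M] [IsSimpleModule R M] :
    Nonempty (M ≃ₗ[R] ResidueField R) := by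
  obtain ⟨I, hI, ⟨e⟩⟩ := isSimpleModule_iff_quot_maximal.mp ‹IsSimpleModule R M›
  obtain rfl := eq_maximalIdeal hI
  exact ⟨e⟩

variable [Module.Injective R E]

lemma length_hom_injective (e : (ResidueField R →ₗ[R] E) ≃ₗ[R] ResidueField R)
    {N : Type} [AddCommGroup N] [Module R N] (hN : IsFiniteLength R N) :
    Module.length R (N →ₗ[R] E) = Module.length R N := by
  induction hN with
  | of_subsingleton =>
    rw [Module.length_eq_zero, Module.length_eq_zero]
  | @of_simple_quotient M _ _ N _ _ ih =>
    obtain ⟨e'⟩ := nonempty_equiv_residueField (R := R) (M ⧸ N)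
    have hk := (LinearEquiv.congrLeft E R e').length_eq.trans e.length_eq
    rw [length_hom_eq_add N.subtype_injective N.mkQ_surjective (LinearMap.exact_subtype_mkQ N), ih,
      Module.length_eq_add_of_exact _ _ N.subtype_injective N.mkQ_surjective
      (LinearMap.exact_subtype_mkQ N), hk, e'.length_eq, add_comm]

lemma injective_of_residueField {E : Type} [AddCommGroup E] [Module R E]
    (e : (ResidueField R →ₗ[R] E) ≃ₗ[R] ResidueField R) : Function.Injective (e.symm 1) :=
  have := isSimpleModule_residueField (R := R)
  (LinearMap.injective_or_eq_zero _).resolve_right (by simp)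

lemma exists_hom_ne_zero (e : (ResidueField R →ₗ[R] E) ≃ₗ[R] ResidueField R)
    {N : Type} [AddCommGroup N] [Module R N] {x : N} (hx : x ≠ 0) :
    ∃ f : N →ₗ[R] E, f x ≠ 0 := by
  have : Nontrivial (R ∙ x) := by
    rw [Submodule.nontrivial_iff_ne_bot, ne_eq, Submodule.span_singleton_eq_bot]
    exact hx
  obtain ⟨P, hP, -⟩ := (eq_top_or_exists_le_coatom (⊥ : Submodule R (R ∙ x))).resolve_left
    bot_ne_top
  have : IsSimpleModule R ((R ∙ x) ⧸ P) := isSimpleModule_iff_isCoatom.mpr hP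
  obtain ⟨e'⟩ := nonempty_equiv_residueField (R := R) ((R ∙ x) ⧸ P)
  have hi := injective_of_residueField e
  obtain ⟨f, hf⟩ := Module.Injective.extension_property R E (R ∙ x) N (R ∙ x).subtype
    (Submodule.subtype_injective _) ((e.symm 1).comp (e'.toLinearMap.comp P.mkQ))
  refine ⟨f, fun h0 ↦ ?_⟩
  have hxP : (⟨x, Submodule.mem_span_singleton_self x⟩ : (R ∙ x)) ∈ P := by
    rw [← Submodule.ker_mkQ P, LinearMap.mem_ker]
    apply e'.injective
    apply hi
    rw [map_zero, map_zero]
    exact (DFunLike.congr_fun hf ⟨x, Submodule.mem_span_singleton_self x⟩).symm.trans h0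
  refine hP.1 (eq_top_iff.mpr fun ⟨y, hy⟩ _ ↦ ?_)
  obtain ⟨r, rfl⟩ := Submodule.mem_span_singleton.mp hy
  exact P.smul_mem r hxP

/-- Matlis duality: finite length modules are reflexive with respect to `E`. -/
lemma nonempty_equiv_bidual (e : (ResidueField R →ₗ[R] E) ≃ₗ[R] ResidueField R)
    {N : Type} [AddCommGroup N] [Module R N] (hN : IsFiniteLength R N) :
    Nonempty (N ≃ₗ[R] ((N →ₗ[R] E) →ₗ[R] E)) := by
  have h := length_hom_injective e hN
  have hN' : IsFiniteLength R (N →ₗ[R] E) :=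
    Module.length_ne_top_iff.mp (h ▸ Module.length_ne_top_iff.mpr hN)
  refine ⟨LinearEquiv.ofBijective (LinearMap.id (M := N →ₗ[R] E)).flip
    (bijective_of_injective_of_length_le _ ((injective_iff_map_eq_zero _).mpr fun x hx ↦ ?_) hN
      ((length_hom_injective e hN').trans h).le)⟩
  by_contra hx0
  obtain ⟨f, hf⟩ := exists_hom_ne_zero e hx0
  exact hf (DFunLike.congr_fun hx f)

/-- A finite length module with one-dimensional socle embeds into `E`. -/
lemma exists_injective_hom (e : (ResidueField R →ₗ[R] E) ≃ₗ[R] ResidueField R)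
    {A : Type} [AddCommGroup A] [Module R A] (hA : IsFiniteLength R A)
    (hs : Module.length R (ResidueField R →ₗ[R] A) = 1) :
    ∃ ι : A →ₗ[R] E, Function.Injective ι := by
  have hsimple := Module.length_eq_one_iff.mp hs
  have := isSimpleModule_residueField (R := R)
  have := hsimple.nontrivial
  obtain ⟨s, hs0⟩ := exists_ne (0 : ResidueField R →ₗ[R] A)
  have hi := injective_of_residueField e
  obtain ⟨ι, hι⟩ := Module.Injective.extension_property R E _ A s
    (s.injective_or_eq_zero.resolve_right hs0) (e.symm 1)
  refine ⟨ι, LinearMap.ker_eq_bot.mp ?_⟩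
  by_contra hker
  have hart := (isFiniteLength_iff_isNoetherian_isArtinian.mp hA).2
  obtain ⟨T, hT, hTle⟩ := (eq_bot_or_exists_atom_le (LinearMap.ker ι)).resolve_left hker
  have : IsSimpleModule R T := isSimpleModule_iff_isAtom.mpr hT
  obtain ⟨e'⟩ := nonempty_equiv_residueField (R := R) T
  let u : ResidueField R →ₗ[R] A := T.subtype.comp e'.symm.toLinearMap
  have hu : Function.Injective u := T.subtype_injective.comp e'.symm.injective
  have hιu : ∀ z, ι (u z) = 0 := fun z ↦ hTle (e'.symm z).2
  obtain ⟨r, hr⟩ := IsSimpleModule.toSpanSingleton_surjective R hs0 u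
  rw [LinearMap.toSpanSingleton_apply] at hr
  have h1 : (e.symm 1) (r • 1) = 0 := by
    rw [← hι, LinearMap.comp_apply, map_smul, map_smul, ← map_smul, ← LinearMap.smul_apply, hr, hιu]
  have h2 : r • (1 : ResidueField R) = 0 := hi (h1.trans (map_zero _).symm)
  have h3 : u 1 = 0 := by rw [← hr, LinearMap.smul_apply, ← map_smul, h2, map_zero]
  exact one_ne_zero (hu (h3.trans (map_zero u).symm))

lemma mem_range_of_smul_eq_zero (e : (ResidueField R →ₗ[R] E) ≃ₗ[R] ResidueField R)
    {q : Ideal R} (hA : IsFiniteLength R (R ⧸ q))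
    {ι : (R ⧸ q) →ₗ[R] E} (hι : Function.Injective ι) {x : E} (hx : ∀ r ∈ q, r • x = 0) :
    x ∈ LinearMap.range ι := by
  let Φ : (R ⧸ q) →ₗ[R] ((R ⧸ q) →ₗ[R] E) :=
    (LinearMap.llcomp R _ _ _ ι).comp (LinearMap.mul R (R ⧸ q))
  have hΦ (a b) : Φ a b = ι (a * b) := rfl
  have h := bijective_of_injective_of_length_le Φ (fun a b hab ↦ by
    simpa [hΦ] using hι (DFunLike.congr_fun hab 1)) hA (length_hom_injective e hA).le
  obtain ⟨a, ha⟩ := h.2 (Submodule.liftQ q (LinearMap.toSpanSingleton R E x) fun r hr ↦ by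
    simpa using hx r hr)
  refine ⟨a, ?_⟩
  have := DFunLike.congr_fun ha (Submodule.Quotient.mk 1)
  rw [Submodule.liftQ_apply, LinearMap.toSpanSingleton_apply, one_smul, hΦ] at this
  rw [← this]
  exact congrArg ι (mul_one a).symm

/-- If `R ⧸ q` is of finite length and embeds into `E` then it represents `Hom(-, E)` on modules
killed by `q`. -/
lemma bijective_comp_of_smul_eq_zero (e : (ResidueField R →ₗ[R] E) ≃ₗ[R] ResidueField R)
    {q : Ideal R} (hA : IsFiniteLength R (R ⧸ q))
    {ι : (R ⧸ q) →ₗ[R] E} (hι : Function.Injective ι) {N : Type} [AddCommGroup N] [Module R N]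
    (hN : ∀ r ∈ q, ∀ y : N, r • y = 0) :
    Function.Bijective (ι.compRight R : (N →ₗ[R] R ⧸ q) →ₗ[R] (N →ₗ[R] E)) := by
  refine ⟨fun f g hfg ↦ LinearMap.ext fun x ↦ hι (DFunLike.congr_fun hfg x), fun f ↦ ?_⟩
  have hf (x) : f x ∈ LinearMap.range ι := mem_range_of_smul_eq_zero e hA hι fun r hr ↦ by
    rw [← map_smul, hN r hr, map_zero]
  refine ⟨(LinearEquiv.ofInjective ι hι).symm.toLinearMap.comp (f.codRestrict _ hf), ?_⟩
  ext x
  exact congrArg Subtype.val ((LinearEquiv.ofInjective ι hι).apply_symm_apply ⟨f x, hf x⟩)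

/-- Self-injectivity of `R ⧸ q`. -/
lemma exists_extension_quotient (e : (ResidueField R →ₗ[R] E) ≃ₗ[R] ResidueField R)
    {q : Ideal R} (hA : IsFiniteLength R (R ⧸ q))
    {ι : (R ⧸ q) →ₗ[R] E} (hι : Function.Injective ι) {N P : Type} [AddCommGroup N] [Module R N]
    [AddCommGroup P] [Module R P] (hP : ∀ r ∈ q, ∀ y : P, r • y = 0) {i : N →ₗ[R] P}
    (hi : Function.Injective i) (f : N →ₗ[R] R ⧸ q) : ∃ f' : P →ₗ[R] R ⧸ q, f' ∘ₗ i = f := by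
  obtain ⟨g, hg⟩ := Module.Injective.extension_property R E N P i hi (ι.comp f)
  obtain ⟨f', hf'⟩ := (bijective_comp_of_smul_eq_zero e hA hι hP).2 g
  refine ⟨f', LinearMap.ext fun x ↦ hι ?_⟩
  exact (DFunLike.congr_fun hf' (i x)).trans (DFunLike.congr_fun hg x)

end Matlis

/-- `Ext⁰` is `Hom`. -/
noncomputable def extZeroEquiv {R : Type} [CommRing R] (N M : ModuleCat.{0} R) :
    Abelian.Ext N M 0 ≃ₗ[R] (N →ₗ[R] M) :=
  (linearEquiv₀ (R := R)).trans (ModuleCat.homLinearEquiv (S := R))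

section Gorenstein

variable {R : Type} [CommRing R] [IsLocalRing R]

lemma smul_residueField {r : R} (hr : r ∈ maximalIdeal R) (z : ResidueField R) : r • z = 0 := by
  rw [Algebra.smul_def, ResidueField.algebraMap_eq, (residue_eq_zero_iff r).mpr hr, zero_mul]

lemma exists_pow_smul_eq_zero {N : Type*} [AddCommGroup N] [Module R N] (hN : IsFiniteLength R N)
    {r : R} (hr : r ∈ maximalIdeal R) : ∃ n : ℕ, ∀ y : N, r ^ n • y = 0 := by
  induction hN with
  | of_subsingleton => exact ⟨0, fun y ↦ Subsingleton.elim _ _⟩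
  | @of_simple_quotient M _ _ N _ _ ih =>
    obtain ⟨n, hn⟩ := ih
    obtain ⟨e⟩ := nonempty_equiv_residueField (R := R) (M ⧸ N)
    refine ⟨n + 1, fun y ↦ ?_⟩
    have hy : r • y ∈ N := by
      rw [← Submodule.Quotient.mk_eq_zero, Submodule.Quotient.mk_smul]
      apply e.injective
      rw [map_smul, smul_residueField hr, map_zero]
    rw [pow_succ, mul_smul]
    exact congrArg Subtype.val (hn ⟨r • y, hy⟩)

lemma isFiniteLength_quotient_of_ringKrullDim_le {R : Type} [CommRing R]
    [IsNoetherianRing R] {I : Ideal R}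
    (h : ringKrullDim (R ⧸ I) ≤ 0) : IsFiniteLength R (R ⧸ I) := by
  have : IsArtinianRing (R ⧸ I) := isArtinianRing_iff_krullDimLE_zero.mpr
    ((Order.krullDimLE_iff 0 _).mpr h)
  exact isFiniteLength_iff_isNoetherian_isArtinian.mpr ⟨inferInstance,
    isArtinian_of_surjective_algebraMap (R := R ⧸ I) (S := R) Ideal.Quotient.mk_surjective⟩

variable (R) in
/-- A homological form of the Gorenstein condition in dimension `d`. -/
structure IsGorensteinOfDim (d : ℕ) : Prop where
  exists_regular : ∃ rs : List R, rs.length = d ∧ (∀ r ∈ rs, r ∈ maximalIdeal R) ∧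
    IsWeaklyRegular R rs
  ringKrullDim_eq : ringKrullDim R = d
  length_ext : Module.length R
    (Abelian.Ext (ModuleCat.of R (ResidueField R)) (ModuleCat.of R R) d) = 1

variable {d : ℕ}

lemma IsGorensteinOfDim.subsingleton_ext_of_lt (hG : IsGorensteinOfDim R d)
    {N : ModuleCat.{0} R} (hN : IsFiniteLength R N)
    {j : ℕ} (hj : j < d) : Subsingleton (Abelian.Ext N (ModuleCat.of R R) j) := by
  obtain ⟨rs, rfl, hm, hrs⟩ := hG.exists_regular
  exact subsingleton_ext_of_isWeaklyRegular hrs N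
    (fun r hr ↦ exists_pow_smul_eq_zero hN (hm r hr)) j hj

variable [IsNoetherianRing R]

lemma IsGorensteinOfDim.exists_quotient (hG : IsGorensteinOfDim R d)
    {N : ModuleCat.{0} R} (hN : IsFiniteLength R N)
    [Nontrivial N] : ∃ (q : Ideal R)
      (α : Abelian.Ext (ModuleCat.of R (R ⧸ q)) (ModuleCat.of R R) d),
      (∀ r ∈ q, ∀ y : N, r • y = 0) ∧ q ≤ maximalIdeal R ∧ IsFiniteLength R (R ⧸ q) ∧
      (∀ N' : ModuleCat.{0} R, (∀ r ∈ q, ∀ y : N', r • y = 0) →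
        Function.Bijective (α.postcompOfLinear R N' (zero_add d))) ∧
      HasProjectiveDimensionLT (ModuleCat.of R (R ⧸ q)) (d + 1) := by
  have := (isFiniteLength_iff_isNoetherian_isArtinian.mp hN).1
  obtain ⟨rs, rfl, hann, hrs⟩ := exists_isWeaklyRegular_of_subsingleton_ext N d (ModuleCat.of R R)
    fun j hj ↦ hG.subsingleton_ext_of_lt hN hj
  obtain ⟨α, hα⟩ := exists_bijective_comp_of_isWeaklyRegular hrs
  have hq : (Ideal.ofList rs • ⊤ : Ideal R) = Ideal.ofList rs := by simp
  have hq' : Ideal.ofList rs ≤ Module.annihilator R N := Ideal.span_le.mpr hann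
  have hm : Module.annihilator R N ≤ maximalIdeal R := le_maximalIdeal fun h ↦
    not_subsingleton N (Module.annihilator_eq_top_iff.mp h)
  have hreg : IsRegular R rs :=
    (IsLocalRing.isRegular_iff_isWeaklyRegular_of_subset_maximalIdeal
      fun r hr ↦ hm (hann r hr)).mpr hrs
  have hdim := ringKrullDim_add_length_eq_ringKrullDim_of_isRegular rs hreg
  rw [hG.ringKrullDim_eq] at hdim
  refine ⟨Ideal.ofList rs • ⊤, α, fun r hr y ↦ Module.mem_annihilator.mp (hq' (hq.le hr)) y,
    hq.le.trans (hq'.trans hm), ?_, fun N' hN' ↦ hα N' fun r hr ↦ hN' r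
      (hq.ge (Ideal.subset_span hr)), ?_⟩
  · rw [hq]
    refine isFiniteLength_quotient_of_ringKrullDim_le (le_of_eq ?_)
    have : (rs.length : WithBot ℕ∞) = 0 + rs.length := (zero_add _).symm
    exact ENat.WithBot.add_natCast_cancel.mp (hdim.trans this)
  · have : Projective (ModuleCat.of R R) := (IsProjective.iff_projective R).mp inferInstance
    have hpd := ModuleCat.projectiveDimension_quotient_eq_add_length_of_isWeaklyRegular
      (ModuleCat.of R R) rs hrs fun r hr ↦ hm (hann r hr)
    have h1 : projectiveDimension (ModuleCat.of R R) ≤ (0 : ℕ) :=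
      (projectiveDimension_le_iff _ _).mpr
        (inferInstance : HasProjectiveDimensionLT (ModuleCat.of R R) 1)
    have h2 : projectiveDimension (ModuleCat.of R (R ⧸ (Ideal.ofList rs • ⊤ : Ideal R))) ≤
        rs.length := hpd.le.trans ((add_le_add_left h1 _).trans (by simp))
    exact (projectiveDimension_le_iff _ _).mp h2

variable {E : Type} [AddCommGroup E] [Module R E] [Module.Injective R E]

lemma IsGorensteinOfDim.exists_embedding {R : Type} [CommRing R] [IsLocalRing R] {d : ℕ}
    (hG : IsGorensteinOfDim R d) {E : Type} [AddCommGroup E] [Module R E]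
    [Module.Injective R E] (e : (ResidueField R →ₗ[R] E) ≃ₗ[R] ResidueField R)
    {q : Ideal R} (hq : q ≤ maximalIdeal R)
    (hA : IsFiniteLength R (R ⧸ q)) {α : Abelian.Ext (ModuleCat.of R (R ⧸ q)) (ModuleCat.of R R) d}
    (hα : ∀ N' : ModuleCat.{0} R, (∀ r ∈ q, ∀ y : N', r • y = 0) →
        Function.Bijective (α.postcompOfLinear R N' (zero_add d))) :
    ∃ ι : (R ⧸ q) →ₗ[R] E, Function.Injective ι := by
  refine exists_injective_hom e hA ?_
  rw [← hG.length_ext, ← (LinearEquiv.ofBijective _ (hα (ModuleCat.of R (ResidueField R))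
    fun r hr y ↦ smul_residueField (hq hr) y)).length_eq]
  exact (extZeroEquiv (ModuleCat.of R (ResidueField R)) (ModuleCat.of R (R ⧸ q))).length_eq.symm

/-- Local duality in finite length: `Ext^d(-, R)` is Matlis duality. -/
lemma IsGorensteinOfDim.nonempty_ext_equiv (hG : IsGorensteinOfDim R d)
    (e : (ResidueField R →ₗ[R] E) ≃ₗ[R] ResidueField R)
    {N : ModuleCat.{0} R} (hN : IsFiniteLength R N) :
    Nonempty (Abelian.Ext N (ModuleCat.of R R) d ≃ₗ[R] (N →ₗ[R] E)) := by
  rcases subsingleton_or_nontrivial N with h | h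
  · have : Subsingleton (Abelian.Ext N (ModuleCat.of R R) d) :=
      have := (ModuleCat.isZero_of_subsingleton N).hasProjectiveDimensionLT_zero
      HasProjectiveDimensionLT.subsingleton N 0 d (Nat.zero_le _) _
    exact ⟨0⟩
  · obtain ⟨q, α, hqN, hqm, hA, hα, -⟩ := hG.exists_quotient hN
    obtain ⟨ι, hι⟩ := hG.exists_embedding e hqm hA hα
    exact ⟨(LinearEquiv.ofBijective _ (hα N hqN)).symm.trans
      ((extZeroEquiv N (ModuleCat.of R (R ⧸ q))).trans
        (LinearEquiv.ofBijective _ (bijective_comp_of_smul_eq_zero e hA hι hqN)))⟩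

lemma IsGorensteinOfDim.subsingleton_ext_residueField_succ (hG : IsGorensteinOfDim R d)
    (e : (ResidueField R →ₗ[R] E) ≃ₗ[R] ResidueField R) :
    Subsingleton (Abelian.Ext (ModuleCat.of R (ResidueField R)) (ModuleCat.of R R) (d + 1)) := by
  have := isSimpleModule_residueField (R := R)
  have hk : IsFiniteLength R (ResidueField R) :=
    Module.length_ne_top_iff.mp (by rw [Module.length_eq_one]; exact ENat.one_ne_top)
  obtain ⟨q, α, -, hqm, hA, hα, hpd⟩ := hG.exists_quotient (N := ModuleCat.of R (ResidueField R)) hk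
  obtain ⟨ι, hι⟩ := hG.exists_embedding e hqm hA hα
  let π : (R ⧸ q) →ₗ[R] ResidueField R := q.liftQ (Algebra.linearMap R (ResidueField R))
    fun r hr ↦ (residue_eq_zero_iff r).mpr (hqm hr)
  have hπ : Function.Surjective π := fun x ↦ by
    obtain ⟨r, rfl⟩ := residue_surjective x
    exact ⟨Submodule.Quotient.mk r, rfl⟩
  have hS := LinearMap.shortExact_shortComplexKer hπ
  have hqA : ∀ r ∈ q, ∀ y : R ⧸ q, r • y = 0 := fun r hr y ↦ by
    rw [Algebra.smul_def, Ideal.Quotient.algebraMap_eq, Ideal.Quotient.eq_zero_iff_mem.mpr hr,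
      zero_mul]
  have hzero : Subsingleton (Abelian.Ext (ModuleCat.of R (R ⧸ q)) (ModuleCat.of R R) (d + 1)) :=
    HasProjectiveDimensionLT.subsingleton _ (d + 1) _ le_rfl _
  refine subsingleton_of_forall_eq 0 fun x ↦ ?_
  obtain ⟨y, rfl⟩ := (exact_precomp_right hS (ModuleCat.of R R) d x).mp
    (Subsingleton.elim (α := Abelian.Ext (ModuleCat.of R (R ⧸ q)) _ _) _ _)
  obtain ⟨z, rfl⟩ := (hα _ fun r hr y ↦ Subtype.ext (hqA r hr y)).2 y
  obtain ⟨f, rfl⟩ := (extZeroEquiv _ _).symm.surjective z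
  obtain ⟨f', hf'⟩ := exists_extension_quotient e hA hι hqA (LinearMap.ker π).subtype_injective f
  refine (exact_precomp_left hS (ModuleCat.of R R) d _).mpr
    ⟨α.postcompOfLinear R _ (zero_add d) (mk₀ (ModuleCat.ofHom f')), ?_⟩
  have h : (extZeroEquiv _ _).symm f = mk₀ (ModuleCat.ofHom f) := rfl
  have hf : ModuleCat.ofHom f = (LinearMap.shortComplexKer π).f ≫ ModuleCat.ofHom f' := by
    rw [← hf']
    rfl
  rw [h, hf]
  rw [← mk₀_comp_mk₀]
  exact (comp_assoc (mk₀ (LinearMap.shortComplexKer π).f) (mk₀ (ModuleCat.ofHom f')) α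
    (zero_add 0) (zero_add d) (by omega)).symm

lemma IsGorensteinOfDim.subsingleton_ext_succ (hG : IsGorensteinOfDim R d)
    (e : (ResidueField R →ₗ[R] E) ≃ₗ[R] ResidueField R) {N : Type} [AddCommGroup N] [Module R N]
    (hN : IsFiniteLength R N) :
    Subsingleton (Abelian.Ext (ModuleCat.of R N) (ModuleCat.of R R) (d + 1)) := by
  induction hN with
  | @of_subsingleton N =>
    have := (ModuleCat.isZero_of_subsingleton (ModuleCat.of R N)).hasProjectiveDimensionLT_zero
    exact HasProjectiveDimensionLT.subsingleton _ 0 _ (Nat.zero_le _) _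
  | @of_simple_quotient M _ _ N _ _ ih =>
    obtain ⟨f⟩ := nonempty_equiv_residueField (R := R) (M ⧸ N)
    obtain ⟨f'⟩ := nonempty_extEquiv f.toModuleIso (Iso.refl (ModuleCat.of R R)) (d + 1)
    have h1 := hG.subsingleton_ext_residueField_succ e
    have h2 := f'.subsingleton
    have hS : (ShortComplex.mk (ModuleCat.ofHom N.subtype) (ModuleCat.ofHom N.mkQ)
        (by ext; simp)).ShortExact :=
      { exact := (ShortComplex.ShortExact.moduleCat_exact_iff_function_exact _).mpr
          fun _ ↦ by simp
        mono_f := (ModuleCat.mono_iff_injective _).mpr N.injective_subtype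
        epi_g := (ModuleCat.epi_iff_surjective _).mpr N.mkQ_surjective }
    exact @subsingleton_of_exact _ _ _ _ _ _ _ _ _ _ _ _ _
      (exact_precomp_mid hS (ModuleCat.of R R) (d + 1)) h2 ih

end Gorenstein

section Adjunction

variable {R : Type} [CommRing R]

lemma nonempty_equiv_of_exact {A B C A' B' C' : Type*} [AddCommGroup A] [AddCommGroup B]
    [AddCommGroup C] [AddCommGroup A'] [AddCommGroup B'] [AddCommGroup C'] [Module R A]
    [Module R B] [Module R C] [Module R A'] [Module R B'] [Module R C']
    {f : A →ₗ[R] B} {g : B →ₗ[R] C} {f' : A' →ₗ[R] B'} {g' : B' →ₗ[R] C'}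
    (h : Function.Exact f g) (hg : Function.Surjective g)
    (h' : Function.Exact f' g') (hg' : Function.Surjective g')
    (eA : A ≃ₗ[R] A') (eB : B ≃ₗ[R] B') (hcomm : ∀ a, eB (f a) = f' (eA a)) :
    Nonempty (C ≃ₗ[R] C') := by
  have hr : (LinearMap.ker g).map (eB : B →ₗ[R] B') = LinearMap.ker g' := by
    rw [LinearMap.exact_iff.mp h, LinearMap.exact_iff.mp h', ← LinearMap.range_comp]
    have : (eB : B →ₗ[R] B') ∘ₗ f = f' ∘ₗ (eA : A →ₗ[R] A') := LinearMap.ext hcomm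
    rw [this, LinearMap.range_comp, LinearEquiv.range, Submodule.map_top]
  exact ⟨(g.quotKerEquivOfSurjective hg).symm.trans
    ((Submodule.Quotient.equiv _ _ eB hr).trans (g'.quotKerEquivOfSurjective hg'))⟩

variable (E : Type) [AddCommGroup E] [Module R E] [Module.Injective R E]

lemma lcomp_surjective {A B : Type} [AddCommGroup A] [AddCommGroup B] [Module R A] [Module R B]
    {f : A →ₗ[R] B} (hf : Function.Injective f) :
    Function.Surjective (LinearMap.lcomp R E f) := fun g ↦ by
  obtain ⟨h, hh⟩ := Module.Injective.out f hf g
  exact ⟨h, LinearMap.ext hh⟩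

lemma injective_hom (P : Type) [AddCommGroup P] [Module R P] [Module.Projective R P] :
    Module.Injective R (P →ₗ[R] E) where
  out A B _ _ _ _ f hf g := by
    obtain ⟨h, hh⟩ := Module.projective_lifting_property (LinearMap.lcomp R E f) g.flip
      (lcomp_surjective E hf)
    refine ⟨h.flip, fun a ↦ LinearMap.ext fun p ↦ ?_⟩
    exact DFunLike.congr_fun (DFunLike.congr_fun hh p) a

/-- The `E`-dual of a short exact sequence. -/
@[simps]
def dualShortComplex (S : ShortComplex (ModuleCat.{0} R)) : ShortComplex (ModuleCat.{0} R) where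
  X₁ := ModuleCat.of R (S.X₃ →ₗ[R] E)
  X₂ := ModuleCat.of R (S.X₂ →ₗ[R] E)
  X₃ := ModuleCat.of R (S.X₁ →ₗ[R] E)
  f := ModuleCat.ofHom (LinearMap.lcomp R E S.g.hom)
  g := ModuleCat.ofHom (LinearMap.lcomp R E S.f.hom)
  zero := by
    ext f x
    simp

lemma exact_lcomp (E : Type) [AddCommGroup E] [Module R E]
    {A B C : Type} [AddCommGroup A] [AddCommGroup B] [AddCommGroup C]
    [Module R A] [Module R B] [Module R C] {f : A →ₗ[R] B} {g : B →ₗ[R] C}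
    (h : Function.Exact f g) (hg : Function.Surjective g) :
    Function.Exact (LinearMap.lcomp R E g) (LinearMap.lcomp R E f) := fun u ↦ by
  constructor
  · intro hu
    have hk : LinearMap.ker g ≤ LinearMap.ker u := by
      rw [LinearMap.exact_iff.mp h]
      rintro _ ⟨y, rfl⟩
      exact DFunLike.congr_fun hu y
    refine ⟨(LinearMap.ker g).liftQ u hk ∘ₗ (g.quotKerEquivOfSurjective hg).symm,
      LinearMap.ext fun x ↦ ?_⟩
    have : (g.quotKerEquivOfSurjective hg).symm (g x) = (LinearMap.ker g).mkQ x := by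
      rw [LinearEquiv.symm_apply_eq]
      rfl
    exact (congrArg _ this).trans rfl
  · rintro ⟨g, rfl⟩
    ext x
    simp [h.apply_apply_eq_zero x]

lemma shortExact_dualShortComplex {S : ShortComplex (ModuleCat.{0} R)} (hS : S.ShortExact) :
    (dualShortComplex E S).ShortExact where
  mono_f := (ModuleCat.mono_iff_injective _).mpr fun (f : S.X₃ →ₗ[R] E) (f' : S.X₃ →ₗ[R] E) h ↦
    LinearMap.ext fun x ↦ by
      obtain ⟨y, rfl⟩ := hS.moduleCat_surjective_g x
      exact DFunLike.congr_fun (F := S.X₂ →ₗ[R] E) h y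
  epi_g := (ModuleCat.epi_iff_surjective _).mpr (lcomp_surjective E hS.moduleCat_injective_f)
  exact := (ShortComplex.ShortExact.moduleCat_exact_iff_function_exact _).mpr
    (exact_lcomp E ((ShortComplex.ShortExact.moduleCat_exact_iff_function_exact _).mp hS.exact)
      hS.moduleCat_surjective_g)

/-- `Hom(X, Hom(W, E)) ≃ Hom(W, Hom(X, E))`, on `Ext⁰`. -/
noncomputable def extZeroFlip (X W : ModuleCat.{0} R) :
    Abelian.Ext X (ModuleCat.of R (W →ₗ[R] E)) 0 ≃ₗ[R]
      Abelian.Ext W (ModuleCat.of R (X →ₗ[R] E)) 0 :=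
  (extZeroEquiv X (ModuleCat.of R (W →ₗ[R] E))).trans
    (LinearMap.lflip.trans (extZeroEquiv W (ModuleCat.of R (X →ₗ[R] E))).symm)

lemma extZeroFlip_symm_apply (E : Type) [AddCommGroup E] [Module R E]
    (X W : ModuleCat.{0} R) (f : X →ₗ[R] W →ₗ[R] E) :
    extZeroFlip E X W ((extZeroEquiv X (ModuleCat.of R (W →ₗ[R] E))).symm f) =
      (extZeroEquiv W (ModuleCat.of R (X →ₗ[R] E))).symm f.flip := by
  simp only [extZeroFlip, LinearEquiv.trans_apply, LinearEquiv.apply_symm_apply]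
  rfl

/-- `Ext(X, Hom(W, E)) ≃ Ext(W, Hom(X, E))` for `E` injective. -/
lemma nonempty_ext_hom_equiv (X : ModuleCat.{0} R) (i : ℕ) : ∀ W : ModuleCat.{0} R,
    Nonempty (Abelian.Ext X (ModuleCat.of R (W →ₗ[R] E)) i ≃ₗ[R]
      Abelian.Ext W (ModuleCat.of R (X →ₗ[R] E)) i) := by
  have setup (W : ModuleCat.{0} R) : ∃ S : ShortComplex (ModuleCat.{0} R), S.X₃ = W ∧
      S.ShortExact ∧ (∀ Y n, Subsingleton (Abelian.Ext S.X₂ Y (n + 1))) ∧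
      ∀ Y n, Subsingleton (Abelian.Ext Y (dualShortComplex E S).X₂ (n + 1)) := by
    have : Module.Injective R (W.projectiveShortComplex.X₂ →ₗ[R] E) := injective_hom E _
    have : Injective (ModuleCat.of R (W.projectiveShortComplex.X₂ →ₗ[R] E)) :=
      Module.injective_object_of_injective_module R _
    have : Projective W.projectiveShortComplex.X₂ :=
      (IsProjective.iff_projective W.projectiveShortComplex.X₂).mp inferInstance
    exact ⟨_, rfl, ModuleCat.shortExact_projectiveShortComplex W,
      fun Y n ↦ subsingleton_of_forall_eq 0 Abelian.Ext.eq_zero_of_projective,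
      fun Y n ↦ Abelian.Ext.subsingleton_of_injective Y
        (ModuleCat.of R (W.projectiveShortComplex.X₂ →ₗ[R] E)) n⟩
  rcases i with _ | i
  · exact fun W ↦ ⟨extZeroFlip E X W⟩
  induction i with
  | zero =>
    intro W
    obtain ⟨S, rfl, hS, h1, h2⟩ := setup W
    have hT := shortExact_dualShortComplex E hS
    refine nonempty_equiv_of_exact (exact_postcomp_right hT X 0)
      (fun x ↦ (exact_postcomp_left hT X 0 x).mp ((h2 X 0).elim _ _))
      (exact_precomp_left hS (ModuleCat.of R (X →ₗ[R] E)) 0)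
      (fun x ↦ (exact_precomp_right hS (ModuleCat.of R (X →ₗ[R] E)) 0 x).mp ((h1 _ 0).elim _ _))
      (extZeroFlip E X S.X₂) (extZeroFlip E X S.X₁) fun a ↦ ?_
    obtain ⟨f, rfl⟩ := (extZeroEquiv _ _).symm.surjective a
    have hL : (mk₀ (dualShortComplex E S).g).postcompOfLinear R X (add_zero 0)
        ((extZeroEquiv _ _).symm f) =
        (extZeroEquiv X (ModuleCat.of R (S.X₁ →ₗ[R] E))).symm
          ((LinearMap.lcomp R E S.f.hom) ∘ₗ f) :=
      mk₀_comp_mk₀ (ModuleCat.ofHom f) (dualShortComplex E S).g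
    have hR : (mk₀ S.f).precompOfLinear R (ModuleCat.of R (X →ₗ[R] E)) (zero_add 0)
        ((extZeroEquiv _ _).symm (LinearMap.flip f)) =
        (extZeroEquiv S.X₁ (ModuleCat.of R (X →ₗ[R] E))).symm
          ((LinearMap.flip f) ∘ₗ S.f.hom) :=
      mk₀_comp_mk₀ S.f (ModuleCat.ofHom _)
    exact (congrArg (extZeroFlip E X S.X₁) hL).trans ((extZeroFlip_symm_apply E X S.X₁ _).trans
      (hR.symm.trans (congrArg _ (extZeroFlip_symm_apply E X S.X₂ f).symm)))
  | succ i ih =>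
    intro W
    obtain ⟨S, rfl, hS, h1, h2⟩ := setup W
    have hT := shortExact_dualShortComplex E hS
    obtain ⟨φ⟩ := ih S.X₁
    refine ⟨(LinearEquiv.ofBijective _ ⟨injective_of_exact (exact_postcomp_right hT X (i + 1))
      fun a ↦ ?_, fun x ↦ (exact_postcomp_left hT X (i + 1) x).mp ((h2 X _).elim _ _)⟩).symm.trans
      (φ.trans (LinearEquiv.ofBijective _ ⟨injective_of_exact
        (exact_precomp_left hS (ModuleCat.of R (X →ₗ[R] E)) (i + 1)) fun a ↦ ?_, fun x ↦
        (exact_precomp_right hS (ModuleCat.of R (X →ₗ[R] E)) (i + 1) x).mp ((h1 _ _).elim _ _)⟩))⟩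
    · rw [(h2 X i).elim a 0, map_zero]
    · rw [(h1 _ i).elim a 0, map_zero]

end Adjunction

section

variable {R : Type} [CommRing R] [IsLocalRing R] [IsNoetherianRing R]

/-- The case of finite length, from local duality. -/
lemma IsGorensteinOfDim.nonempty_ext_equiv_ext {d : ℕ} (hG : IsGorensteinOfDim R d)
    {M : ModuleCat.{0} R} (hM : IsFiniteLength R M) (i : ℕ) :
    Nonempty (Abelian.Ext (ModuleCat.of R (ResidueField R)) M i ≃ₗ[R]
      Abelian.Ext (ModuleCat.of R (Abelian.Ext M (ModuleCat.of R R) d))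
        (ModuleCat.of R (ResidueField R)) i) := by
  obtain ⟨E, _, _, _, ⟨e⟩⟩ := exists_injective_residueField R
  obtain ⟨f⟩ := hG.nonempty_ext_equiv e hM
  obtain ⟨b⟩ := nonempty_equiv_bidual e hM
  obtain ⟨e₁⟩ := nonempty_extEquiv (Iso.refl (ModuleCat.of R (ResidueField R)))
    (LinearEquiv.toModuleIso b) i
  obtain ⟨e₂⟩ := nonempty_ext_hom_equiv E (ModuleCat.of R (ResidueField R)) i
    (ModuleCat.of R (M →ₗ[R] E))
  obtain ⟨e₃⟩ := nonempty_extEquiv (LinearEquiv.toModuleIso f.symm) (LinearEquiv.toModuleIso e) i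
  exact ⟨e₁.trans (e₂.trans e₃)⟩

end

section CohenMacaulay

variable {R : Type} [CommRing R] [IsLocalRing R]

lemma isFiniteLength_of_smul_eq_zero {X : Type} [AddCommGroup X] [Module R X] [Module.Finite R X]
    (h : ∀ r ∈ maximalIdeal R, ∀ x : X, r • x = 0) : IsFiniteLength R X := by
  obtain ⟨n, s, hs⟩ := Module.Finite.exists_fin (R := R) (M := X)
  let g (i : Fin n) : ResidueField R →ₗ[R] X :=
    (maximalIdeal R).liftQ (LinearMap.toSpanSingleton R X (s i)) fun r hr ↦ h r hr _
  let f : (Fin n → ResidueField R) →ₗ[R] X := LinearMap.lsum R (fun _ ↦ ResidueField R) R g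
  have hf : Function.Surjective f := by
    rw [← LinearMap.range_eq_top, eq_top_iff, ← hs, Submodule.span_le]
    rintro _ ⟨i, rfl⟩
    refine ⟨Pi.single i 1, ?_⟩
    have : g i 1 = s i := one_smul R (s i)
    simp only [f]
    rw [LinearMap.lsum_apply, LinearMap.sum_apply, Finset.sum_eq_single i]
    · simpa using this
    · intro j _ hj
      simp [Pi.single_eq_of_ne hj]
    · simp
  refine Module.length_ne_top_iff.mp (ne_top_of_le_ne_top ?_ (Module.length_le_of_surjective f hf))
  have := isSimpleModule_residueField (R := R)
  simp [Module.length_eq_one]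

lemma nonempty_quotSMulTop_equiv {R : Type} [CommRing R]
    {A B : Type} [AddCommGroup A] [Module R A] [AddCommGroup B]
    [Module R B] {x : R} {g : A →ₗ[R] B} (h : Function.Exact (LinearMap.lsmul R A x) g)
    (hg : Function.Surjective g) : Nonempty (QuotSMulTop x A ≃ₗ[R] B) := by
  refine ⟨(Submodule.quotEquivOfEq _ _ ?_).trans (g.quotKerEquivOfSurjective hg)⟩
  rw [LinearMap.exact_iff.mp h]
  ext y
  simp [Submodule.mem_smul_pointwise_iff_exists]

variable [IsNoetherianRing R] {d : ℕ}

lemma IsGorensteinOfDim.subsingleton_ext (hG : IsGorensteinOfDim R d)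
    {rs : List R} (hm : ∀ r ∈ rs, r ∈ maximalIdeal R) :
    ∀ {M : ModuleCat.{0} R} [Module.Finite R M], IsWeaklyRegular M rs →
      IsFiniteLength R (M ⧸ (Ideal.ofList rs • ⊤ : Submodule R M)) →
      ∀ {j : ℕ}, j + rs.length < d ∨ j + rs.length = d + 1 →
      Subsingleton (Abelian.Ext M (ModuleCat.of R R) j) := by
  induction rs with
  | nil =>
    intro M _ _ hM j hj
    have hM : IsFiniteLength R M := by
      refine (LinearEquiv.isFiniteLength ?_ hM)
      exact Submodule.quotEquivOfEqBot _ (by simp)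
    rcases hj with hj | rfl
    · exact hG.subsingleton_ext_of_lt hM hj
    · obtain ⟨E, _, _, _, ⟨e⟩⟩ := exists_injective_residueField R
      exact hG.subsingleton_ext_succ e hM
  | cons x rs ih =>
    intro M _ hreg hM j hj
    rw [isWeaklyRegular_cons_iff] at hreg
    have h1 := ih (fun r hr ↦ hm r (List.mem_cons_of_mem _ hr))
      (M := ModuleCat.of R (QuotSMulTop x M)) hreg.2
      ((Submodule.quotOfListConsSMulTopEquivQuotSMulTopInner M x rs).isFiniteLength hM)
      (j := j + 1) (by simp only [List.length_cons] at hj; omega)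
    have h2 := ext_smul_surjective_of_subsingleton hreg.1 j h1
    have : Module.Finite R (Abelian.Ext M (ModuleCat.of R R) j) := ModuleCat.finite_ext ..
    have h3 : (⊤ : Submodule R (Abelian.Ext M (ModuleCat.of R R) j)) = ⊥ := by
      refine Submodule.eq_bot_of_le_smul_of_le_jacobson_bot (Ideal.span {x}) _
        Module.Finite.fg_top (fun y _ ↦ ?_) ?_
      · obtain ⟨z, rfl⟩ := h2 y
        exact Submodule.smul_mem_smul (Ideal.mem_span_singleton_self x) trivial
      · rw [jacobson_eq_maximalIdeal ⊥ bot_ne_top, Ideal.span_singleton_le_iff_mem]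
        exact hm x List.mem_cons_self
    exact (Submodule.subsingleton_iff R).mp (subsingleton_of_bot_eq_top h3.symm)

/-- Length form of the equality of Bass and Betti numbers for Cohen--Macaulay modules. -/
lemma IsGorensteinOfDim.length_ext_eq (hG : IsGorensteinOfDim R d)
    {rs : List R} (hm : ∀ r ∈ rs, r ∈ maximalIdeal R) :
    ∀ {M : ModuleCat.{0} R} [Module.Finite R M], IsWeaklyRegular M rs →
      IsFiniteLength R (M ⧸ (Ideal.ofList rs • ⊤ : Submodule R M)) →
      ∀ {c : ℕ}, c + rs.length = d → ∀ i : ℕ,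
      Module.length R (Abelian.Ext (ModuleCat.of R (ResidueField R)) M (i + rs.length)) =
        Module.length R (Abelian.Ext (ModuleCat.of R (Abelian.Ext M (ModuleCat.of R R) c))
          (ModuleCat.of R (ResidueField R)) i) := by
  induction rs with
  | nil =>
    intro M _ _ hM c hc i
    obtain rfl : c = d := hc
    exact (hG.nonempty_ext_equiv_ext
      (LinearEquiv.isFiniteLength (Submodule.quotEquivOfEqBot _ (by simp)) hM) i).some.length_eq
  | cons x rs ih =>
    intro M _ hreg hM c hc i
    have hreg' := (isWeaklyRegular_cons_iff _ _ _).mp hreg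
    have hm' : ∀ r ∈ rs, r ∈ maximalIdeal R := fun r hr ↦ hm r (List.mem_cons_of_mem _ hr)
    have hM' := (Submodule.quotOfListConsSMulTopEquivQuotSMulTopInner M x rs).isFiniteLength hM
    have hk (y : ResidueField R) : x • y = 0 := smul_residueField (hm x List.mem_cons_self) y
    rw [List.length_cons] at hc
    have h0 := hG.subsingleton_ext hm' (M := ModuleCat.of R (QuotSMulTop x M)) hreg'.2 hM'
      (j := c) (by omega)
    have h1 := hG.subsingleton_ext hm hreg hM (j := c + 1) (by rw [List.length_cons]; omega)
    have hω : IsSMulRegular (Abelian.Ext M (ModuleCat.of R R) c) x :=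
      injective_of_exact (exact_ext_smul_left_mid hreg'.1 c) fun a ↦ by
        have : a = 0 := h0.elim a 0
        exact (congrArg _ this).trans (map_zero _)
    have hq : Nonempty (QuotSMulTop x (Abelian.Ext M (ModuleCat.of R R) c) ≃ₗ[R]
        Abelian.Ext (ModuleCat.of R (QuotSMulTop x M)) (ModuleCat.of R R) (c + 1)) :=
      nonempty_quotSMulTop_equiv (exact_ext_smul_left hreg'.1 c) fun y ↦
        (exact_precomp_right hreg'.1.smulShortComplex_shortExact (ModuleCat.of R R) c y).mp
          (h1.elim _ _)
    have h2 (n : ℕ) :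
        Module.length R (Abelian.Ext (ModuleCat.of R (ResidueField R)) M (n + rs.length)) +
          Module.length R (Abelian.Ext (ModuleCat.of R (ResidueField R)) M (n + rs.length + 1)) =
        Module.length R (Abelian.Ext
          (ModuleCat.of R (QuotSMulTop x (Abelian.Ext M (ModuleCat.of R R) c)))
          (ModuleCat.of R (ResidueField R)) n) := by
      rw [← length_ext_quotSMulTop_right hreg'.1 hk, ih hm' (M := ModuleCat.of R (QuotSMulTop x M))
        hreg'.2 hM' (c := c + 1) (by omega)]
      exact (nonempty_extEquiv (LinearEquiv.toModuleIso hq.some.symm) (Iso.refl _) n).some.length_eq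
    have hfin (n : ℕ) :
        Module.length R (Abelian.Ext (ModuleCat.of R (ResidueField R)) M n) ≠ ⊤ :=
      Module.length_ne_top_iff.mpr (isFiniteLength_of_smul_eq_zero fun r hr ↦
        smul_ext_eq_zero_left (smul_residueField hr))
    induction i with
    | zero =>
      have := subsingleton_ext_of_isWeaklyRegular hreg (ModuleCat.of R (ResidueField R))
        (fun r hr ↦ ⟨1, fun y ↦ by rw [pow_one]; exact smul_residueField (hm r hr) y⟩)
        (0 + rs.length) (by simp)
      have h3 := h2 0
      rw [Module.length_eq_zero (M := Abelian.Ext (ModuleCat.of R (ResidueField R)) M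
        (0 + rs.length)), zero_add] at h3
      exact h3.trans (length_ext_zero_quotSMulTop_left
        (N := ModuleCat.of R (Abelian.Ext M (ModuleCat.of R R) c)) hω hk)
    | succ i ihi =>
      have h3 := (h2 (i + 1)).trans (length_ext_quotSMulTop_left
        (N := ModuleCat.of R (Abelian.Ext M (ModuleCat.of R R) c)) hω hk i)
      rw [← ihi, List.length_cons, show i + 1 + rs.length = i + (rs.length + 1) by omega] at h3
      have h4 := ENat.add_right_injective_of_ne_top (hfin _) h3
      rw [← h4, List.length_cons, show i + 1 + (rs.length + 1) = i + (rs.length + 1) + 1 by omega]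

end CohenMacaulay

section Height

variable {R : Type} [CommRing R]

lemma height_add_length_le (l : LTSeries (PrimeSpectrum R)) :
    l.head.asIdeal.height + l.length ≤ l.last.asIdeal.height := by
  have (i : ℕ) (hi : i < l.length + 1) :
      l.head.asIdeal.height + i ≤ (l ⟨i, hi⟩).asIdeal.height := by
    induction i with
    | zero => simp [RelSeries.head]
    | succ i ih =>
      rw [Nat.cast_succ, ← add_assoc]
      exact (add_le_add_left (ih (by omega)) 1).trans
        (Ideal.height_add_one_le_of_lt_of_isPrime (l.step ⟨i, by omega⟩))
  exact this l.length (by omega)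

lemma idealHt_le_height {J p : Ideal R} [p.IsPrime] (h : J ≤ p) :
    idealHt R J ≤ ((p.height : ℕ∞) : WithBot ℕ∞) := by
  obtain ⟨q, hq, hqp⟩ := Ideal.exists_minimalPrimes_le h
  have := hq.1.1
  have h0 : idealHt R J ≤ ringKrullDim (Localization.AtPrime q) := sInf_le ⟨⟨q, this⟩, hq, rfl⟩
  refine h0.trans ?_
  rw [IsLocalization.AtPrime.ringKrullDim_eq_height q]
  exact WithBot.coe_le_coe.mpr (Ideal.height_mono hqp)

lemma add_le_of_idealHt_eq {J : Ideal R} {g t d : ℕ}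
    (hg : idealHt R J = (g : WithBot (WithTop ℕ))) (ht : ringKrullDim (R ⧸ J) = t)
    (hd : ringKrullDim R = d) : g + t ≤ d := by
  obtain ⟨l, hl⟩ := Order.le_krullDim_iff.mp ht.ge
  have hmono : StrictMono (PrimeSpectrum.comap (Ideal.Quotient.mk J)) :=
    (RingHom.strictMono_comap_of_surjective Ideal.Quotient.mk_surjective)
  have h1 := height_add_length_le (l.map _ hmono)
  have h2 : idealHt R J ≤ (((l.map _ hmono).head.asIdeal.height : ℕ∞) : WithBot ℕ∞) :=
    idealHt_le_height fun r hr ↦ by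
    simp [LTSeries.head_map, Ideal.Quotient.eq_zero_iff_mem.mpr hr]
  have h3 := Ideal.height_le_ringKrullDim_of_ne_top (l.map _ hmono).last.isPrime.ne_top
  rw [hg] at h2
  rw [hd] at h3
  have h4 : (g : ℕ∞) ≤ _ := WithBot.coe_le_coe.mp h2
  have h5 : _ ≤ (d : ℕ∞) := WithBot.coe_le_coe.mp h3
  have h6 : ((g + t : ℕ) : ℕ∞) ≤ d := by
    rw [Nat.cast_add, ← hl]
    exact (add_le_add_left h4 _).trans (h1.trans h5)
  exact_mod_cast h6

lemma length_le_idealHt [IsNoetherianRing R] {J : Ideal R} {rs : List R}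
    (hrs : IsWeaklyRegular R rs)
    (h : ∀ r ∈ rs, r ∈ J) : (rs.length : WithBot (WithTop ℕ)) ≤ idealHt R J := by
  refine le_sInf ?_
  rintro _ ⟨p, hp, rfl⟩
  have hreg := hrs.isRegular_of_isLocalization_of_mem (Localization.AtPrime p.asIdeal) p.asIdeal
    fun r hr ↦ hp.1.2 (h r hr)
  have hdim := ringKrullDim_add_length_eq_ringKrullDim_of_isRegular _ hreg
  rw [← hdim, List.length_map]
  have h0 : 0 ≤ ringKrullDim (Localization.AtPrime p.asIdeal ⧸
      Ideal.ofList (rs.map (algebraMap R (Localization.AtPrime p.asIdeal)))) := by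
    have : Nontrivial (Localization.AtPrime p.asIdeal ⧸
        Ideal.ofList (rs.map (algebraMap R (Localization.AtPrime p.asIdeal)))) :=
      Ideal.Quotient.nontrivial_iff.mpr fun h ↦ hreg.top_ne_smul (by simp [h])
    exact ringKrullDim_nonneg_of_nontrivial
  exact le_add_of_nonneg_left h0

variable [IsLocalRing R] [IsNoetherianRing R] {d : ℕ}

lemma IsGorensteinOfDim.add_eq_of_idealHt_eq (hG : IsGorensteinOfDim R d) {J : Ideal R}
    {rs : List R} (hm : ∀ r ∈ rs, r ∈ maximalIdeal R) (hreg : IsWeaklyRegular (R ⧸ J) rs)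
    (hM : IsFiniteLength R ((R ⧸ J) ⧸ (Ideal.ofList rs • ⊤ : Submodule R (R ⧸ J)))) {g : ℕ}
    (hg : idealHt R J = (g : WithBot (WithTop ℕ))) (ht : ringKrullDim (R ⧸ J) = rs.length) :
    g + rs.length = d := by
  refine le_antisymm (add_le_of_idealHt_eq hg ht hG.ringKrullDim_eq) ?_
  obtain ⟨ss, hlen, hss, hssreg⟩ := exists_isWeaklyRegular_of_subsingleton_ext
    (ModuleCat.of R (R ⧸ J)) (d - rs.length) (ModuleCat.of R R)
    fun j hj ↦ hG.subsingleton_ext hm hreg hM (Or.inl (by omega))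
  have h := length_le_idealHt hssreg (J := J) fun r hr ↦ by
    have := hss r hr
    rwa [Ideal.annihilator_quotient] at this
  rw [hg, hlen] at h
  have : d - rs.length ≤ g := by exact_mod_cast h
  omega

end Height

section ExtComparison

variable {R : Type} [CommRing R] {X Y : ModuleCat.{0} R} (P : ProjectiveResolution X)

open CochainComplex.HomComplex in
lemma extMk_zero_eq_zero_iff (f : P.complex.X 0 ⟶ Y) (hf : P.complex.d 1 0 ≫ f = 0) :
    P.extMk f 1 rfl hf = 0 ↔ f = 0 := by
  refine ⟨fun h ↦ ?_, fun h ↦ by subst h; simp⟩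
  rw [← P.extEquivCohomologyClass.apply_eq_iff_eq, P.extEquivCohomologyClass_extMk,
    P.extEquivCohomologyClass_zero, CohomologyClass.mk_eq_zero_iff,
    Cocycle.toSingleMk_mem_coboundaries_iff _ _ _ _ _ 1 (by lia)] at h
  obtain ⟨g, hg⟩ := h
  rw [← cancel_epi (P.cochainComplexXIso (-(0 : ℕ)) 0 rfl).hom]
  rw [(P.cochainComplex.isZero_of_isStrictlyLE 0 1).eq_zero_of_src g, Limits.comp_zero] at hg
  rw [← hg, Limits.comp_zero]

lemma extMk_eq_zero_iff_exists (n : ℕ) (f : P.complex.X n ⟶ Y)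
    (hf : P.complex.d (n + 1) n ≫ f = 0) :
    P.extMk f (n + 1) rfl hf = 0 ↔
      ∃ g : P.complex.X ((ComplexShape.up ℕ).prev n) ⟶ Y,
        P.complex.d n ((ComplexShape.up ℕ).prev n) ≫ g = f := by
  cases n with
  | zero =>
    rw [extMk_zero_eq_zero_iff, P.complex.shape _ _ (by simp)]
    simp [eq_comm]
  | succ n =>
    rw [CochainComplex.prev_nat_succ]
    exact P.extMk_eq_zero_iff f _ rfl hf n rfl

/-- A cocycle of the complex computing `Ext` gives an `Ext` class. -/
noncomputable def cocycleToExt (n : ℕ) :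
    LinearMap.ker (ModuleCat.Hom.hom ((P.complex.linearYonedaObj R Y).d n (n + 1))) →ₗ[R]
      Abelian.Ext X Y n where
  toFun f := P.extMk (f.1 : P.complex.X n ⟶ Y) (n + 1) rfl f.2
  map_add' f g := (P.add_extMk _ _ _ rfl f.2 g.2).symm
  map_smul' r f := by
    rw [RingHom.id_apply, smul_eq_comp_mk₀]
    refine Eq.trans ?_ (P.extMk_comp_mk₀ (f.1 : P.complex.X n ⟶ Y) _ rfl f.2 (r • 𝟙 Y)).symm
    congr 1

lemma cocycleToExt_surjective (n : ℕ) : Function.Surjective (cocycleToExt (Y := Y) P n) := by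
  intro α
  obtain ⟨f, hf, h⟩ := P.extMk_surjective α (n + 1) rfl
  exact ⟨⟨f, hf⟩, h⟩

lemma nonempty_extM_equiv (n : ℕ) :
    Nonempty (ExtM R n X Y ≃ₗ[R] Abelian.Ext X Y n) := by
  let P := projectiveResolution X
  let K := P.complex.linearYonedaObj R Y
  let S := K.sc' ((ComplexShape.up ℕ).prev n) n (n + 1)
  have e : ExtM R n X Y ≅ S.moduleCatLeftHomologyData.H :=
    P.isoExt n Y ≪≫ (K.homologyIsoSc' _ n (n + 1) rfl (by simp)) ≪≫ S.moduleCatHomologyIso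
  let φ : LinearMap.ker S.g.hom →ₗ[R] Abelian.Ext X Y n := cocycleToExt (Y := Y) P n
  have h : LinearMap.range S.moduleCatToCycles = LinearMap.ker φ := by
    ext f
    rw [LinearMap.mem_ker, LinearMap.mem_range]
    refine Iff.trans ?_ (extMk_eq_zero_iff_exists P n (f.1 : P.complex.X n ⟶ Y) f.2).symm
    exact exists_congr fun g ↦ Subtype.ext_iff
  exact ⟨e.toLinearEquiv ≪≫ₗ Submodule.quotEquivOfEq _ _ h ≪≫ₗ
    φ.quotKerEquivOfSurjective (cocycleToExt_surjective P n)⟩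

end ExtComparison

section Numbers

variable {R : Type} [CommRing R] [IsLocalRing R]

lemma length_residueField_pow (b : ℕ) :
    Module.length R (Fin b → ResidueField R) = b := by
  have := isSimpleModule_residueField (R := R)
  simp

lemma length_ext_of_hasBass {M : ModuleCat.{0} R} {j b : ℕ} (h : HasBass R M j b) :
    Module.length R (Abelian.Ext (ModuleCat.of R (ResidueField R)) M j) = b := by
  obtain ⟨e⟩ := h
  obtain ⟨e'⟩ := nonempty_extM_equiv (X := ModuleCat.of R (ResidueField R)) (Y := M) j
  exact ((e'.symm ≪≫ₗ e.toLinearEquiv).length_eq).trans (length_residueField_pow b)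

lemma isGorensteinOfDim [IsNoetherianRing R] (h : IsGorensteinLocalRing R) {d : ℕ}
    (hd : (d : WithBot (WithTop ℕ)) = ringKrullDim R) : IsGorensteinOfDim R d := by
  obtain ⟨⟨rs, hm, hreg, hl⟩, d', hd', hb⟩ := h
  have hdd : d' = d := by
    have := hd'.trans hd.symm
    exact_mod_cast this
  subst hdd
  let e : (R ⧸ (⊥ : Ideal R)) ≃ₗ[R] R := Submodule.quotEquivOfEqBot _ rfl
  refine ⟨⟨rs, ?_, hm, ((e.isRegular_congr rs).mp hreg).toIsWeaklyRegular⟩, hd.symm, ?_⟩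
  · rw [ringKrullDim_eq_of_ringEquiv (RingEquiv.quotientBot R), ← hd] at hl
    exact_mod_cast hl
  · exact (length_ext_of_hasBass hb).trans (by simp)

end Numbers

section Tor

variable {R : Type} [CommRing R] (E : Type) [AddCommGroup E] [Module R E]

/-- A functional on the middle term of a short complex vanishing on the image restricts to the
homology. -/
def kerLcompToHomology (S : ShortComplex (ModuleCat.{0} R)) :
    LinearMap.ker (LinearMap.lcomp R E S.f.hom) →ₗ[R]
      ((LinearMap.ker S.g.hom ⧸ LinearMap.range S.moduleCatToCycles) →ₗ[R] E) where
  toFun φ := (LinearMap.range S.moduleCatToCycles).liftQ (φ.1 ∘ₗ (LinearMap.ker S.g.hom).subtype)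
    (by
      rintro _ ⟨x, rfl⟩
      exact DFunLike.congr_fun φ.2 x)
  map_add' φ ψ := by
    ext x
    rfl
  map_smul' r φ := by
    ext x
    rfl

lemma kerLcompToHomology_surjective [Module.Injective R E] (S : ShortComplex (ModuleCat.{0} R)) :
    Function.Surjective (kerLcompToHomology E S) := by
  intro ψ
  obtain ⟨φ, hφ⟩ := lcomp_surjective E (LinearMap.ker S.g.hom).injective_subtype
    (ψ ∘ₗ (LinearMap.range S.moduleCatToCycles).mkQ)
  have hφ (x) : φ (x : LinearMap.ker S.g.hom).1 =
      ψ ((LinearMap.range S.moduleCatToCycles).mkQ x) := DFunLike.congr_fun hφ x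
  refine ⟨⟨φ, ?_⟩, ?_⟩
  · rw [LinearMap.mem_ker]
    ext x
    have := hφ (S.moduleCatToCycles x)
    rw [(Submodule.mkQ_apply _ _).trans
      ((Submodule.Quotient.mk_eq_zero _).mpr (LinearMap.mem_range_self _ x)), map_zero] at this
    exact this
  · ext x
    exact hφ x

lemma kerLcompToHomology_eq_zero_iff [Module.Injective R E] (S : ShortComplex (ModuleCat.{0} R))
    (φ : LinearMap.ker (LinearMap.lcomp R E S.f.hom)) :
    kerLcompToHomology E S φ = 0 ↔ ∃ ψ : S.X₃ →ₗ[R] E, ψ ∘ₗ S.g.hom = φ.1 := by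
  constructor
  · intro h
    have h' : LinearMap.ker S.g.hom ≤ LinearMap.ker φ.1 := fun x hx ↦
      DFunLike.congr_fun h ((LinearMap.range S.moduleCatToCycles).mkQ ⟨x, hx⟩)
    obtain ⟨ψ, hψ⟩ := lcomp_surjective E
      (f := (LinearMap.ker S.g.hom).liftQ S.g.hom le_rfl)
      (LinearMap.ker_eq_bot.mp (Submodule.ker_liftQ_eq_bot _ _ _ le_rfl))
      ((LinearMap.ker S.g.hom).liftQ φ.1 h')
    refine ⟨ψ, ?_⟩
    ext x
    exact DFunLike.congr_fun hψ ((LinearMap.ker S.g.hom).mkQ x)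
  · rintro ⟨ψ, hψ⟩
    ext x
    have h1 : φ.1 x.1 = ψ (S.g.hom x.1) := (DFunLike.congr_fun hψ x.1).symm
    have h2 : S.g.hom x.1 = 0 := x.2
    rw [h2, map_zero] at h1
    exact h1

open TensorProduct

/-- The adjunction between tensor product and linear maps. -/
def tensorHomEquiv (K Q : Type) [AddCommGroup K] [Module R K] [AddCommGroup Q] [Module R Q] :
    (Q →ₗ[R] K →ₗ[R] E) ≃ₗ[R] (K ⊗[R] Q →ₗ[R] E) :=
  LinearMap.lflip (R₀ := R) ≪≫ₗ TensorProduct.lift.equiv (.id R) K Q E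

lemma exists_tensorComplex {W : ModuleCat.{0} R} (P : ProjectiveResolution W) (K : ModuleCat.{0} R)
    (n : ℕ) : ∃ (C : ChainComplex (ModuleCat.{0} R) ℕ)
      (Θ : ∀ i : ℕ, (P.complex.X i →ₗ[R] K →ₗ[R] E) ≃ₗ[R] (C.X i →ₗ[R] E)),
      (∀ (i j : ℕ) (f : P.complex.X j →ₗ[R] K →ₗ[R] E),
        Θ i (f ∘ₗ (P.complex.d i j).hom) = Θ j f ∘ₗ (C.d i j).hom) ∧
      Nonempty (TorM R n K W ≅ C.homology n) :=
  ⟨((MonoidalCategory.tensoringLeft (ModuleCat.{0} R)).obj K).mapHomologicalComplex _ |>.obj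
      P.complex, fun _ ↦ tensorHomEquiv E K _, fun _ _ _ ↦ TensorProduct.ext' fun _ _ ↦ rfl,
    ⟨P.isoLeftDerivedObj _ n⟩⟩

lemma nonempty_ext_hom_equiv_torM [Module.Injective R E] (W K : ModuleCat.{0} R) (n : ℕ) :
    Nonempty (Abelian.Ext W (ModuleCat.of R (K →ₗ[R] E)) n ≃ₗ[R] (TorM R n K W →ₗ[R] E)) := by
  let P := projectiveResolution W
  obtain ⟨C, Θ, hΘ, ⟨e₀⟩⟩ := exists_tensorComplex E P K n
  let S := C.sc' (n + 1) n ((ComplexShape.down ℕ).next n)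
  have e : TorM R n K W ≅ S.moduleCatLeftHomologyData.H :=
    e₀ ≪≫ (C.homologyIsoSc' (n + 1) n _ (by simp) rfl) ≪≫ S.moduleCatHomologyIso
  let Y := ModuleCat.of R (K →ₗ[R] E)
  let Z := LinearMap.ker (ModuleCat.Hom.hom ((P.complex.linearYonedaObj R Y).d n (n + 1)))
  let η : Z →ₗ[R] (P.complex.X n →ₗ[R] K →ₗ[R] E) :=
    (ModuleCat.homLinearEquiv (M := P.complex.X n) (N := Y) (S := R)).toLinearMap ∘ₗ Z.subtype
  let χ : Z →ₗ[R] LinearMap.ker (LinearMap.lcomp R E S.f.hom) :=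
    ((Θ n).toLinearMap ∘ₗ η).codRestrict _ fun f ↦ by
      have h : P.complex.d (n + 1) n ≫ (f.1 : P.complex.X n ⟶ Y) = 0 := f.2
      refine (hΘ (n + 1) n (η f)).symm.trans ?_
      exact (congrArg (fun f ↦ Θ (n + 1) (ModuleCat.Hom.hom f)) h).trans (map_zero (Θ (n + 1)))
  have hχ : Function.Surjective χ := by
    intro φ
    refine ⟨⟨ModuleCat.ofHom ((Θ n).symm φ.1), ?_⟩, Subtype.ext ((Θ n).apply_symm_apply _)⟩
    refine ModuleCat.hom_ext ((Θ (n + 1)).injective ?_)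
    refine (hΘ (n + 1) n _).trans (Eq.trans ?_ (map_zero (Θ (n + 1))).symm)
    exact (congrArg (· ∘ₗ (C.d (n + 1) n).hom) ((Θ n).apply_symm_apply _)).trans φ.2
  let κ := kerLcompToHomology E S ∘ₗ χ
  have h : LinearMap.ker (cocycleToExt (Y := Y) P n) = LinearMap.ker κ := by
    ext f
    rw [LinearMap.mem_ker, LinearMap.mem_ker]
    refine (extMk_eq_zero_iff_exists P n (f.1 : P.complex.X n ⟶ Y) f.2).trans
      (Iff.trans ?_ (kerLcompToHomology_eq_zero_iff E S (χ f)).symm)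
    constructor
    · rintro ⟨g, hg⟩
      refine ⟨Θ _ g.hom, (hΘ _ _ _).symm.trans ?_⟩
      exact congrArg (fun f ↦ Θ n (ModuleCat.Hom.hom f)) hg
    · rintro ⟨ψ, hψ⟩
      refine ⟨ModuleCat.ofHom ((Θ _).symm ψ), ModuleCat.hom_ext ((Θ n).injective ?_)⟩
      refine (hΘ _ _ _).trans (Eq.trans ?_ hψ)
      exact congrArg (· ∘ₗ (C.d n _).hom) ((Θ _).apply_symm_apply ψ)
  exact ⟨((cocycleToExt (Y := Y) P n).quotKerEquivOfSurjective
    (cocycleToExt_surjective P n)).symm ≪≫ₗ Submodule.quotEquivOfEq _ _ h ≪≫ₗ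
    κ.quotKerEquivOfSurjective ((kerLcompToHomology_surjective E S).comp hχ) ≪≫ₗ
    e.toLinearEquiv.symm.congrLeft E R⟩

end Tor

section Main

variable {R : Type} [CommRing R] [IsLocalRing R]

lemma length_ext_of_hasBetti {W : ModuleCat.{0} R} {i b : ℕ} (h : HasBetti R W i b) :
    Module.length R (Abelian.Ext W (ModuleCat.of R (ResidueField R)) i) = b := by
  obtain ⟨e⟩ := h
  obtain ⟨E, _, _, _, ⟨eE⟩⟩ := exists_injective_residueField R
  obtain ⟨e₁⟩ := nonempty_extEquiv (Iso.refl W) eE.toModuleIso i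
  obtain ⟨e₂⟩ := nonempty_ext_hom_equiv_torM E W (ModuleCat.of R (ResidueField R)) i
  have e₃ : (TorM R i (ModuleCat.of R (ResidueField R)) W →ₗ[R] E) ≃ₗ[R]
      (Fin b → ResidueField R) :=
    e.toLinearEquiv.congrLeft E R ≪≫ₗ
      (LinearMap.lsum R (fun _ : Fin b ↦ ResidueField R) R).symm ≪≫ₗ
      LinearEquiv.piCongrRight fun _ ↦ eE
  exact (e₁.symm ≪≫ₗ e₂ ≪≫ₗ e₃).length_eq.trans (length_residueField_pow b)

end Main

section Canonical

variable {R : Type} [CommRing R] [IsNoetherianRing R] [IsLocalRing R]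

lemma isFiniteLength_quotient_of_isRegular {J : Ideal R} {rs : List R}
    (hreg : IsRegular (R ⧸ J) rs)
    (hl : (rs.length : WithBot (WithTop ℕ)) = ringKrullDim (R ⧸ J)) :
    IsFiniteLength R ((R ⧸ J) ⧸ (Ideal.ofList rs • ⊤ : Submodule R (R ⧸ J))) := by
  have hdim := Module.supportDim_add_length_eq_supportDim_of_isRegular rs hreg
  rw [Module.supportDim_quotient_eq_ringKrullDim] at hdim
  let f := (Ideal.ofList rs • ⊤ : Submodule R (R ⧸ J)).mkQ ∘ₗ J.mkQ
  have hf : Function.Surjective f :=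
    (Submodule.mkQ_surjective _).comp (Submodule.mkQ_surjective _)
  let e := f.quotKerEquivOfSurjective hf
  refine e.isFiniteLength (isFiniteLength_quotient_of_ringKrullDim_le (le_of_eq ?_))
  rw [← Module.supportDim_quotient_eq_ringKrullDim, Module.supportDim_eq_of_equiv e]
  have : (rs.length : WithBot ℕ∞) = 0 + rs.length := (zero_add _).symm
  exact ENat.WithBot.add_natCast_cancel.mp (hdim.trans (hl.symm.trans this))

end Canonical

end BassBetti

theorem stmt14 (R : Type) [CommRing R] [IsNoetherianRing R] [IsLocalRing R]
    (hGor : IsGorensteinLocalRing R)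
    (d : ℕ) (hd : (d : WithBot (WithTop ℕ)) = ringKrullDim R)
    (J : Ideal R) (g : ℕ) (hht : idealHt R J = (g : WithBot (WithTop ℕ)))
    (hCMJ : IsCMQuot R J) :
    ∀ i b b' : ℕ,
      HasBetti R (ExtM R g (ModuleCat.of R (R ⧸ J)) (ModuleCat.of R R)) i b →
      HasBass R (ModuleCat.of R (R ⧸ J)) (d - g + i) b' → b = b' := by
  intro i b b' hb hb'
  have hG := BassBetti.isGorensteinOfDim hGor hd
  obtain ⟨rs, hm, hreg, hl⟩ := hCMJ
  have hfin := BassBetti.isFiniteLength_quotient_of_isRegular hreg hl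
  have hgd := hG.add_eq_of_idealHt_eq hm hreg.toIsWeaklyRegular hfin hht hl.symm
  obtain ⟨e⟩ := BassBetti.nonempty_extM_equiv (X := ModuleCat.of R (R ⧸ J))
    (Y := ModuleCat.of R R) g
  obtain ⟨e'⟩ := BassBetti.nonempty_extEquiv e.toModuleIso
    (Iso.refl (ModuleCat.of R (ResidueField R))) i
  have h₁ := e'.length_eq.symm.trans (BassBetti.length_ext_of_hasBetti hb)
  have h₂ := BassBetti.length_ext_of_hasBass hb'
  rw [show d - g + i = i + rs.length by omega] at h₂
  have h := hG.length_ext_eq hm (M := ModuleCat.of R (R ⧸ J)) hreg.toIsWeaklyRegular hfin hgd i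
  exact_mod_cast h₁.symm.trans (h.symm.trans h₂)
end
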